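/- Let 𝔽 be a finite field, let n ≥ 4 be an integer, and let f be a homogeneous polynomial of degree 3 in n+1 variables over 𝔽 defining a smooth cubic hypersurface X ⊂ Pⁿ_𝔽. Then the greatest common divisor of the set of degrees [L:𝔽], where L runs over the finite field extensions of 𝔽 such that X contains an L-line — i.e., such that there exist two linearly independent vectors v, w ∈ L^{n+1} with f(s·v + t·w) = 0 for all s, t ∈ L — is equal to 1. -/

import Mathlib

namespace CubicLines

section Vectors

variable {ι A R : Type*} [CommRing A] [CommRing R]

/-- Change of the ring of coefficients. -/
def mapc (φ : A →+* R) (c : ι → ι → ι → A) : ι → ι → ι → R := fun i j k => φ (c i j k)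

lemma mapc_apply (φ : A →+* R) (c : ι → ι → ι → A) (i j k : ι) :
    mapc φ c i j k = φ (c i j k) := rfl

variable (φ : A →+* R)

lemma comp_add (x y : ι → A) : φ ∘ (x + y) = φ ∘ x + φ ∘ y := by ext; simp
lemma comp_smul (r : A) (x : ι → A) : φ ∘ (r • x) = φ r • (φ ∘ x) := by ext; simp
lemma comp_zero : φ ∘ (0 : ι → A) = 0 := by ext; simp

/-- Linear independence of two vectors. -/
def Indep (v w : ι → A) : Prop := ∀ a b : A, a • v + b • w = 0 → a = 0 ∧ b = 0

end Vectors

section CubicForms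

variable {ι A R : Type*} [Fintype ι] [CommRing A] [CommRing R]

/-- The trilinear form with coefficients `c`. -/
def T (c : ι → ι → ι → A) (x y z : ι → A) : A := ∑ i, ∑ j, ∑ k, c i j k * x i * y j * z k

/-- The cubic form attached to the trilinear form with coefficients `c`. -/
def F (c : ι → ι → ι → A) (x : ι → A) : A := T c x x x

/-- The derivative at `x` in the direction `y` of the cubic form. -/
def D (c : ι → ι → ι → A) (x y : ι → A) : A := T c y x x + T c x y x + T c x x y

/-- The full polarization of the cubic form. -/
def B (c : ι → ι → ι → A) (x y z : ι → A) : A :=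
  T c x y z + T c x z y + T c y x z + T c y z x + T c z x y + T c z y x

variable (c : ι → ι → ι → A) (φ : A →+* R)

lemma T_add₁ (x x' y z : ι → A) : T c (x + x') y z = T c x y z + T c x' y z := by
  simp only [T, ← Finset.sum_add_distrib, Pi.add_apply, mul_add, add_mul]
lemma T_add₂ (x y y' z : ι → A) : T c x (y + y') z = T c x y z + T c x y' z := by
  simp only [T, ← Finset.sum_add_distrib, Pi.add_apply, mul_add, add_mul]
lemma T_add₃ (x y z z' : ι → A) : T c x y (z + z') = T c x y z + T c x y z' := by
  simp only [T, ← Finset.sum_add_distrib, Pi.add_apply, mul_add]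
lemma T_smul₁ (r : A) (x y z : ι → A) : T c (r • x) y z = r * T c x y z := by
  simp only [T, Finset.mul_sum, Pi.smul_apply, smul_eq_mul]
  exact Finset.sum_congr rfl fun _ _ => Finset.sum_congr rfl fun _ _ =>
    Finset.sum_congr rfl fun _ _ => by ring
lemma T_smul₂ (r : A) (x y z : ι → A) : T c x (r • y) z = r * T c x y z := by
  simp only [T, Finset.mul_sum, Pi.smul_apply, smul_eq_mul]
  exact Finset.sum_congr rfl fun _ _ => Finset.sum_congr rfl fun _ _ =>
    Finset.sum_congr rfl fun _ _ => by ring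
lemma T_smul₃ (r : A) (x y z : ι → A) : T c x y (r • z) = r * T c x y z := by
  simp only [T, Finset.mul_sum, Pi.smul_apply, smul_eq_mul]
  exact Finset.sum_congr rfl fun _ _ => Finset.sum_congr rfl fun _ _ =>
    Finset.sum_congr rfl fun _ _ => by ring

lemma T_map (x y z : ι → A) :
    T (mapc φ c) (φ ∘ x) (φ ∘ y) (φ ∘ z) = φ (T c x y z) := by
  simp [T, mapc, map_sum]
lemma F_map (x : ι → A) : F (mapc φ c) (φ ∘ x) = φ (F c x) := T_map c φ x x x
lemma D_map (x y : ι → A) : D (mapc φ c) (φ ∘ x) (φ ∘ y) = φ (D c x y) := by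
  simp only [D, T_map, map_add]
lemma B_map (x y z : ι → A) : B (mapc φ c) (φ ∘ x) (φ ∘ y) (φ ∘ z) = φ (B c x y z) := by
  simp only [B, T_map, map_add]

lemma D_add_right (x y z : ι → A) : D c x (y + z) = D c x y + D c x z := by
  simp only [D, T_add₁, T_add₂, T_add₃]; ring
lemma D_smul_right (r : A) (x y : ι → A) : D c x (r • y) = r * D c x y := by
  simp only [D, T_smul₁, T_smul₂, T_smul₃]; ring
lemma D_add_left (x y z : ι → A) : D c (x + y) z = D c x z + B c x y z + D c y z := by
  simp only [D, B, T_add₁, T_add₂, T_add₃]; ring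
lemma D_smul_left (r : A) (x y : ι → A) : D c (r • x) y = r ^ 2 * D c x y := by
  simp only [D, T_smul₁, T_smul₂, T_smul₃]; ring
lemma F_add (x y : ι → A) : F c (x + y) = F c x + D c x y + D c y x + F c y := by
  simp only [F, D, T_add₁, T_add₂, T_add₃]; ring
lemma F_smul (r : A) (x : ι → A) : F c (r • x) = r ^ 3 * F c x := by
  simp only [F, T_smul₁, T_smul₂, T_smul₃]; ring
lemma B_add₁ (x x' y z : ι → A) : B c (x + x') y z = B c x y z + B c x' y z := by
  simp only [B, T_add₁, T_add₂, T_add₃]; ring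
lemma B_add₂ (x y y' z : ι → A) : B c x (y + y') z = B c x y z + B c x y' z := by
  simp only [B, T_add₁, T_add₂, T_add₃]; ring
lemma B_add₃ (x y z z' : ι → A) : B c x y (z + z') = B c x y z + B c x y z' := by
  simp only [B, T_add₁, T_add₂, T_add₃]; ring
lemma B_smul₁ (r : A) (x y z : ι → A) : B c (r • x) y z = r * B c x y z := by
  simp only [B, T_smul₁, T_smul₂, T_smul₃]; ring
lemma B_smul₂ (r : A) (x y z : ι → A) : B c x (r • y) z = r * B c x y z := by
  simp only [B, T_smul₁, T_smul₂, T_smul₃]; ring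
lemma B_smul₃ (r : A) (x y z : ι → A) : B c x y (r • z) = r * B c x y z := by
  simp only [B, T_smul₁, T_smul₂, T_smul₃]; ring
lemma B_swap₁₂ (x y z : ι → A) : B c x y z = B c y x z := by simp only [B]; ring
lemma B_swap₂₃ (x y z : ι → A) : B c x y z = B c x z y := by simp only [B]; ring
lemma B_diag₁₂ (x z : ι → A) : B c x x z = 2 * D c x z := by simp only [B, D]; ring
lemma B_diag₁₃ (x z : ι → A) : B c x z x = 2 * D c x z := by simp only [B, D]; ring
lemma B_diag₂₃ (x z : ι → A) : B c z x x = 2 * D c x z := by simp only [B, D]; ring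
lemma D_self (x : ι → A) : D c x x = 3 * F c x := by simp only [F, D]; ring
lemma F_zero : F c 0 = 0 := by simpa using F_smul c 0 0
lemma D_zero_right (x : ι → A) : D c x 0 = 0 := by simpa using D_smul_right c 0 x 0

/-- No point of the cubic `F c = 0` with coordinates in the ground ring is singular. -/
def Smooth : Prop := ∀ x, F c x = 0 → (∀ y, D c x y = 0) → x = 0

/-- The vectors `v` and `w` span a line contained in the cubic. -/
def IsLine (v w : ι → A) : Prop :=
  Indep v w ∧ F c v = 0 ∧ D c v w = 0 ∧ D c w v = 0 ∧ F c w = 0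

variable {c}

lemma IsLine.F_eq_zero {v w : ι → A} (h : IsLine c v w) (a b : A) : F c (a • v + b • w) = 0 := by
  obtain ⟨-, h1, h2, h3, h4⟩ := h
  simp only [F_add, F_smul, D_smul_left, D_smul_right, h1, h2, h3, h4]; ring

lemma IsLine.D_eq_zero {v w : ι → A} (h : IsLine c v w) (a b a' b' : A) :
    D c (a • v + b • w) (a' • v + b' • w) = 0 := by
  obtain ⟨-, h1, h2, h3, h4⟩ := h
  simp only [D_add_left, D_add_right, D_smul_left, D_smul_right, B_smul₂,
    B_diag₂₃, D_self, B_swap₁₂, h1, h2, h3, h4]; ring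

end CubicForms

section TangentLines

variable {ι E L : Type*} [Fintype ι] [Field E] [Field L]

/-- There is a line in the cubic on which the derivative at `y` vanishes. -/
def TangentLine (c : ι → ι → ι → E) (y : ι → E) : Prop :=
  ∃ v w, IsLine c v w ∧ D c y v = 0 ∧ D c y w = 0

lemma tangentLine_of_rational_direction (φ : E →+* L) {c : ι → ι → ι → E} {y z₀ : ι → E}
    {z : ι → L} {μ ν : L} (hz : z = μ • φ ∘ z₀ + ν • φ ∘ y) (hi : Indep (φ ∘ y) z)
    (hy : F c y = 0) (hD : D (mapc φ c) (φ ∘ y) z = 0) (hQ : D (mapc φ c) z (φ ∘ y) = 0)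
    (hF : F (mapc φ c) z = 0) : TangentLine c y := by
  have hμ : μ ≠ 0 := by
    rintro rfl
    have := hi ν (-1) (by rw [hz]; simp)
    simp at this
  have hDy : D c y y = 0 := by rw [D_self, hy, mul_zero]
  subst hz
  have h1 : D c y z₀ = 0 := by
    simp only [D_add_right, D_smul_right, D_map, hDy, map_zero, mul_zero, add_zero] at hD
    simpa [hμ] using hD
  have h2 : D c z₀ y = 0 := by
    simp only [D_add_left, D_smul_left, D_smul_right, B_smul₂, B_diag₂₃, D_map, hDy, h1,
      map_zero, mul_zero, add_zero] at hQ
    simpa [hμ] using hQ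
  have h3 : F c z₀ = 0 := by
    simp only [F_add, F_smul, D_smul_left, D_smul_right, D_map, F_map, h1, h2, hy,
      map_zero, mul_zero, add_zero] at hF
    simpa [hμ] using hF
  refine ⟨y, z₀, ⟨?_, hy, h1, h2, h3⟩, hDy, h1⟩
  intro a b hab
  have hab' : φ a • φ ∘ y + φ b • φ ∘ z₀ = 0 := by
    rw [← comp_smul, ← comp_smul, ← comp_add, hab, comp_zero]
  have := hi (μ * φ a - φ b * ν) (φ b) (by
    have : (μ * φ a - φ b * ν) • φ ∘ y + φ b • (μ • φ ∘ z₀ + ν • φ ∘ y)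
      = μ • (φ a • φ ∘ y + φ b • φ ∘ z₀) := by module
    rw [this, hab', smul_zero])
  have hb : b = 0 := by simpa using this.2
  subst hb
  simpa [hμ] using this.1

lemma exists_kernel_basis (φ : E →+* L) (p q r : E) :
    ∃ s a b s' a' b' : E, p * s + q * a + r * b = 0 ∧ p * s' + q * a' + r * b' = 0 ∧
      ∀ x x' : L, x * φ s + x' * φ s' = 0 → x * φ a + x' * φ a' = 0 →
        x * φ b + x' * φ b' = 0 → x = 0 ∧ x' = 0 := by
  by_cases hp : p = 0
  · by_cases hq : q = 0
    · exact ⟨1, 0, 0, 0, 1, 0, by simp [hp], by simp [hq], by simp +contextual⟩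
    · refine ⟨1, 0, 0, 0, -r, q, by simp [hp], by ring, ?_⟩
      simp +contextual [hq]
  · refine ⟨-q, p, 0, -r, 0, p, by ring, by ring, ?_⟩
    simp +contextual [hp]

variable [Algebra E L]

lemma tangentLine_of_quadratic_direction {c : ι → ι → ι → E} {y z₁ z₂ : ι → E} {θ : L}
    {m₁ m₀ : E} (hθ : θ ^ 2 + algebraMap E L m₁ * θ + algebraMap E L m₀ = 0) {z : ι → L}
    (hz : z = algebraMap E L ∘ z₁ + θ • algebraMap E L ∘ z₂)
    (hi : Indep (algebraMap E L ∘ y) z) (hy : F c y = 0)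
    (hD : D (mapc (algebraMap E L) c) (algebraMap E L ∘ y) z = 0)
    (hQ : D (mapc (algebraMap E L) c) z (algebraMap E L ∘ y) = 0)
    (hF : F (mapc (algebraMap E L) c) z = 0) : TangentLine c y := by
  set φ := algebraMap E L with hφ
  by_cases hrat : ∃ e, φ e = θ
  · obtain ⟨e, rfl⟩ := hrat
    refine tangentLine_of_rational_direction φ (z₀ := z₁ + e • z₂) (μ := 1) (ν := 0) ?_ hi hy hD hQ hF
    rw [hz, comp_add, comp_smul]; simp
  have hlin : ∀ a b : E, φ a + φ b * θ = 0 → a = 0 ∧ b = 0 := by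
    intro a b hab
    by_cases hb : b = 0
    · subst hb; simpa using hab
    · exfalso; apply hrat
      refine ⟨-a / b, ?_⟩
      have : φ b ≠ 0 := by simpa using hb
      rw [map_div₀, map_neg]; field_simp; linear_combination -hab
  by_cases h3 : ∀ s a b : E, s • y + a • z₁ + b • z₂ = 0 → s = 0 ∧ a = 0 ∧ b = 0
  · have hDy : D c y y = 0 := by rw [D_self, hy, mul_zero]
    rw [hz] at hD hQ hF
    simp only [D_add_right, D_smul_right, D_map] at hD
    obtain ⟨hD1, hD2⟩ := hlin (D c y z₁) (D c y z₂) (by linear_combination hD)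
    simp only [D_add_left, D_smul_left, B_smul₂, D_map, B_map] at hQ
    obtain ⟨hQ1, hQ2⟩ := hlin (D c z₁ y - m₀ * D c z₂ y) (B c z₁ z₂ y - m₁ * D c z₂ y) (by
      simp only [map_sub, map_mul]; linear_combination hQ - φ (D c z₂ y) * hθ)
    simp only [F_add, F_smul, D_smul_left, D_smul_right, D_map, F_map] at hF
    obtain ⟨hF1, hF2⟩ := hlin (F c z₁ - m₀ * D c z₂ z₁ + m₀ * m₁ * F c z₂)
      (D c z₁ z₂ - m₁ * D c z₂ z₁ + (m₁ ^ 2 - m₀) * F c z₂) (by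
      simp only [map_sub, map_mul, map_add, map_pow]
      linear_combination hF - φ (D c z₂ z₁) * hθ - φ (F c z₂) * (θ - φ m₁) * hθ)
    have e1 : D c z₁ y = m₀ * D c z₂ y := by linear_combination hQ1
    have e2 : B c y z₁ z₂ = m₁ * D c z₂ y := by
      rw [B_swap₁₂, B_swap₂₃]; linear_combination hQ2
    have e3 : F c z₁ = m₀ * (D c z₂ z₁ - m₁ * F c z₂) := by linear_combination hF1
    have e4 : D c z₁ z₂ = m₁ * D c z₂ z₁ - (m₁ ^ 2 - m₀) * F c z₂ := by linear_combination hF2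
    have key : ∀ s a b : E, F c (s • y + a • z₁ + b • z₂) = (m₀ * a ^ 2 + m₁ * a * b + b ^ 2) *
        (D c z₂ y * s + (D c z₂ z₁ - m₁ * F c z₂) * a + F c z₂ * b) := by
      intro s a b
      simp only [F_add, F_smul, D_add_left, D_add_right, D_smul_left, D_smul_right, B_smul₁,
        B_smul₂, e1, e2, e3, e4, hD1, hD2, hy]
      ring
    have key' : ∀ s a b s' a' b' : E,
        D c (s • y + a • z₁ + b • z₂) (s' • y + a' • z₁ + b' • z₂) =
        (2 * m₀ * a * a' + m₁ * (a * b' + a' * b) + 2 * b * b') *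
          (D c z₂ y * s + (D c z₂ z₁ - m₁ * F c z₂) * a + F c z₂ * b) +
        (m₀ * a ^ 2 + m₁ * a * b + b ^ 2) *
          (D c z₂ y * s' + (D c z₂ z₁ - m₁ * F c z₂) * a' + F c z₂ * b') := by
      intro s a b s' a' b'
      have e2' : B c y z₂ z₁ = m₁ * D c z₂ y := by rw [B_swap₂₃, e2]
      have e2'' : B c z₁ z₂ y = m₁ * D c z₂ y := by rw [B_swap₂₃, B_swap₁₂, e2]
      simp only [D_add_left, D_add_right, D_smul_left, D_smul_right, B_smul₁, B_add₁,
        B_smul₂, B_diag₁₃, B_diag₂₃, D_self, e1, e2, e2', e2'', e3, e4, hD1, hD2, hy]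
      ring
    obtain ⟨s, a, b, s', a', b', hk, hk', hli⟩ := exists_kernel_basis (RingHom.id E) (D c z₂ y)
      (D c z₂ z₁ - m₁ * F c z₂) (F c z₂)
    refine ⟨s • y + a • z₁ + b • z₂, s' • y + a' • z₁ + b' • z₂, ⟨?_, ?_, ?_, ?_, ?_⟩, ?_, ?_⟩
    · intro x x' hx
      obtain ⟨h1, h2, h3⟩ := h3 (x * s + x' * s') (x * a + x' * a') (x * b + x' * b') (by
        rw [← hx]; module)
      exact hli x x' h1 h2 h3
    · rw [key, hk, mul_zero]
    · rw [key', hk, hk', mul_zero, mul_zero, add_zero]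
    · rw [key', hk, hk', mul_zero, mul_zero, add_zero]
    · rw [key, hk', mul_zero]
    · simp only [D_add_right, D_smul_right, hDy, hD1, hD2]; ring
    · simp only [D_add_right, D_smul_right, hDy, hD1, hD2]; ring
  · push Not at h3
    obtain ⟨s, a, b, hsab, hne⟩ := h3
    have hφ' : φ s • φ ∘ y + φ a • φ ∘ z₁ + φ b • φ ∘ z₂ = 0 := by
      simp only [← comp_smul, ← comp_add, hsab, comp_zero]
    by_cases hb : b = 0
    · subst hb
      have ha : a ≠ 0 := by
        rintro rfl
        have h0 := hi (φ s) 0 (by simpa using hφ')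
        exact hne (by simpa using h0.1) rfl rfl
      have ha' : φ a ≠ 0 := by simpa using ha
      refine tangentLine_of_rational_direction φ (z₀ := z₂) (μ := θ) (ν := - φ s / φ a) ?_
        hi hy hD hQ hF
      have : φ ∘ z₁ = (-φ s / φ a) • φ ∘ y := by
        rw [map_zero, zero_smul, add_zero] at hφ'
        have h := congrArg ((φ a)⁻¹ • ·) hφ'
        simp only [smul_add, smul_smul, smul_zero, inv_mul_cancel₀ ha', one_smul] at h
        rw [eq_neg_of_add_eq_zero_right h, ← neg_smul]; congr 1; ring
      rw [hz, this, add_comm]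
    · have hb' : φ b ≠ 0 := by simpa using hb
      refine tangentLine_of_rational_direction φ (z₀ := z₁) (μ := 1 - θ * φ a / φ b)
        (ν := - θ * φ s / φ b) ?_ hi hy hD hQ hF
      have : φ ∘ z₂ = (-φ s / φ b) • φ ∘ y + (-φ a / φ b) • φ ∘ z₁ := by
        have h := congrArg ((φ b)⁻¹ • ·) hφ'
        simp only [smul_add, smul_smul, smul_zero, inv_mul_cancel₀ hb', one_smul] at h
        rw [eq_neg_of_add_eq_zero_right h, neg_add, ← neg_smul, ← neg_smul]; congr 2 <;> ring
      rw [hz, this]; module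

section Resultant

variable {A R : Type*} [CommRing A] [CommRing R]

/-- Linear coefficient of the remainder of `F c (x e₁ + w)` modulo `D c (x e₁ + w) y`. -/
def remLin (c : ι → ι → ι → A) (y e₁ w : ι → A) : A :=
  F c e₁ * B c e₁ w y ^ 2 - D c e₁ y * F c e₁ * D c w y - D c e₁ y * D c e₁ w * B c e₁ w y +
    D c e₁ y ^ 2 * D c w e₁

/-- Constant coefficient of the remainder of `F c (x e₁ + w)` modulo `D c (x e₁ + w) y`. -/
def remConst (c : ι → ι → ι → A) (y e₁ w : ι → A) : A :=
  F c e₁ * B c e₁ w y * D c w y + D c e₁ y ^ 2 * F c w - D c e₁ y * D c e₁ w * D c w y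

/-- Up to a factor, the resultant of `F c (x e₁ + w)` and `D c (x e₁ + w) y` with respect
to `x`. -/
def res (c : ι → ι → ι → A) (y e₁ w : ι → A) : A :=
  D c e₁ y * remConst c y e₁ w ^ 2 - B c e₁ w y * remLin c y e₁ w * remConst c y e₁ w +
    D c w y * remLin c y e₁ w ^ 2

lemma res_map (φ : A →+* R) (c : ι → ι → ι → A) (y e₁ w : ι → A) :
    res (mapc φ c) (φ ∘ y) (φ ∘ e₁) (φ ∘ w) = φ (res c y e₁ w) := by
  simp only [res, remConst, remLin, D_map, B_map, F_map, map_add, map_sub, map_mul, map_pow]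

lemma division_identity (c : ι → ι → ι → A) (y e₁ w : ι → A) (x : A) :
    D c e₁ y ^ 2 * F c (x • e₁ + w) =
      (D c e₁ y * F c e₁ * x + D c e₁ y * D c e₁ w - F c e₁ * B c e₁ w y) *
        D c (x • e₁ + w) y + x * remLin c y e₁ w + remConst c y e₁ w := by
  simp only [remConst, remLin, F_add, D_add_left, D_smul_left, D_smul_right, B_smul₁, F_smul]
  ring

end Resultant

lemma mem_adjoin_quadratic {θ : L} {m₁ m₀ : E}
    (hθ : θ ^ 2 + algebraMap E L m₁ * θ + algebraMap E L m₀ = 0) {x : L}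
    (hx : x ∈ Algebra.adjoin E {θ}) :
    ∃ a b : E, x = algebraMap E L a + θ * algebraMap E L b := by
  induction hx using Algebra.adjoin_induction with
  | mem x hx => exact ⟨0, 1, by simpa using hx⟩
  | algebraMap r => exact ⟨r, 0, by simp⟩
  | add x y _ _ hx hy =>
    obtain ⟨a, b, rfl⟩ := hx
    obtain ⟨a', b', rfl⟩ := hy
    exact ⟨a + a', b + b', by simp only [map_add]; ring⟩
  | mul x y _ _ hx hy =>
    obtain ⟨a, b, rfl⟩ := hx
    obtain ⟨a', b', rfl⟩ := hy
    refine ⟨a * a' - b * b' * m₀, a * b' + a' * b - b * b' * m₁, ?_⟩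
    simp only [map_add, map_sub, map_mul]
    linear_combination algebraMap E L b * algebraMap E L b' * hθ

lemma T_mem (S : Subalgebra E L) {c : ι → ι → ι → L} {x y z : ι → L}
    (hc : ∀ i j k, c i j k ∈ S) (hx : ∀ i, x i ∈ S) (hy : ∀ i, y i ∈ S) (hz : ∀ i, z i ∈ S) :
    T c x y z ∈ S :=
  S.sum_mem fun i _ => S.sum_mem fun j _ => S.sum_mem fun k _ =>
    S.mul_mem (S.mul_mem (S.mul_mem (hc i j k) (hx i)) (hy j)) (hz k)

lemma D_mem (S : Subalgebra E L) {c : ι → ι → ι → L} {x y : ι → L}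
    (hc : ∀ i j k, c i j k ∈ S) (hx : ∀ i, x i ∈ S) (hy : ∀ i, y i ∈ S) : D c x y ∈ S :=
  add_mem (add_mem (T_mem S hc hy hx hx) (T_mem S hc hx hy hx)) (T_mem S hc hx hx hy)

lemma B_mem (S : Subalgebra E L) {c : ι → ι → ι → L} {x y z : ι → L}
    (hc : ∀ i j k, c i j k ∈ S) (hx : ∀ i, x i ∈ S) (hy : ∀ i, y i ∈ S) (hz : ∀ i, z i ∈ S) :
    B c x y z ∈ S :=
  add_mem (add_mem (add_mem (add_mem (add_mem (T_mem S hc hx hy hz) (T_mem S hc hx hz hy))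
    (T_mem S hc hy hx hz)) (T_mem S hc hy hz hx)) (T_mem S hc hz hx hy)) (T_mem S hc hz hy hx)

lemma remLin_mem (S : Subalgebra E L) {c : ι → ι → ι → L} {x y z : ι → L}
    (hc : ∀ i j k, c i j k ∈ S) (hx : ∀ i, x i ∈ S) (hy : ∀ i, y i ∈ S) (hz : ∀ i, z i ∈ S) :
    remLin c x y z ∈ S := by
  have hF : F c y ∈ S := T_mem S hc hy hy hy
  have hB := B_mem S hc hy hz hx
  have hκ := D_mem S hc hy hx
  exact add_mem (sub_mem (sub_mem (mul_mem hF (pow_mem hB 2))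
    (mul_mem (mul_mem hκ hF) (D_mem S hc hz hx))) (mul_mem (mul_mem hκ (D_mem S hc hy hz)) hB))
    (mul_mem (pow_mem hκ 2) (D_mem S hc hz hy))

lemma remConst_mem (S : Subalgebra E L) {c : ι → ι → ι → L} {x y z : ι → L}
    (hc : ∀ i j k, c i j k ∈ S) (hx : ∀ i, x i ∈ S) (hy : ∀ i, y i ∈ S) (hz : ∀ i, z i ∈ S) :
    remConst c x y z ∈ S := by
  have hF : F c y ∈ S := T_mem S hc hy hy hy
  have hF' : F c z ∈ S := T_mem S hc hz hz hz
  have hκ := D_mem S hc hy hx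
  exact sub_mem (add_mem (mul_mem (mul_mem hF (B_mem S hc hy hz hx)) (D_mem S hc hz hx))
    (mul_mem (pow_mem hκ 2) hF')) (mul_mem (mul_mem hκ (D_mem S hc hy hz)) (D_mem S hc hz hx))

variable [IsAlgClosed L]

set_option maxHeartbeats 1000000 in
/-- A root of the resultant which is at most quadratic over the ground field yields a line over
the ground field. -/
theorem tangentLine_of_res_eq_zero {c : ι → ι → ι → E} {y e₁ e₂ e₃ : ι → E}
    (hli : ∀ r₀ r₁ r₂ r₃ : L, r₀ • algebraMap E L ∘ y + r₁ • algebraMap E L ∘ e₁ +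
      r₂ • algebraMap E L ∘ e₂ + r₃ • algebraMap E L ∘ e₃ = 0 →
      r₀ = 0 ∧ r₁ = 0 ∧ r₂ = 0 ∧ r₃ = 0)
    (hy : F c y = 0) (h₁ : D c y e₁ = 0) (h₂ : D c y e₂ = 0) (h₃ : D c y e₃ = 0)
    (hκ : D c e₁ y ≠ 0) {θ : L} {m₁ m₀ : E}
    (hθ : θ ^ 2 + algebraMap E L m₁ * θ + algebraMap E L m₀ = 0)
    (hres : res (mapc (algebraMap E L) c) (algebraMap E L ∘ y) (algebraMap E L ∘ e₁)
      (algebraMap E L ∘ e₂ + θ • algebraMap E L ∘ e₃) = 0) : TangentLine c y := by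
  set φ := algebraMap E L with hφ
  have hκ' : D (mapc φ c) (φ ∘ e₁) (φ ∘ y) ≠ 0 := by rw [D_map]; simpa using hκ
  have hDy : D (mapc φ c) (φ ∘ y) (φ ∘ y) = 0 := by rw [D_map, D_self, hy]; simp
  have h₁' : D (mapc φ c) (φ ∘ y) (φ ∘ e₁) = 0 := by rw [D_map, h₁, map_zero]
  have h₂' : D (mapc φ c) (φ ∘ y) (φ ∘ e₂) = 0 := by rw [D_map, h₂, map_zero]
  have h₃' : D (mapc φ c) (φ ∘ y) (φ ∘ e₃) = 0 := by rw [D_map, h₃, map_zero]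
  have indep : ∀ x Y Z : L, ¬ (x = 0 ∧ Y = 0 ∧ Z = 0) →
      Indep (φ ∘ y) (x • φ ∘ e₁ + (Y • φ ∘ e₂ + Z • φ ∘ e₃)) := by
    intro x Y Z hne a b hab
    obtain ⟨ha, hx, hY, hZ⟩ := hli a (b * x) (b * Y) (b * Z) (by rw [← hab]; module)
    refine ⟨ha, ?_⟩
    by_contra hb
    simp only [mul_eq_zero, hb, false_or] at hx hY hZ
    exact hne ⟨hx, hY, hZ⟩
  set w := φ ∘ e₂ + θ • φ ∘ e₃ with hw
  have hdiv := fun (x : L) (w : ι → L) => division_identity (mapc φ c) (φ ∘ y) (φ ∘ e₁) w x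
  by_cases hA : remLin (mapc φ c) (φ ∘ y) (φ ∘ e₁) w = 0
  swap
  · set a := remLin (mapc φ c) (φ ∘ y) (φ ∘ e₁) w with ha
    set b := remConst (mapc φ c) (φ ∘ y) (φ ∘ e₁) w with hb
    have hmem : ∀ x : ι → L, (∀ i, x i ∈ Algebra.adjoin E {θ}) →
        ∃ z₁ z₂ : ι → E, x = φ ∘ z₁ + θ • φ ∘ z₂ := by
      intro x hx
      choose z₁ z₂ h using fun i => mem_adjoin_quadratic hθ (hx i)
      exact ⟨z₁, z₂, funext h⟩
    have hθS : θ ∈ Algebra.adjoin E {θ} := Algebra.subset_adjoin rfl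
    have hφS : ∀ x : ι → E, ∀ i, (φ ∘ x) i ∈ Algebra.adjoin E {θ} := fun x i =>
      Subalgebra.algebraMap_mem _ _
    have hwS : ∀ i, w i ∈ Algebra.adjoin E {θ} := fun i =>
      add_mem (hφS _ _) (mul_mem hθS (hφS _ _))
    have hcS : ∀ i j k, mapc φ c i j k ∈ Algebra.adjoin E {θ} := fun i j k =>
      Subalgebra.algebraMap_mem _ _
    have haS : a ∈ Algebra.adjoin E {θ} := remLin_mem _ hcS (hφS y) (hφS e₁) hwS
    have hbS : b ∈ Algebra.adjoin E {θ} := remConst_mem _ hcS (hφS y) (hφS e₁) hwS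
    obtain ⟨z₁, z₂, hz⟩ := hmem (-b • φ ∘ e₁ + a • w) fun i =>
      add_mem (mul_mem (neg_mem hbS) (hφS _ _)) (mul_mem haS (hwS _))
    have hD0 : D (mapc φ c) (-b • φ ∘ e₁ + a • w) (φ ∘ y) = 0 := by
      rw [← hres, res]
      simp only [D_add_left, D_smul_left, B_smul₁, B_smul₂, ← ha, ← hb]; ring
    refine tangentLine_of_quadratic_direction hθ hz ?_ hy ?_ hD0 ?_
    · have := indep (-b) a (a * θ) (by simp [hA])
      convert this using 2
      rw [hw]; module
    · simp only [← hφ, hw, D_add_right, D_smul_right, h₁', h₂', h₃']; ring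
    · have h := hdiv (-b / a) w
      have e : -b • φ ∘ e₁ + a • w = a • ((-b / a) • φ ∘ e₁ + w) := by
        conv_rhs => rw [smul_add, smul_smul, mul_div_cancel₀ _ hA]
      rw [e, D_smul_left, mul_eq_zero, or_iff_right (pow_ne_zero _ hA)] at hD0
      rw [e, F_smul]
      rw [hD0, ← ha, ← hb, div_mul_cancel₀ _ hA] at h
      have : F (mapc φ c) ((-b / a) • φ ∘ e₁ + w) = 0 := by
        have h' : D (mapc φ c) (φ ∘ e₁) (φ ∘ y) ^ 2 *
          F (mapc φ c) ((-b / a) • φ ∘ e₁ + w) = 0 := by rw [h]; ring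
        exact (mul_eq_zero.mp h').resolve_left (pow_ne_zero _ hκ')
      rw [this, mul_zero]
  have hA' : remConst (mapc φ c) (φ ∘ y) (φ ∘ e₁) w = 0 := by
    rw [res, hA] at hres
    simpa [hκ'] using hres
  have quad_root : ∀ p q r : L, p ≠ 0 → ∃ x : L, p * x ^ 2 + q * x + r = 0 := by
    intro p q r hp
    obtain ⟨x, hx⟩ := IsAlgClosed.exists_root
      (Polynomial.C p * Polynomial.X ^ 2 + Polynomial.C q * Polynomial.X + Polynomial.C r)
      (by rw [Polynomial.degree_quadratic hp]; decide)
    exact ⟨x, by simpa using hx⟩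
  by_cases hrat : ∃ e, φ e = θ
  · obtain ⟨e, rfl⟩ := hrat
    have hw' : w = φ ∘ (e₂ + e • e₃) := by rw [comp_add, comp_smul]
    obtain ⟨x, hx⟩ := quad_root (φ (D c e₁ y)) (φ (B c e₁ (e₂ + e • e₃) y))
      (φ (D c (e₂ + e • e₃) y)) (by simpa using hκ)
    have hD0 : D (mapc φ c) (x • φ ∘ e₁ + w) (φ ∘ y) = 0 := by
      rw [← hx]
      simp only [D_add_left, D_smul_left, B_smul₁, hw', D_map, B_map]; ring
    refine tangentLine_of_quadratic_direction (θ := x) (m₁ := B c e₁ (e₂ + e • e₃) y / D c e₁ y)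
      (m₀ := D c (e₂ + e • e₃) y / D c e₁ y) ?_ (z := x • φ ∘ e₁ + w) (by rw [hw', add_comm]) ?_ hy
      ?_ hD0 ?_
    · have : φ (D c e₁ y) ≠ 0 := by simpa using hκ
      simp only [← hφ, map_div₀]; field_simp; linear_combination hx
    · simpa [hw] using indep x 1 (φ e) (by simp)
    · simp only [← hφ, hw, D_add_right, D_smul_right, h₁', h₂', h₃']; ring
    · have h := hdiv x w
      rw [hD0, hA, hA'] at h
      simpa [hκ'] using h
  have hlin : ∀ a b : E, φ a + φ b * θ = 0 → a = 0 ∧ b = 0 := by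
    intro a b hab
    by_cases hb : b = 0
    · subst hb; simpa using hab
    · exfalso; apply hrat
      refine ⟨-a / b, ?_⟩
      have : φ b ≠ 0 := by simpa using hb
      rw [map_div₀, map_neg]; field_simp; linear_combination -hab
  obtain ⟨a₀, a₁, a₂, ha⟩ : ∃ a₀ a₁ a₂ : E, ∀ Y Z : L,
      remLin (mapc φ c) (φ ∘ y) (φ ∘ e₁) (Y • φ ∘ e₂ + Z • φ ∘ e₃) =
        φ a₀ * Y ^ 2 + φ a₁ * Y * Z + φ a₂ * Z ^ 2 := by
    refine ⟨remLin c y e₁ e₂, 2 * F c e₁ * B c e₁ e₂ y * B c e₁ e₃ y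
      - D c e₁ y * F c e₁ * B c e₂ e₃ y
      - D c e₁ y * (D c e₁ e₂ * B c e₁ e₃ y + D c e₁ e₃ * B c e₁ e₂ y)
      + D c e₁ y ^ 2 * B c e₂ e₃ e₁, remLin c y e₁ e₃, fun Y Z => ?_⟩
    simp only [remLin, D_add_left, D_smul_left, D_add_right, D_smul_right, B_add₂, B_smul₁,
      B_smul₂, D_map, B_map, F_map, map_add, map_sub, map_mul, map_pow, map_ofNat]
    ring
  obtain ⟨b₀, b₁, b₂, b₃, hb⟩ : ∃ b₀ b₁ b₂ b₃ : E, ∀ Y Z : L,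
      remConst (mapc φ c) (φ ∘ y) (φ ∘ e₁) (Y • φ ∘ e₂ + Z • φ ∘ e₃) =
        φ b₀ * Y ^ 3 + φ b₁ * Y ^ 2 * Z + φ b₂ * Y * Z ^ 2 + φ b₃ * Z ^ 3 := by
    refine ⟨remConst c y e₁ e₂,
      F c e₁ * (B c e₁ e₂ y * B c e₂ e₃ y + B c e₁ e₃ y * D c e₂ y) + D c e₁ y ^ 2 * D c e₂ e₃
      - D c e₁ y * (D c e₁ e₂ * B c e₂ e₃ y + D c e₁ e₃ * D c e₂ y),
      F c e₁ * (B c e₁ e₂ y * D c e₃ y + B c e₁ e₃ y * B c e₂ e₃ y) + D c e₁ y ^ 2 * D c e₃ e₂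
      - D c e₁ y * (D c e₁ e₂ * D c e₃ y + D c e₁ e₃ * B c e₂ e₃ y),
      remConst c y e₁ e₃, fun Y Z => ?_⟩
    simp only [remConst, D_add_left, D_smul_left, D_add_right, D_smul_right, B_add₂, B_smul₁,
      B_smul₂, D_map, B_map, F_map, F_add, F_smul, map_add, map_sub, map_mul, map_pow]
    ring
  have ha1 := ha 1 θ
  have hb1 := hb 1 θ
  rw [one_smul, ← hw, hA] at ha1
  rw [one_smul, ← hw, hA'] at hb1
  obtain ⟨i1, i2⟩ := hlin (a₀ - a₂ * m₀) (a₁ - a₂ * m₁) (by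
    simp only [map_sub, map_mul]; linear_combination -ha1 - φ a₂ * hθ)
  obtain ⟨i3, i4⟩ := hlin (b₀ - b₂ * m₀ + b₃ * m₀ * m₁) (b₁ - b₂ * m₁ + b₃ * (m₁ ^ 2 - m₀)) (by
    simp only [map_sub, map_mul, map_add, map_pow]
    linear_combination -hb1 - φ b₂ * hθ - φ b₃ * (θ - φ m₁) * hθ)
  replace i1 := congrArg φ i1
  replace i2 := congrArg φ i2
  replace i3 := congrArg φ i3
  replace i4 := congrArg φ i4
  simp only [map_sub, map_mul, map_add, map_pow, map_zero] at i1 i2 i3 i4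
  have key : ∀ x Y Z : L, φ a₂ * x + φ (b₂ - b₃ * m₁) * Y + φ b₃ * Z = 0 →
      D (mapc φ c) (x • φ ∘ e₁ + (Y • φ ∘ e₂ + Z • φ ∘ e₃)) (φ ∘ y) = 0 →
      F (mapc φ c) (x • φ ∘ e₁ + (Y • φ ∘ e₂ + Z • φ ∘ e₃)) = 0 := by
    intro x Y Z hk hD0
    have h := hdiv x (Y • φ ∘ e₂ + Z • φ ∘ e₃)
    rw [hD0, ha, hb] at h
    have h' : D (mapc φ c) (φ ∘ e₁) (φ ∘ y) ^ 2 *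
        F (mapc φ c) (x • φ ∘ e₁ + (Y • φ ∘ e₂ + Z • φ ∘ e₃)) = 0 := by
      rw [h]
      simp only [map_sub, map_mul] at hk
      linear_combination (φ m₀ * Y ^ 2 + φ m₁ * Y * Z + Z ^ 2) * hk + x * Y ^ 2 * i1 +
        x * Y * Z * i2 + Y ^ 3 * i3 + Y ^ 2 * Z * i4
    exact (mul_eq_zero.mp h').resolve_left (pow_ne_zero _ hκ')
  obtain ⟨s, a, b, s', a', b', hk, hk', hker⟩ :=
    exists_kernel_basis φ a₂ (b₂ - b₃ * m₁) b₃
  set U := s • e₁ + (a • e₂ + b • e₃) with hU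
  set U' := s' • e₁ + (a' • e₂ + b' • e₃) with hU'
  have hφU : φ ∘ U = φ s • φ ∘ e₁ + (φ a • φ ∘ e₂ + φ b • φ ∘ e₃) := by
    simp only [hU, comp_add, comp_smul]
  have hφU' : φ ∘ U' = φ s' • φ ∘ e₁ + (φ a' • φ ∘ e₂ + φ b' • φ ∘ e₃) := by
    simp only [hU', comp_add, comp_smul]
  replace hk := congrArg φ hk
  replace hk' := congrArg φ hk'
  simp only [map_add, map_mul, map_zero] at hk hk'
  by_cases hD' : D c U' y = 0
  · refine tangentLine_of_quadratic_direction (θ := (0 : L)) (m₁ := 0) (m₀ := 0) (by simp)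
      (z := φ ∘ U') (z₁ := U') (z₂ := 0) (by simp [← hφ]) ?_ hy ?_ ?_ ?_
    · rw [hφU']
      refine indep _ _ _ fun ⟨p1, p2, p3⟩ => ?_
      have := hker 0 1 (by simp [p1]) (by simp [p2]) (by simp [p3])
      simp at this
    · rw [hφU']; simp only [← hφ, D_add_right, D_smul_right, h₁', h₂', h₃']; ring
    · rw [← hφ, D_map, hD', map_zero]
    · rw [hφU']
      refine key _ _ _ hk' ?_
      rw [← hφU', D_map, hD', map_zero]
  · obtain ⟨x, hx⟩ := quad_root (φ (D c U' y)) (φ (B c U U' y)) (φ (D c U y)) (by simpa using hD')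
    have hz : φ ∘ U + x • φ ∘ U' = (φ s + x * φ s') • φ ∘ e₁ + ((φ a + x * φ a') • φ ∘ e₂ +
        (φ b + x * φ b') • φ ∘ e₃) := by rw [hφU, hφU']; module
    have hD0 : D (mapc φ c) (φ ∘ U + x • φ ∘ U') (φ ∘ y) = 0 := by
      rw [← hx]
      simp only [D_add_left, D_smul_left, B_smul₂, D_map, B_map]; ring
    refine tangentLine_of_quadratic_direction (θ := x) (m₁ := B c U U' y / D c U' y)
      (m₀ := D c U y / D c U' y) ?_ (z := φ ∘ U + x • φ ∘ U') rfl ?_ hy ?_ hD0 ?_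
    · have : φ (D c U' y) ≠ 0 := by simpa using hD'
      simp only [← hφ, map_div₀]; field_simp; linear_combination hx
    · rw [hz]
      refine indep _ _ _ fun ⟨p1, p2, p3⟩ => ?_
      have := hker 1 x (by simpa using p1) (by simpa using p2) (by simpa using p3)
      simp at this
    · rw [hz]; simp only [← hφ, D_add_right, D_smul_right, h₁', h₂', h₃']; ring
    · rw [hz] at hD0 ⊢
      refine key _ _ _ ?_ hD0
      linear_combination hk + x * hk'

end TangentLines

end CubicLines

namespace CubicLines

open Polynomial

section Pencils

variable {κ 𝕜 : Type*} [Field 𝕜]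

lemma exists_quadratic_zero [IsAlgClosed 𝕜] (p q r : 𝕜) :
    ∃ x y : 𝕜, p * x ^ 2 + q * (x * y) + r * y ^ 2 = 0 ∧ ¬ (x = 0 ∧ y = 0) := by
  by_cases hp : p = 0
  · exact ⟨1, 0, by simp [hp], by simp⟩
  obtain ⟨x, hx⟩ := IsAlgClosed.exists_root (C p * X ^ 2 + C q * X + C r)
    (by rw [degree_quadratic hp]; decide)
  exact ⟨x, 1, by simpa using hx, by simp⟩

/-- The pencil of linear forms `x² A + xy B + y² C` has no zero. -/
def Nonvanishing (A B C : κ → 𝕜) : Prop :=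
  ∀ x y : 𝕜, (∀ i, x ^ 2 * A i + x * y * B i + y ^ 2 * C i = 0) → x = 0 ∧ y = 0

lemma Nonvanishing.not_all_mul [IsAlgClosed 𝕜] {A B C Z : κ → 𝕜} (h : Nonvanishing A B C) (a b c : 𝕜)
    (hA : ∀ i, A i = a * Z i) (hB : ∀ i, B i = b * Z i) (hC : ∀ i, C i = c * Z i) : False := by
  obtain ⟨x, y, hxy, hne⟩ := exists_quadratic_zero a b c
  exact hne (h x y fun i => by rw [hA, hB, hC]; linear_combination Z i * hxy)

lemma Nonvanishing.exists_ne {A B C : κ → 𝕜} (h : Nonvanishing A B C) :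
    (∃ i, A i ≠ 0) ∧ ∃ i, C i ≠ 0 := by
  constructor
  · by_contra! h'
    have := h 1 0 (by simp [h'])
    simp at this
  · by_contra! h'
    have := h 0 1 (by simp [h'])
    simp at this

lemma Nonvanishing.syzygy [IsAlgClosed 𝕜] {A B C : κ → 𝕜} (h : Nonvanishing A B C) {r₀ r₁ r₂ r₃ : 𝕜}
    (h₁ : ∀ i, r₀ * A i + r₁ * B i + r₂ * C i = 0)
    (h₂ : ∀ i, r₁ * A i + r₂ * B i + r₃ * C i = 0) : r₀ = 0 ∧ r₁ = 0 ∧ r₂ = 0 ∧ r₃ = 0 := by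
  obtain ⟨⟨i, hi⟩, ⟨j, hj⟩⟩ := h.exists_ne
  by_cases e1 : r₁ ^ 2 - r₀ * r₂ = 0
  swap
  · exfalso
    refine h.not_all_mul (Z := C) ((r₂ ^ 2 - r₁ * r₃) / (r₁ ^ 2 - r₀ * r₂))
      (-(r₁ * r₂ - r₀ * r₃) / (r₁ ^ 2 - r₀ * r₂)) 1 (fun i => ?_) (fun i => ?_) (by simp)
    · rw [div_mul_eq_mul_div, eq_div_iff e1]; linear_combination r₁ * h₂ i - r₂ * h₁ i
    · rw [div_mul_eq_mul_div, eq_div_iff e1]; linear_combination r₁ * h₁ i - r₀ * h₂ i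
  by_cases e3 : r₂ ^ 2 - r₁ * r₃ = 0
  swap
  · exfalso
    refine h.not_all_mul (Z := A) 1 (-(r₁ * r₂ - r₀ * r₃) / (r₂ ^ 2 - r₁ * r₃))
      ((r₁ ^ 2 - r₀ * r₂) / (r₂ ^ 2 - r₁ * r₃)) (by simp) (fun i => ?_) (fun i => ?_)
    · rw [div_mul_eq_mul_div, eq_div_iff e3]; linear_combination r₂ * h₂ i - r₃ * h₁ i
    · rw [div_mul_eq_mul_div, eq_div_iff e3]; linear_combination r₂ * h₁ i - r₁ * h₂ i
  have e2 : r₁ * r₂ - r₀ * r₃ = 0 := by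
    have : (r₁ * r₂ - r₀ * r₃) * C j = 0 := by
      linear_combination r₁ * h₁ j - r₀ * h₂ j - B j * e1
    exact (mul_eq_zero.mp this).resolve_right hj
  by_cases h0 : r₀ = 0
  · subst h0
    have h1 : r₁ = 0 := by simpa using e1
    subst h1
    have h2 : r₂ = 0 := by simpa using e3
    subst h2
    have := h₂ j
    simp_all
  · exfalso
    have := h r₀ r₁ fun i => by
      linear_combination r₀ * h₁ i + C i * e1
    exact h0 this.1

lemma Nonvanishing.wedge [IsAlgClosed 𝕜] {A B C : κ → 𝕜} (h : Nonvanishing A B C) {k₁ k₂ : 𝕜}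
    (h₁ : ∀ p q, k₁ * (C p * A q - C q * A p) + k₂ * (A p * B q - A q * B p) = 0)
    (h₂ : ∀ p q, k₁ * (B p * C q - B q * C p) + k₂ * (C p * A q - C q * A p) = 0) :
    k₁ = 0 ∧ k₂ = 0 := by
  obtain ⟨⟨i, hi⟩, ⟨j, hj⟩⟩ := h.exists_ne
  obtain ⟨l, hl⟩ : ∃ l, ∀ p, k₁ * C p = k₂ * B p + l * A p :=
    ⟨(k₁ * C i - k₂ * B i) / A i, fun p => by field_simp; linear_combination h₁ p i⟩
  obtain ⟨m, hm⟩ : ∃ m, ∀ p, k₁ * B p = k₂ * A p + m * C p :=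
    ⟨(k₁ * B j - k₂ * A j) / C j, fun p => by field_simp; linear_combination h₂ p j⟩
  have rel : ∀ p, (k₁ ^ 2 - k₂ * m) * C p = (k₂ ^ 2 + l * k₁) * A p := fun p => by
    linear_combination k₁ * hl p + k₂ * hm p
  by_cases e : k₁ ^ 2 - k₂ * m = 0
  · have e' : k₂ ^ 2 + l * k₁ = 0 := by
      have := rel i
      rw [e, zero_mul] at this
      exact (mul_eq_zero.mp this.symm).resolve_right hi
    by_cases h0 : k₁ = 0
    · subst h0; simpa using e'
    · exfalso
      have hk2 : k₂ ≠ 0 := by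
        rintro rfl
        simp [h0] at e
      have := h k₂ (-k₁) fun p => by
        linear_combination (-k₂) * hm p + C p * e
      exact hk2 this.1
  · by_contra hk
    have hC : ∀ p, C p = (k₂ ^ 2 + l * k₁) / (k₁ ^ 2 - k₂ * m) * A p := fun p => by
      rw [div_mul_eq_mul_div, eq_div_iff e]; linear_combination rel p
    by_cases h0 : k₁ = 0
    · subst h0
      have hk2 : k₂ ≠ 0 := by simpa using hk
      exact h.not_all_mul (Z := A) 1 (-l / k₂) _ (by simp)
        (fun p => by field_simp; linear_combination -hl p) hC
    · exact h.not_all_mul (Z := A) 1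
        ((k₂ + m * ((k₂ ^ 2 + l * k₁) / (k₁ ^ 2 - k₂ * m))) / k₁) _ (by simp)
        (fun p => by
          have := hm p
          rw [hC p] at this
          rw [div_mul_eq_mul_div, eq_div_iff h0]; linear_combination this) hC

end Pencils

section Lattice

variable {I κ 𝕜 : Type*} [Field 𝕜]

/-- A polynomial vector in the kernel of a matrix whose value at `0` is injective vanishes. -/
lemma eq_zero_of_eval_zero_injective {n : Type*} [Fintype n] (M : I → n → 𝕜[X])
    (hM : ∀ r : n → 𝕜, (∀ i, ∑ j, (M i j).eval 0 * r j = 0) → r = 0) (r : n → 𝕜[X])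
    (hr : ∀ i, ∑ j, M i j * r j = 0) : r = 0 := by
  have key : ∀ N : ℕ, ∃ r' : n → 𝕜[X], r = (X ^ N : 𝕜[X]) • r' ∧ ∀ i, ∑ j, M i j * r' j = 0 := by
    intro N
    induction N with
    | zero => exact ⟨r, by simp, hr⟩
    | succ N ih =>
      obtain ⟨r', h, h'⟩ := ih
      have h0 := hM (fun j => (r' j).eval 0) fun i => by
        have := congrArg (eval 0) (h' i)
        simpa [eval_finsetSum] using this
      have hX : ∀ j, X ∣ r' j := fun j => by
        rw [X_dvd_iff, coeff_zero_eq_eval_zero]; exact congrFun h0 j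
      choose r'' hr'' using hX
      refine ⟨r'', ?_, fun i => ?_⟩
      · rw [h]; funext j; simp [hr'' j, pow_succ, mul_assoc]
      · have := h' i
        simp only [hr'', mul_left_comm _ X, ← Finset.mul_sum] at this
        exact (mul_eq_zero.mp this).resolve_left X_ne_zero
  funext j
  by_contra hj
  obtain ⟨r', h, -⟩ := key ((r j).natDegree + 1)
  have hd : X ^ ((r j).natDegree + 1) ∣ r j := ⟨r' j, congrFun h j⟩
  have := natDegree_le_of_dvd hd hj
  simp at this

lemma exists_polynomial_coordinates [IsAlgClosed 𝕜] {x y u : I → 𝕜[X]}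
    (hind : ∀ s a b : 𝕜, (∀ i, a * (x i).eval s + b * (y i).eval s = 0) → a = 0 ∧ b = 0)
    {d k₁ k₂ : 𝕜[X]} (hd : d ≠ 0) (hu : ∀ i, d * u i = k₁ * x i + k₂ * y i) :
    ∃ a b : 𝕜[X], k₁ = d * a ∧ k₂ = d * b ∧ ∀ i, u i = a * x i + b * y i := by
  induction hn : d.natDegree generalizing d k₁ k₂ with
  | zero =>
    obtain ⟨c, rfl⟩ := natDegree_eq_zero.mp hn
    have hc : c ≠ 0 := by simpa using hd
    have hcc : C c * C c⁻¹ = 1 := by rw [← C_mul, mul_inv_cancel₀ hc, C_1]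
    refine ⟨C c⁻¹ * k₁, C c⁻¹ * k₂, ?_, ?_, fun i => ?_⟩
    · rw [← mul_assoc, hcc, one_mul]
    · rw [← mul_assoc, hcc, one_mul]
    · linear_combination (-u i) * hcc + C c⁻¹ * hu i
  | succ n ih =>
    obtain ⟨s, hs⟩ := IsAlgClosed.exists_root d (by
      rw [degree_eq_natDegree hd, hn]; exact_mod_cast Nat.succ_ne_zero n)
    obtain ⟨h1, h2⟩ := hind s (k₁.eval s) (k₂.eval s) fun i => by
      have := congrArg (eval s) (hu i)
      simpa [hs.eq_zero] using this.symm
    obtain ⟨d', rfl⟩ := dvd_iff_isRoot.mpr hs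
    obtain ⟨k₁', rfl⟩ := dvd_iff_isRoot.mpr (show IsRoot k₁ s from h1)
    obtain ⟨k₂', rfl⟩ := dvd_iff_isRoot.mpr (show IsRoot k₂ s from h2)
    have hd' : d' ≠ 0 := right_ne_zero_of_mul hd
    have hX : (X - C s) ≠ 0 := X_sub_C_ne_zero s
    obtain ⟨a, b, ha, hb, h⟩ := ih (d := d') (k₁ := k₁') (k₂ := k₂') hd'
      (fun i => mul_left_cancel₀ hX (by linear_combination hu i)) (by
        rw [natDegree_mul hX hd', natDegree_X_sub_C] at hn; omega)
    exact ⟨a, b, by rw [ha, mul_assoc], by rw [hb, mul_assoc], h⟩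

lemma degree_lt_of_leading_independent {x y : I → 𝕜[X]} {ω : I → ℕ} {dx dy m : ℕ}
    (hx : ∀ i, (x i).natDegree ≤ ω i + dx) (hy : ∀ i, (y i).natDegree ≤ ω i + dy)
    (hlead : ∀ a b : 𝕜, (∀ i, a * (x i).coeff (ω i + dx) + b * (y i).coeff (ω i + dy) = 0) →
      a = 0 ∧ b = 0) {a b : 𝕜[X]}
    (hm : ∀ i n, ω i + m ≤ n → (a * x i + b * y i).coeff n = 0) :
    (a = 0 ∨ a.natDegree + dx < m) ∧ (b = 0 ∨ b.natDegree + dy < m) := by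
  have step : ∀ n, m ≤ n → (a = 0 ∨ a.natDegree + dx ≤ n) → (b = 0 ∨ b.natDegree + dy ≤ n) →
      (a = 0 ∨ a.natDegree + dx < n) ∧ (b = 0 ∨ b.natDegree + dy < n) := by
    intro n hn ha hb
    have main : ∀ (a : 𝕜[X]) (x : I → 𝕜[X]) (dx : ℕ), (∀ i, (x i).natDegree ≤ ω i + dx) →
        (a = 0 ∨ a.natDegree + dx ≤ n) → ∃ a' : 𝕜, (∀ i, (a * x i).coeff (ω i + n) =
          a' * (x i).coeff (ω i + dx)) ∧ (a' = 0 → a = 0 ∨ a.natDegree + dx < n) := by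
      intro a x dx hx ha
      by_cases h0 : a = 0
      · exact ⟨0, by simp [h0], fun _ => Or.inl h0⟩
      have ha := ha.resolve_left h0
      refine ⟨a.coeff (n - dx), fun i => ?_, fun h => ?_⟩
      · rw [show ω i + n = (n - dx) + (ω i + dx) by omega]
        exact coeff_mul_add_eq_of_natDegree_le (by omega) (hx i)
      · rcases ha.lt_or_eq with h' | h'
        · exact Or.inr h'
        · rw [show n - dx = a.natDegree by omega, coeff_natDegree, leadingCoeff_eq_zero] at h
          exact Or.inl h
    obtain ⟨a', h1, h2⟩ := main a x dx hx ha
    obtain ⟨b', h3, h4⟩ := main b y dy hy hb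
    obtain ⟨h5, h6⟩ := hlead a' b' fun i => by
      rw [← h1, ← h3, ← coeff_add]; exact hm i _ (by omega)
    exact ⟨h2 h5, h4 h6⟩
  have desc : ∀ k, (a = 0 ∨ a.natDegree + dx < m + k) → (b = 0 ∨ b.natDegree + dy < m + k) →
      (a = 0 ∨ a.natDegree + dx < m) ∧ (b = 0 ∨ b.natDegree + dy < m) := by
    intro k
    induction k with
    | zero => exact fun h h' => ⟨h, h'⟩
    | succ k ih =>
      intro h h'
      obtain ⟨h1, h2⟩ := step (m + k) (by omega) (h.imp_right (by omega)) (h'.imp_right (by omega))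
      exact ih h1 h2
  exact desc (a.natDegree + dx + b.natDegree + dy + 1) (Or.inr (by omega)) (Or.inr (by omega))

end Lattice

end CubicLines

namespace CubicLines

section Syzygies

open Matrix

variable {E : Type*} [Field E]

lemma exists_cross_coordinates {A B C a b : Fin 3 → E}
    (hS : ∀ r₀ r₁ r₂ r₃ : E, (∀ i, r₀ * A i + r₁ * B i + r₂ * C i = 0) →
      (∀ i, r₁ * A i + r₂ * B i + r₃ * C i = 0) → r₀ = 0 ∧ r₁ = 0 ∧ r₂ = 0 ∧ r₃ = 0)
    (hW : ∀ k₁ k₂ : E, k₁ • (C ⨯₃ A) + k₂ • (A ⨯₃ B) = 0 → k₁ • (B ⨯₃ C) + k₂ • (C ⨯₃ A) = 0 →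
      k₁ = 0 ∧ k₂ = 0)
    (h₁ : A ⬝ᵥ a = 0) (h₂ : A ⬝ᵥ b + B ⬝ᵥ a = 0) (h₃ : B ⬝ᵥ b + C ⬝ᵥ a = 0) (h₄ : C ⬝ᵥ b = 0) :
    ∃ k₁ k₂ : E, a = k₁ • (C ⨯₃ A) + k₂ • (A ⨯₃ B) ∧
      b = -(k₁ • (B ⨯₃ C) + k₂ • (C ⨯₃ A)) := by
  let Φ : (Fin 3 → E) × (Fin 3 → E) →ₗ[E] (Fin 4 → E) :=
    { toFun := fun x => ![A ⬝ᵥ x.1, A ⬝ᵥ x.2 + B ⬝ᵥ x.1, B ⬝ᵥ x.2 + C ⬝ᵥ x.1, C ⬝ᵥ x.2]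
      map_add' := fun x y => by
        ext i; fin_cases i <;> simp [dotProduct_add] <;> ring
      map_smul' := fun r x => by
        ext i; fin_cases i <;> simp [dotProduct_smul] <;> ring }
  have hΦ : ∀ x, Φ x = ![A ⬝ᵥ x.1, A ⬝ᵥ x.2 + B ⬝ᵥ x.1, B ⬝ᵥ x.2 + C ⬝ᵥ x.1, C ⬝ᵥ x.2] :=
    fun _ => rfl
  have hsurj : LinearMap.range Φ = ⊤ := by
    by_contra hne
    obtain ⟨f, hf, hle⟩ := Submodule.exists_le_ker_of_lt_top _ (lt_top_iff_ne_top.mpr hne)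
    have hfx : ∀ x, f x = x 0 * f (Pi.single 0 1) + x 1 * f (Pi.single 1 1) +
        x 2 * f (Pi.single 2 1) + x 3 * f (Pi.single 3 1) := fun x => by
      have : x = x 0 • Pi.single 0 1 + x 1 • Pi.single 1 1 + x 2 • Pi.single 2 1 +
          x 3 • Pi.single 3 1 := by ext i; fin_cases i <;> simp
      conv_lhs => rw [this]
      simp only [map_add, map_smul, smul_eq_mul]
    have hf0 : ∀ x, f (Φ x) = 0 := fun x => hle ⟨x, rfl⟩
    obtain ⟨e0, e1, e2, e3⟩ := hS (f (Pi.single 0 1)) (f (Pi.single 1 1)) (f (Pi.single 2 1))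
      (f (Pi.single 3 1)) (fun i => by
        have := hf0 (Pi.single i 1, 0)
        rw [hfx, hΦ] at this
        simp at this
        linear_combination this) (fun i => by
        have := hf0 (0, Pi.single i 1)
        rw [hfx, hΦ] at this
        simp at this
        linear_combination this)
    apply hf
    refine LinearMap.ext fun x => ?_
    rw [hfx, e0, e1, e2, e3]
    simp
  let Ψ : E × E →ₗ[E] (Fin 3 → E) × (Fin 3 → E) :=
    { toFun := fun k => (k.1 • (C ⨯₃ A) + k.2 • (A ⨯₃ B), -(k.1 • (B ⨯₃ C) + k.2 • (C ⨯₃ A)))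
      map_add' := fun x y => by ext <;> simp <;> ring
      map_smul' := fun r x => by ext <;> simp <;> ring }
  have hinj : Function.Injective Ψ := by
    rw [← LinearMap.ker_eq_bot, LinearMap.ker_eq_bot']
    rintro ⟨k₁, k₂⟩ hk
    obtain ⟨e1, e2⟩ := Prod.ext_iff.mp hk
    obtain ⟨rfl, rfl⟩ := hW k₁ k₂ e1 (neg_eq_zero.mp e2)
    rfl
  have hle : LinearMap.range Ψ ≤ LinearMap.ker Φ := by
    rintro _ ⟨k, rfl⟩
    rw [LinearMap.mem_ker, hΦ]
    ext i
    fin_cases i <;> simp [Ψ, cross_apply, dotProduct, Fin.sum_univ_three] <;> ring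
  have heq : LinearMap.range Ψ = LinearMap.ker Φ := by
    refine Submodule.eq_of_le_of_finrank_eq hle ?_
    have h1 := LinearMap.finrank_range_add_finrank_ker Φ
    rw [hsurj, finrank_top] at h1
    rw [LinearMap.finrank_range_of_inj hinj]
    simp at h1 ⊢
    omega
  have hmem : (a, b) ∈ LinearMap.ker Φ := by
    rw [LinearMap.mem_ker, hΦ]
    simp [h₁, h₂, h₃, h₄]
  rw [← heq] at hmem
  obtain ⟨k, hk⟩ := hmem
  exact ⟨k.1, k.2, (congrArg Prod.fst hk).symm, (congrArg Prod.snd hk).symm⟩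

lemma exists_det_ne_zero_of_indep {v w : Fin 5 → E} (h : Indep v w) :
    ∃ M : Matrix (Fin 5) (Fin 5) E, M 0 = v ∧ M 1 = w ∧ M.det ≠ 0 := by
  have h2 : LinearIndependent E ![v, w] := LinearIndependent.pair_iff.mpr h
  obtain ⟨x, h3⟩ := exists_linearIndependent_snoc_of_lt_finrank h2 (by simp)
  obtain ⟨y, h4⟩ := exists_linearIndependent_snoc_of_lt_finrank h3 (by simp)
  obtain ⟨z, h5⟩ := exists_linearIndependent_snoc_of_lt_finrank h4 (by simp)
  refine ⟨Matrix.of (Fin.snoc (Fin.snoc (Fin.snoc ![v, w] x) y) z), rfl, rfl, ?_⟩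
  have := (Matrix.linearIndependent_rows_iff_isUnit (A := Matrix.of
    (Fin.snoc (Fin.snoc (Fin.snoc ![v, w] x) y) z))).mp h5
  rw [Matrix.isUnit_iff_isUnit_det] at this
  exact this.ne_zero

lemma exists_det_formula {v w x y A B C : Fin 5 → E} (hvw : Indep v w)
    (hAv : A ⬝ᵥ v = 0) (hAw : A ⬝ᵥ w = 0) (hBv : B ⬝ᵥ v = 0) (hBw : B ⬝ᵥ w = 0)
    (hCv : C ⬝ᵥ v = 0) (hCw : C ⬝ᵥ w = 0)
    (hS : ∀ r₀ r₁ r₂ r₃ : E, (∀ i, r₀ * A i + r₁ * B i + r₂ * C i = 0) →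
      (∀ i, r₁ * A i + r₂ * B i + r₃ * C i = 0) → r₀ = 0 ∧ r₁ = 0 ∧ r₂ = 0 ∧ r₃ = 0)
    (hW : ∀ k₁ k₂ : E,
      (∀ p q, k₁ * (C p * A q - C q * A p) + k₂ * (A p * B q - A q * B p) = 0) →
      (∀ p q, k₁ * (B p * C q - B q * C p) + k₂ * (C p * A q - C q * A p) = 0) →
      k₁ = 0 ∧ k₂ = 0)
    (h₁ : A ⬝ᵥ x = 0) (h₂ : A ⬝ᵥ y + B ⬝ᵥ x = 0) (h₃ : B ⬝ᵥ y + C ⬝ᵥ x = 0) (h₄ : C ⬝ᵥ y = 0) :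
    ∃ k₁ k₂ : E,
      (∀ i j, (of ![v, w, x, Pi.single i 1, Pi.single j 1]).det =
        k₁ * (C i * A j - C j * A i) + k₂ * (A i * B j - A j * B i)) ∧
      (∀ i j, (of ![v, w, y, Pi.single i 1, Pi.single j 1]).det =
        -(k₁ * (B i * C j - B j * C i) + k₂ * (C i * A j - C j * A i))) ∧
      (k₁ = 0 → k₂ = 0 → (∃ a b : E, x = a • v + b • w) ∧ ∃ a b : E, y = a • v + b • w) := by
  obtain ⟨M, rfl, rfl, hM⟩ := exists_det_ne_zero_of_indep hvw
  have hco : ∀ p : Fin 5 → E, ∃ r : Fin 5 → E, p = r ᵥ* M := fun p =>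
    ⟨p ᵥ* M⁻¹, by rw [vecMul_vecMul, nonsing_inv_mul _ (Ne.isUnit hM), vecMul_one]⟩
  have hsum : ∀ r : Fin 5 → E, r ᵥ* M =
      r 0 • M 0 + r 1 • M 1 + r 2 • M 2 + r 3 • M 3 + r 4 • M 4 := fun r => by
    rw [vecMul_eq_sum, Fin.sum_univ_five]
  have hdot : ∀ Z : Fin 5 → E, Z ⬝ᵥ M 0 = 0 → Z ⬝ᵥ M 1 = 0 → ∀ r : Fin 5 → E,
      Z ⬝ᵥ (r ᵥ* M) = ![Z ⬝ᵥ M 2, Z ⬝ᵥ M 3, Z ⬝ᵥ M 4] ⬝ᵥ ![r 2, r 3, r 4] := by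
    intro Z h0 h1 r
    rw [hsum]
    simp [dotProduct_add, dotProduct_smul, h0, h1]
    ring
  have hcoord : ∀ Z : Fin 5 → E, Z ⬝ᵥ M 0 = 0 → Z ⬝ᵥ M 1 = 0 → ∀ i,
      ∀ r : Fin 5 → E, Pi.single i 1 = r ᵥ* M →
      Z i = (Z ⬝ᵥ M 2) * r 2 + (Z ⬝ᵥ M 3) * r 3 + (Z ⬝ᵥ M 4) * r 4 := by
    intro Z h0 h1 i r hr
    have := hdot Z h0 h1 r
    rw [← hr] at this
    rw [add_assoc]
    simpa [vec3_dotProduct] using this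
  obtain ⟨a, rfl⟩ := hco x
  obtain ⟨b, rfl⟩ := hco y
  have hdet : ∀ r p q : Fin 5 → E, (of ![M 0, M 1, r ᵥ* M, p ᵥ* M, q ᵥ* M]).det =
      (r 2 * (p 3 * q 4 - p 4 * q 3) - r 3 * (p 2 * q 4 - p 4 * q 2) +
        r 4 * (p 2 * q 3 - p 3 * q 2)) * M.det := by
    intro r p q
    have : of ![M 0, M 1, r ᵥ* M, p ᵥ* M, q ᵥ* M] =
        of ![Pi.single 0 1, Pi.single 1 1, r, p, q] * M := by
      funext i
      rw [mul_apply_eq_vecMul]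
      fin_cases i
      · exact (single_one_vecMul 0 M).symm
      · exact (single_one_vecMul 1 M).symm
      all_goals rfl
    rw [this, det_mul]
    congr 1
    simp [det_succ_row_zero, Fin.sum_univ_succ, Fin.succAbove, Pi.single_apply]
    ring
  obtain ⟨k₁, k₂, ha, hb⟩ := exists_cross_coordinates
    (A := ![A ⬝ᵥ M 2, A ⬝ᵥ M 3, A ⬝ᵥ M 4]) (B := ![B ⬝ᵥ M 2, B ⬝ᵥ M 3, B ⬝ᵥ M 4])
    (C := ![C ⬝ᵥ M 2, C ⬝ᵥ M 3, C ⬝ᵥ M 4]) (a := ![a 2, a 3, a 4]) (b := ![b 2, b 3, b 4])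
    (fun r₀ r₁ r₂ r₃ e e' => hS r₀ r₁ r₂ r₃ (fun i => by
        obtain ⟨r, hr⟩ := hco (Pi.single i 1)
        rw [hcoord A hAv hAw i r hr, hcoord B hBv hBw i r hr, hcoord C hCv hCw i r hr]
        have e0 := e 0
        have e1 := e 1
        have e2 := e 2
        simp at e0 e1 e2
        linear_combination r 2 * e0 + r 3 * e1 + r 4 * e2) (fun i => by
        obtain ⟨r, hr⟩ := hco (Pi.single i 1)
        rw [hcoord A hAv hAw i r hr, hcoord B hBv hBw i r hr, hcoord C hCv hCw i r hr]
        have e0 := e' 0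
        have e1 := e' 1
        have e2 := e' 2
        simp at e0 e1 e2
        linear_combination r 2 * e0 + r 3 * e1 + r 4 * e2))
    (fun l₁ l₂ e e' => hW l₁ l₂ (fun i j => by
        obtain ⟨r, hr⟩ := hco (Pi.single i 1)
        obtain ⟨t, ht⟩ := hco (Pi.single j 1)
        rw [hcoord A hAv hAw i r hr, hcoord B hBv hBw i r hr, hcoord C hCv hCw i r hr,
          hcoord A hAv hAw j t ht, hcoord B hBv hBw j t ht, hcoord C hCv hCw j t ht]
        have e0 := congrFun e 0
        have e1 := congrFun e 1
        have e2 := congrFun e 2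
        simp [cross_apply] at e0 e1 e2
        linear_combination (r 3 * t 4 - r 4 * t 3) * e0 + (r 4 * t 2 - r 2 * t 4) * e1 +
          (r 2 * t 3 - r 3 * t 2) * e2) (fun i j => by
        obtain ⟨r, hr⟩ := hco (Pi.single i 1)
        obtain ⟨t, ht⟩ := hco (Pi.single j 1)
        rw [hcoord A hAv hAw i r hr, hcoord B hBv hBw i r hr, hcoord C hCv hCw i r hr,
          hcoord A hAv hAw j t ht, hcoord B hBv hBw j t ht, hcoord C hCv hCw j t ht]
        have e0 := congrFun e' 0
        have e1 := congrFun e' 1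
        have e2 := congrFun e' 2
        simp [cross_apply] at e0 e1 e2
        linear_combination (r 3 * t 4 - r 4 * t 3) * e0 + (r 4 * t 2 - r 2 * t 4) * e1 +
          (r 2 * t 3 - r 3 * t 2) * e2))
    (by rw [← hdot A hAv hAw, h₁]) (by rw [← hdot A hAv hAw, ← hdot B hBv hBw, h₂])
    (by rw [← hdot B hBv hBw, ← hdot C hCv hCw, h₃]) (by rw [← hdot C hCv hCw, h₄])
  have a2 := congrFun ha 0
  have a3 := congrFun ha 1
  have a4 := congrFun ha 2
  have b2 := congrFun hb 0
  have b3 := congrFun hb 1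
  have b4 := congrFun hb 2
  simp [cross_apply] at a2 a3 a4 b2 b3 b4
  refine ⟨M.det * k₁, M.det * k₂, fun i j => ?_, fun i j => ?_, fun h h' => ?_⟩
  · obtain ⟨r, hr⟩ := hco (Pi.single i 1)
    obtain ⟨t, ht⟩ := hco (Pi.single j 1)
    rw [hcoord A hAv hAw i r hr, hcoord B hBv hBw i r hr, hcoord C hCv hCw i r hr,
      hcoord A hAv hAw j t ht, hcoord B hBv hBw j t ht, hcoord C hCv hCw j t ht, hr, ht, hdet,
      a2, a3, a4]
    ring
  · obtain ⟨r, hr⟩ := hco (Pi.single i 1)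
    obtain ⟨t, ht⟩ := hco (Pi.single j 1)
    rw [hcoord A hAv hAw i r hr, hcoord B hBv hBw i r hr, hcoord C hCv hCw i r hr,
      hcoord A hAv hAw j t ht, hcoord B hBv hBw j t ht, hcoord C hCv hCw j t ht, hr, ht, hdet,
      b2, b3, b4]
    ring
  · have e1 := (mul_eq_zero.mp h).resolve_left hM
    have e2 := (mul_eq_zero.mp h').resolve_left hM
    subst e1 e2
    refine ⟨⟨a 0, a 1, ?_⟩, b 0, b 1, ?_⟩
    · rw [hsum, a2, a3, a4]; simp
    · rw [hsum, b2, b3, b4]; simp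

end Syzygies

end CubicLines

namespace CubicLines

open Polynomial Matrix

section Span

variable {ι A : Type*} [CommRing A]

/-- A nonzero multiple of `u` lies in the span of `v` and `w`. -/
def InSpan (v w u : ι → A) : Prop := ∃ d a b : A, d ≠ 0 ∧ d • u = a • v + b • w

variable {v w u u' : ι → A}

lemma InSpan.left [Nontrivial A] : InSpan v w v := ⟨1, 1, 0, one_ne_zero, by simp⟩
lemma InSpan.right [Nontrivial A] : InSpan v w w := ⟨1, 0, 1, one_ne_zero, by simp⟩

lemma Indep.symm (h : Indep v w) : Indep w v := fun a b hab =>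
  (h b a (by rw [← hab, add_comm])).symm

lemma IsLine.symm [Fintype ι] {c : ι → ι → ι → A} (h : IsLine c v w) : IsLine c w v :=
  ⟨h.1.symm, h.2.2.2.2, h.2.2.2.1, h.2.2.1, h.2.1⟩

lemma InSpan.symm (h : InSpan v w u) : InSpan w v u := by
  obtain ⟨d, a, b, hd, h⟩ := h
  exact ⟨d, b, a, hd, by rw [h, add_comm]⟩

variable [IsDomain A]

lemma InSpan.trans (h : InSpan u u' w) {x y : ι → A} (hu : InSpan x y u) (hu' : InSpan x y u') :
    InSpan x y w := by
  obtain ⟨d, a, b, hd, h⟩ := h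
  obtain ⟨d₁, a₁, b₁, hd₁, h₁⟩ := hu
  obtain ⟨d₂, a₂, b₂, hd₂, h₂⟩ := hu'
  refine ⟨d₁ * d₂ * d, d₂ * a * a₁ + d₁ * b * a₂, d₂ * a * b₁ + d₁ * b * b₂,
    mul_ne_zero (mul_ne_zero hd₁ hd₂) hd, ?_⟩
  calc (d₁ * d₂ * d) • w = (d₁ * d₂) • (d • w) := by module
    _ = (d₂ * a) • (d₁ • u) + (d₁ * b) • (d₂ • u') := by rw [h]; module
    _ = _ := by rw [h₁, h₂]; module

lemma Indep.replace_right (h : Indep v w) {d a b : A} (hb : b ≠ 0) (hu : d • u = a • v + b • w) :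
    Indep v u := by
  intro x y hxy
  have h1 := h (d * x + y * a) (y * b) (by
    calc _ = d • (x • v) + y • (a • v + b • w) := by module
      _ = d • (x • v + y • u) := by rw [← hu]; module
      _ = 0 := by rw [hxy, smul_zero])
  have hy : y = 0 := (mul_eq_zero.mp h1.2).resolve_right hb
  subst hy
  exact ⟨(h x 0 (by simpa using hxy)).1, rfl⟩

variable [Fintype ι] {c : ι → ι → ι → A}

lemma IsLine.of_inSpan (h : IsLine c v w) (hu : InSpan v w u) (hu' : InSpan v w u')
    (hi : Indep u u') : IsLine c u u' := by
  obtain ⟨d₁, a₁, b₁, hd₁, h₁⟩ := hu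
  obtain ⟨d₂, a₂, b₂, hd₂, h₂⟩ := hu'
  have e1 := h.F_eq_zero a₁ b₁
  have e2 := h.F_eq_zero a₂ b₂
  have e3 := h.D_eq_zero a₁ b₁ a₂ b₂
  have e4 := h.D_eq_zero a₂ b₂ a₁ b₁
  rw [← h₁] at e1 e3 e4
  rw [← h₂] at e2 e3 e4
  simp only [F_smul, D_smul_left, D_smul_right, mul_eq_zero, pow_eq_zero_iff', hd₁, hd₂, false_and,
    false_or] at e1 e2 e3 e4
  exact ⟨hi, e1, e3, e4, e2⟩

end Span

section DualVectors

variable {A : Type*} [CommRing A] {ι : Type*} [Fintype ι] [DecidableEq ι] (c : ι → ι → ι → A)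

lemma D_eq_dotProduct (x y : ι → A) :
    D c x y = (fun i => D c x (Pi.single i 1)) ⬝ᵥ y := by
  let f : (ι → A) →ₗ[A] A :=
    { toFun := D c x
      map_add' := D_add_right c x
      map_smul' := fun r y => D_smul_right c r x y }
  have := LinearMap.pi_apply_eq_sum_univ f y
  simp only [f, LinearMap.coe_mk, AddHom.coe_mk] at this
  rw [this, dotProduct]
  refine Finset.sum_congr rfl fun i _ => ?_
  rw [smul_eq_mul, mul_comm]
  congr 2
  funext j
  simp [Pi.single_apply, eq_comm]

lemma B_eq_dotProduct (x y z : ι → A) :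
    B c x y z = (fun i => B c x y (Pi.single i 1)) ⬝ᵥ z := by
  let f : (ι → A) →ₗ[A] A :=
    { toFun := B c x y
      map_add' := B_add₃ c x y
      map_smul' := fun r z => B_smul₃ c r x y z }
  have := LinearMap.pi_apply_eq_sum_univ f z
  simp only [f, LinearMap.coe_mk, AddHom.coe_mk] at this
  rw [this, dotProduct]
  refine Finset.sum_congr rfl fun i _ => ?_
  rw [smul_eq_mul, mul_comm]
  congr 2
  funext j
  simp [Pi.single_apply, eq_comm]

end DualVectors

section PolynomialForms

variable {ι k : Type*} [Fintype ι] [CommRing k] (c : ι → ι → ι → k)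

lemma T_natDegree_le {x y z : ι → k[X]} {a b e : ℕ} (hx : ∀ i, (x i).natDegree ≤ a)
    (hy : ∀ i, (y i).natDegree ≤ b) (hz : ∀ i, (z i).natDegree ≤ e) :
    (T (mapc C c) x y z).natDegree ≤ a + b + e :=
  natDegree_sum_le_of_forall_le _ _ fun i _ => natDegree_sum_le_of_forall_le _ _ fun j _ =>
    natDegree_sum_le_of_forall_le _ _ fun l _ =>
      natDegree_mul_le_of_le (natDegree_mul_le_of_le
        ((natDegree_C_mul_le _ _).trans (hx i)) (hy j)) (hz l)

lemma T_coeff {x y z : ι → k[X]} {a b e : ℕ} (hx : ∀ i, (x i).natDegree ≤ a)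
    (hy : ∀ i, (y i).natDegree ≤ b) (hz : ∀ i, (z i).natDegree ≤ e) :
    (T (mapc C c) x y z).coeff (a + b + e) =
      T c (fun i => (x i).coeff a) (fun i => (y i).coeff b) (fun i => (z i).coeff e) := by
  simp only [T, finsetSum_coeff]
  refine Finset.sum_congr rfl fun i _ => Finset.sum_congr rfl fun j _ =>
    Finset.sum_congr rfl fun l _ => ?_
  have h1 : (mapc C c i j l * x i).natDegree ≤ a := (natDegree_C_mul_le _ _).trans (hx i)
  rw [coeff_mul_add_eq_of_natDegree_le (natDegree_mul_le_of_le h1 (hy j)) (hz l),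
    coeff_mul_add_eq_of_natDegree_le h1 (hy j), mapc_apply, coeff_C_mul]

lemma D_natDegree_le {x y : ι → k[X]} {a b : ℕ} (hx : ∀ i, (x i).natDegree ≤ a)
    (hy : ∀ i, (y i).natDegree ≤ b) : (D (mapc C c) x y).natDegree ≤ a + a + b := by
  have h1 := T_natDegree_le c hy hx hx
  have h2 := T_natDegree_le c hx hy hx
  have h3 := T_natDegree_le c hx hx hy
  exact natDegree_add_le_of_degree_le (natDegree_add_le_of_degree_le (by omega) (by omega)) h3

lemma D_coeff {x y : ι → k[X]} {a b : ℕ} (hx : ∀ i, (x i).natDegree ≤ a)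
    (hy : ∀ i, (y i).natDegree ≤ b) : (D (mapc C c) x y).coeff (a + a + b) =
      D c (fun i => (x i).coeff a) (fun i => (y i).coeff b) := by
  simp only [D, coeff_add, ← T_coeff c hx hx hy, ← T_coeff c hx hy hx, ← T_coeff c hy hx hx]
  congr 3 <;> ring

lemma F_coeff {x : ι → k[X]} {a : ℕ} (hx : ∀ i, (x i).natDegree ≤ a) :
    (F (mapc C c) x).coeff (a + a + a) = F c (fun i => (x i).coeff a) := T_coeff c hx hx hx

lemma B_natDegree_le {x y z : ι → k[X]} {a b e : ℕ} (hx : ∀ i, (x i).natDegree ≤ a)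
    (hy : ∀ i, (y i).natDegree ≤ b) (hz : ∀ i, (z i).natDegree ≤ e) :
    (B (mapc C c) x y z).natDegree ≤ a + b + e := by
  have h1 := T_natDegree_le c hx hy hz
  have h2 := T_natDegree_le c hx hz hy
  have h3 := T_natDegree_le c hy hx hz
  have h4 := T_natDegree_le c hy hz hx
  have h5 := T_natDegree_le c hz hx hy
  have h6 := T_natDegree_le c hz hy hx
  exact natDegree_add_le_of_degree_le (natDegree_add_le_of_degree_le (natDegree_add_le_of_degree_le
    (natDegree_add_le_of_degree_le (natDegree_add_le_of_degree_le (by omega) (by omega))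
    (by omega)) (by omega)) (by omega)) (by omega)

lemma B_coeff {x y z : ι → k[X]} {a b e : ℕ} (hx : ∀ i, (x i).natDegree ≤ a)
    (hy : ∀ i, (y i).natDegree ≤ b) (hz : ∀ i, (z i).natDegree ≤ e) :
    (B (mapc C c) x y z).coeff (a + b + e) =
      B c (fun i => (x i).coeff a) (fun i => (y i).coeff b) (fun i => (z i).coeff e) := by
  simp only [B, coeff_add, ← T_coeff c hx hy hz, ← T_coeff c hx hz hy, ← T_coeff c hy hx hz,
    ← T_coeff c hy hz hx, ← T_coeff c hz hx hy, ← T_coeff c hz hy hx]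
  rw [show a + e + b = a + b + e by ring, show b + a + e = a + b + e by ring,
    show b + e + a = a + b + e by ring, show e + a + b = a + b + e by ring,
    show e + b + a = a + b + e by ring]

/-- Entrywise derivative. -/
noncomputable def der (x : ι → k[X]) : ι → k[X] := fun i => derivative (x i)

lemma derivative_T (x y z : ι → k[X]) : derivative (T (mapc C c) x y z) =
    T (mapc C c) (der x) y z + T (mapc C c) x (der y) z + T (mapc C c) x y (der z) := by
  simp only [T, derivative_sum, ← Finset.sum_add_distrib]
  refine Finset.sum_congr rfl fun i _ => Finset.sum_congr rfl fun j _ =>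
    Finset.sum_congr rfl fun l _ => ?_
  simp only [mapc_apply, derivative_mul, derivative_C, der]
  ring

lemma derivative_F (x : ι → k[X]) : derivative (F (mapc C c) x) = D (mapc C c) x (der x) := by
  simp only [F, D, derivative_T]

lemma derivative_D (x y : ι → k[X]) : derivative (D (mapc C c) x y) =
    B (mapc C c) x y (der x) + D (mapc C c) x (der y) := by
  simp only [D, B, derivative_T, derivative_add]; ring

end PolynomialForms

section Specialization

variable {k : Type*} [Field k] {ι : Type*} {c : ι → ι → ι → k}

lemma mapc_eval (c : ι → ι → ι → k) (s : k) : mapc (evalRingHom s) (mapc C c) = c := by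
  funext i j l; simp [mapc]

variable [Fintype ι]

lemma IsLine.eval {v w : ι → k[X]} (h : IsLine (mapc C c) v w) {s : k}
    (hs : Indep (evalRingHom s ∘ v) (evalRingHom s ∘ w)) :
    IsLine c (evalRingHom s ∘ v) (evalRingHom s ∘ w) := by
  obtain ⟨-, h1, h2, h3, h4⟩ := h
  rw [← mapc_eval c s]
  exact ⟨hs, by rw [F_map, h1, map_zero], by rw [D_map, h2, map_zero], by rw [D_map, h3, map_zero],
    by rw [F_map, h4, map_zero]⟩

lemma IsLine.leading {v w : ι → k[X]} (h : IsLine (mapc C c) v w) {a b : ℕ}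
    (hv : ∀ i, (v i).natDegree ≤ a) (hw : ∀ i, (w i).natDegree ≤ b)
    (hs : Indep (fun i => (v i).coeff a) (fun i => (w i).coeff b)) :
    IsLine c (fun i => (v i).coeff a) (fun i => (w i).coeff b) := by
  obtain ⟨-, h1, h2, h3, h4⟩ := h
  exact ⟨hs, by rw [← F_coeff c hv, h1, coeff_zero], by rw [← D_coeff c hv hw, h2, coeff_zero],
    by rw [← D_coeff c hw hv, h3, coeff_zero], by rw [← F_coeff c hw, h4, coeff_zero]⟩

end Specialization

section Nonvanishing

variable {k : Type*} [Field k] {ι : Type*} [Fintype ι] [DecidableEq ι] {c : ι → ι → ι → k}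

lemma IsLine.nonvanishing (hc : Smooth c) {v w : ι → k} (h : IsLine c v w) :
    Nonvanishing (fun i => D c v (Pi.single i 1)) (fun i => B c v w (Pi.single i 1))
      (fun i => D c w (Pi.single i 1)) := by
  intro x y hxy
  refine h.1 x y (hc _ (h.F_eq_zero x y) fun z => ?_)
  rw [D_eq_dotProduct]
  refine (congrArg (· ⬝ᵥ z) (funext fun i => ?_)).trans (zero_dotProduct z)
  simp only [D_add_left, D_smul_left, B_smul₁, B_smul₂, Pi.zero_apply]
  linear_combination hxy i

end Nonvanishing

section FractionField

variable {𝕜 : Type*} [Field 𝕜] {I n E : Type*} [Fintype n] [Field E] [Algebra 𝕜[X] E]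
  [IsFractionRing 𝕜[X] E]

lemma exists_common_denominator {κ : Type*} [Finite κ] (r : κ → E) :
    ∃ (d : 𝕜[X]) (s : κ → 𝕜[X]), d ≠ 0 ∧ ∀ j, algebraMap 𝕜[X] E (s j) = algebraMap 𝕜[X] E d * r j := by
  obtain ⟨d, hd⟩ := IsLocalization.exist_integer_multiples_of_finite (nonZeroDivisors 𝕜[X]) r
  choose s hs using hd
  exact ⟨d, s, nonZeroDivisors.ne_zero d.2, fun j => by rw [hs, Algebra.smul_def]⟩

lemma eq_zero_of_eval_zero_injective_of_isFractionRing [Infinite 𝕜] (M : I → n → 𝕜[X])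
    (hM : ∀ r : n → 𝕜, (∀ i, ∑ j, (M i j).eval 0 * r j = 0) → r = 0) (r : n → E)
    (hr : ∀ i, ∑ j, algebraMap 𝕜[X] E (M i j) * r j = 0) : r = 0 := by
  obtain ⟨d, s, hd, hs⟩ := exists_common_denominator (𝕜 := 𝕜) r
  have inj := IsFractionRing.injective 𝕜[X] E
  have hs0 := eq_zero_of_eval_zero_injective M hM s fun i => inj <| by
    simp only [map_sum, map_mul, hs, map_zero]
    simp only [mul_left_comm _ (algebraMap 𝕜[X] E d), ← Finset.mul_sum, hr i, mul_zero]
  funext j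
  have := hs j
  rw [hs0, Pi.zero_apply, map_zero, eq_comm, mul_eq_zero, map_eq_zero_iff _ inj] at this
  exact this.resolve_left hd

end FractionField

section Degrees

lemma natDegree_det_le {k : Type*} [Field k] {n : Type*} [Fintype n] [DecidableEq n] (M : Matrix n n k[X]) (d : n → ℕ)
    (h : ∀ i j, (M i j).natDegree ≤ d i) : M.det.natDegree ≤ ∑ i, d i := by
  rw [det_apply]
  refine natDegree_sum_le_of_forall_le _ _ fun σ _ => (natDegree_smul_le _ _).trans ?_
  refine (natDegree_prod_le _ _).trans ?_
  rw [← Equiv.sum_comp σ d]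
  exact Finset.sum_le_sum fun i _ => h _ _

variable {k : Type*} [Field k]

lemma natDegree_single_one {ι : Type*} [DecidableEq ι] (i j : ι) :
    ((Pi.single i 1 : ι → k[X]) j).natDegree ≤ 0 := by
  rw [Pi.single_apply]; split_ifs <;> simp

lemma natDegree_wedge_le {I : Type*} {P Q : I → k[X]} {m n N : ℕ} (hP : ∀ i, (P i).natDegree ≤ m)
    (hQ : ∀ i, (Q i).natDegree ≤ n) (hN : m + n = N) (i j : I) :
    (P i * Q j - P j * Q i).natDegree ≤ N := by
  have := natDegree_sub_le_of_le (natDegree_mul_le_of_le (hP i) (hQ j))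
    (natDegree_mul_le_of_le (hP j) (hQ i))
  rwa [max_self, hN] at this

lemma coeff_wedge {I : Type*} {P Q : I → k[X]} {m n N : ℕ} (hP : ∀ i, (P i).natDegree ≤ m)
    (hQ : ∀ i, (Q i).natDegree ≤ n) (hN : m + n = N) (i j : I) :
    (P i * Q j - P j * Q i).coeff N =
      (P i).coeff m * (Q j).coeff n - (P j).coeff m * (Q i).coeff n := by
  rw [coeff_sub, ← hN, coeff_mul_add_eq_of_natDegree_le (hP i) (hQ j),
    coeff_mul_add_eq_of_natDegree_le (hP j) (hQ i)]

lemma coeff_det_der_eq_zero {v w x : Fin 5 → k[X]} {a b e N : ℕ} (hv : ∀ i, (v i).natDegree ≤ a)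
    (hw : ∀ i, (w i).natDegree ≤ b) (hx : ∀ i, (x i).natDegree ≤ e) (i j : Fin 5)
    (hN : a + b + e ≤ N) :
    ((of ![v, w, der x, Pi.single i 1, Pi.single j 1]).det).coeff N = 0 := by
  rcases Nat.eq_zero_or_pos e with rfl | he
  · have : der x = 0 := funext fun i => by
      rw [der, natDegree_eq_zero_iff_degree_le_zero.mp (Nat.le_zero.mp (hx i)) |> eq_C_of_degree_le_zero,
        derivative_C, Pi.zero_apply]
    rw [det_eq_zero_of_row_eq_zero 2 (fun l => by simp [this]), coeff_zero]
  · refine coeff_eq_zero_of_natDegree_lt (lt_of_le_of_lt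
      (natDegree_det_le _ ![a, b, e - 1, 0, 0] fun p q => ?_) ?_)
    · fin_cases p
      · exact hv q
      · exact hw q
      · exact (natDegree_derivative_le _).trans (Nat.sub_le_sub_right (hx q) 1)
      · exact natDegree_single_one i q
      · exact natDegree_single_one j q
    · rw [Fin.sum_univ_five]
      change a + b + (e - 1) + 0 + 0 < N
      omega

lemma single_one_coeff {ι : Type*} [DecidableEq ι] (i : ι) :
    (fun j => ((Pi.single i 1 : ι → k[X]) j).coeff 0) = Pi.single i 1 := by
  funext j; rw [Pi.single_apply, Pi.single_apply]; split_ifs <;> simp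

lemma comp_single_one {ι A R : Type*} [DecidableEq ι] [CommRing A] [CommRing R] (φ : A →+* R) (i : ι) :
    φ ∘ (Pi.single i 1 : ι → A) = Pi.single i 1 := by
  funext j; simp only [Function.comp, Pi.single_apply]; split_ifs <;> simp

lemma det_comp {A R : Type*} [CommRing A] [CommRing R] (φ : A →+* R) (a b c d e : Fin 5 → A) :
    (of ![φ ∘ a, φ ∘ b, φ ∘ c, φ ∘ d, φ ∘ e]).det = φ (of ![a, b, c, d, e]).det := by
  rw [RingHom.map_det]
  congr 1
  funext i j
  fin_cases i <;> rfl

end Degrees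

section Step

variable {k : Type*} [Field k] {c : Fin 5 → Fin 5 → Fin 5 → k}

lemma IsLine.der_eq {v w : Fin 5 → k[X]} (h : IsLine (mapc C c) v w) :
    D (mapc C c) v (der v) = 0 ∧
    D (mapc C c) v (der w) + B (mapc C c) v w (der v) = 0 ∧
    B (mapc C c) v w (der w) + D (mapc C c) w (der v) = 0 ∧
    D (mapc C c) w (der w) = 0 := by
  obtain ⟨-, h1, h2, h3, h4⟩ := h
  refine ⟨by rw [← derivative_F, h1, derivative_zero], ?_, ?_, by rw [← derivative_F, h4, derivative_zero]⟩
  · rw [add_comm, ← derivative_D, h2, derivative_zero]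
  · rw [B_swap₁₂, ← derivative_D, h3, derivative_zero]

set_option maxHeartbeats 800000 in
/-- The derivatives of a family of lines on a smooth cubic threefold which is nowhere degenerate,
also at infinity, lie in the span of the family. -/
lemma IsLine.der_inSpan [IsAlgClosed k] (hc : Smooth c) {v w : Fin 5 → k[X]} (h : IsLine (mapc C c) v w) {α β : ℕ}
    (hv : ∀ i, (v i).natDegree ≤ α) (hw : ∀ i, (w i).natDegree ≤ β)
    (hs : ∀ s, Indep (evalRingHom s ∘ v) (evalRingHom s ∘ w))
    (hl : Indep (fun i => (v i).coeff α) (fun i => (w i).coeff β)) :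
    InSpan v w (der v) ∧ InSpan v w (der w) := by
  let A : Fin 5 → k[X] := fun i => D (mapc C c) v (Pi.single i 1)
  let B' : Fin 5 → k[X] := fun i => B (mapc C c) v w (Pi.single i 1)
  let C' : Fin 5 → k[X] := fun i => D (mapc C c) w (Pi.single i 1)
  let E := FractionRing k[X]
  let φ := algebraMap k[X] E
  have inj : Function.Injective φ := IsFractionRing.injective k[X] E
  have hNs : ∀ s, Nonvanishing (fun i => (A i).eval s) (fun i => (B' i).eval s)
      (fun i => (C' i).eval s) := by
    intro s
    have := (h.eval (hs s)).nonvanishing hc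
    rw [← mapc_eval c s] at this
    simp only [← comp_single_one (evalRingHom s), D_map, B_map] at this
    exact this
  have hNl : Nonvanishing (fun i => (A i).coeff (α + α)) (fun i => (B' i).coeff (α + β))
      (fun i => (C' i).coeff (β + β)) := by
    have := (h.leading hv hw hl).nonvanishing hc
    simpa only [← single_one_coeff, ← D_coeff c hv (natDegree_single_one _),
      ← D_coeff c hw (natDegree_single_one _), ← B_coeff c hv hw (natDegree_single_one _), add_zero]
      using this
  have hA : ∀ i, (A i).natDegree ≤ α + α := fun i => D_natDegree_le c hv (natDegree_single_one i)
  have hB : ∀ i, (B' i).natDegree ≤ α + β := fun i => B_natDegree_le c hv hw (natDegree_single_one i)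
  have hC : ∀ i, (C' i).natDegree ≤ β + β := fun i => D_natDegree_le c hw (natDegree_single_one i)
  have dA : ∀ y, A ⬝ᵥ y = D (mapc C c) v y := fun y => (D_eq_dotProduct _ v y).symm
  have dB : ∀ y, B' ⬝ᵥ y = B (mapc C c) v w y := fun y => (B_eq_dotProduct _ v w y).symm
  have dC : ∀ y, C' ⬝ᵥ y = D (mapc C c) w y := fun y => (D_eq_dotProduct _ w y).symm
  have hφ : ∀ Z y : Fin 5 → k[X], (φ ∘ Z) ⬝ᵥ (φ ∘ y) = φ (Z ⬝ᵥ y) := fun Z y =>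
    (RingHom.map_dotProduct φ Z y).symm
  obtain ⟨e1, e2, e3, e4⟩ := h.der_eq
  obtain ⟨-, f1, f2, f3, f4⟩ := id h
  have hvw : Indep (φ ∘ v) (φ ∘ w) := by
    intro a b hab
    have := eq_zero_of_eval_zero_injective_of_isFractionRing (fun i => ![v i, w i])
      (fun r hr => by
        have := hs 0 (r 0) (r 1) (funext fun i => by
          have := hr i
          simp only [Fin.sum_univ_two, cons_val_zero, cons_val_one] at this
          simp only [Pi.add_apply, Pi.smul_apply, Function.comp, smul_eq_mul, coe_evalRingHom,
            Pi.zero_apply]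
          linear_combination this)
        funext i; fin_cases i <;> simp [this]) (E := E) ![a, b]
      (fun i => by
        have := congrFun hab i
        simp only [Pi.add_apply, Pi.smul_apply, Function.comp, smul_eq_mul, Pi.zero_apply] at this
        simp only [Fin.sum_univ_two, cons_val_zero, cons_val_one]
        linear_combination this)
    exact ⟨congrFun this 0, congrFun this 1⟩
  obtain ⟨k₁, k₂, g1, g2, g3⟩ := exists_det_formula (x := φ ∘ der v) (y := φ ∘ der w) (A := φ ∘ A)
    (B := φ ∘ B') (C := φ ∘ C') hvw
    (by rw [hφ, dA, D_self, f1, mul_zero, map_zero])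
    (by rw [hφ, dA, f2, map_zero])
    (by rw [hφ, dB, B_diag₁₃, f2, mul_zero, map_zero])
    (by rw [hφ, dB, B_diag₂₃, f3, mul_zero, map_zero])
    (by rw [hφ, dC, f3, map_zero])
    (by rw [hφ, dC, D_self, f4, mul_zero, map_zero])
    (by
      intro r₀ r₁ r₂ r₃ h1 h2
      have := eq_zero_of_eval_zero_injective_of_isFractionRing
        (fun i : Fin 5 ⊕ Fin 5 => Sum.elim (fun i => ![A i, B' i, C' i, 0])
          (fun i => ![0, A i, B' i, C' i]) i)
        (fun r hr => by
          obtain ⟨q1, q2, q3, q4⟩ := (hNs 0).syzygy (r₀ := r 0) (r₁ := r 1) (r₂ := r 2) (r₃ := r 3)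
            (fun i => by
              have := hr (Sum.inl i)
              simp [Fin.sum_univ_four] at this
              linear_combination this)
            (fun i => by
              have := hr (Sum.inr i)
              simp [Fin.sum_univ_four] at this
              linear_combination this)
          funext i; fin_cases i <;> simp [q1, q2, q3, q4]) (E := E) ![r₀, r₁, r₂, r₃]
        (fun i => by
          rcases i with i | i
          · have := h1 i
            simp [Fin.sum_univ_four] at this ⊢
            linear_combination this
          · have := h2 i
            simp [Fin.sum_univ_four] at this ⊢
            linear_combination this)
      exact ⟨congrFun this 0, congrFun this 1, congrFun this 2, congrFun this 3⟩)
    (by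
      intro r₀ r₁ h1 h2
      have := eq_zero_of_eval_zero_injective_of_isFractionRing
        (fun i : (Fin 5 × Fin 5) ⊕ (Fin 5 × Fin 5) => Sum.elim
          (fun i => ![C' i.1 * A i.2 - C' i.2 * A i.1, A i.1 * B' i.2 - A i.2 * B' i.1])
          (fun i => ![B' i.1 * C' i.2 - B' i.2 * C' i.1, C' i.1 * A i.2 - C' i.2 * A i.1]) i)
        (fun r hr => by
          obtain ⟨q1, q2⟩ := (hNs 0).wedge (k₁ := r 0) (k₂ := r 1)
            (fun p q => by
              have := hr (Sum.inl (p, q))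
              simp [Fin.sum_univ_two] at this
              linear_combination this)
            (fun p q => by
              have := hr (Sum.inr (p, q))
              simp [Fin.sum_univ_two] at this
              linear_combination this)
          funext i; fin_cases i <;> simp [q1, q2]) (E := E) ![r₀, r₁]
        (fun i => by
          rcases i with ⟨p, q⟩ | ⟨p, q⟩
          · have := h1 p q
            simp [Fin.sum_univ_two] at this ⊢
            linear_combination this
          · have := h2 p q
            simp [Fin.sum_univ_two] at this ⊢
            linear_combination this)
      exact ⟨congrFun this 0, congrFun this 1⟩)
    (by rw [hφ, dA, e1, map_zero])
    (by rw [hφ, hφ, dA, dB, ← map_add, e2, map_zero])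
    (by rw [hφ, hφ, dB, dC, ← map_add, e3, map_zero])
    (by rw [hφ, dC, e4, map_zero])
  obtain ⟨d, κ, hd, hκ⟩ := exists_common_denominator (𝕜 := k) ![k₁, k₂]
  have hκ₁ : φ (κ 0) = φ d * k₁ := hκ 0
  have hκ₂ : φ (κ 1) = φ d * k₂ := hκ 1
  let x : Fin 5 × Fin 5 ⊕ Fin 5 × Fin 5 → k[X] := Sum.elim
    (fun i => C' i.1 * A i.2 - C' i.2 * A i.1) (fun i => -(B' i.1 * C' i.2 - B' i.2 * C' i.1))
  let y : Fin 5 × Fin 5 ⊕ Fin 5 × Fin 5 → k[X] := Sum.elim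
    (fun i => A i.1 * B' i.2 - A i.2 * B' i.1) (fun i => -(C' i.1 * A i.2 - C' i.2 * A i.1))
  let u : Fin 5 × Fin 5 ⊕ Fin 5 × Fin 5 → k[X] := Sum.elim
    (fun i => (of ![v, w, der v, Pi.single i.1 1, Pi.single i.2 1]).det)
    (fun i => (of ![v, w, der w, Pi.single i.1 1, Pi.single i.2 1]).det)
  have hu : ∀ i, d * u i = κ 0 * x i + κ 1 * y i := by
    rintro (⟨p, q⟩ | ⟨p, q⟩) <;> apply inj
    · have := g1 p q
      rw [← comp_single_one φ p, ← comp_single_one φ q, det_comp] at this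
      simp only [map_mul, map_add, x, y, u, Sum.elim_inl, map_sub]
      rw [hκ₁, hκ₂]
      simp only [Function.comp] at this
      linear_combination φ d * this
    · have := g2 p q
      rw [← comp_single_one φ p, ← comp_single_one φ q, det_comp] at this
      simp only [map_mul, map_add, x, y, u, Sum.elim_inr, map_sub, map_neg]
      rw [hκ₁, hκ₂]
      simp only [Function.comp] at this
      linear_combination φ d * this
  obtain ⟨a, b, ha, hb, hab⟩ := exists_polynomial_coordinates (x := x) (y := y) (u := u)
    (fun s a b hab => (hNs s).wedge
      (fun p q => by simpa [x, y] using hab (Sum.inl (p, q)))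
      (fun p q => by
        have := hab (Sum.inr (p, q))
        simp [x, y] at this
        linear_combination -this)) hd hu
  let ω : Fin 5 × Fin 5 ⊕ Fin 5 × Fin 5 → ℕ := Sum.elim (fun _ => α + α + β) (fun _ => α + β + β)
  have hdeg := degree_lt_of_leading_independent (x := x) (y := y) (ω := ω) (dx := β) (dy := α)
    (m := 0) (a := a) (b := b) ?_ ?_ ?_ ?_
  · obtain rfl : a = 0 := by simpa using hdeg.1
    obtain rfl : b = 0 := by simpa using hdeg.2
    have hφd : φ d ≠ 0 := (map_ne_zero_iff φ inj).mpr hd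
    have hk₁ : k₁ = 0 := by simpa [ha, hφd] using hκ₁
    have hk₂ : k₂ = 0 := by simpa [hb, hφd] using hκ₂
    have span : ∀ u : Fin 5 → k[X], (∃ a b : E, φ ∘ u = a • (φ ∘ v) + b • (φ ∘ w)) → InSpan v w u := by
      rintro u ⟨a, b, hab⟩
      obtain ⟨d, κ, hd, hκ⟩ := exists_common_denominator (𝕜 := k) ![a, b]
      refine ⟨d, κ 0, κ 1, hd, funext fun i => inj ?_⟩
      have h1 : φ (κ 0) = φ d * a := hκ 0
      have h2 : φ (κ 1) = φ d * b := hκ 1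
      have h3 := congrFun hab i
      simp only [Pi.add_apply, Pi.smul_apply, smul_eq_mul, Function.comp, map_add, map_mul] at h3 ⊢
      rw [h1, h2, h3]; ring
    exact ⟨span _ (g3 hk₁ hk₂).1, span _ (g3 hk₁ hk₂).2⟩
  · rintro (⟨p, q⟩ | ⟨p, q⟩) <;> simp only [x, ω, Sum.elim_inl, Sum.elim_inr, natDegree_neg]
    · exact natDegree_wedge_le (P := C') (Q := A) hC hA (by ring) p q
    · exact natDegree_wedge_le (P := B') (Q := C') hB hC (by ring) p q
  · rintro (⟨p, q⟩ | ⟨p, q⟩) <;> simp only [y, ω, Sum.elim_inl, Sum.elim_inr, natDegree_neg]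
    · exact natDegree_wedge_le (P := A) (Q := B') hA hB (by ring) p q
    · exact natDegree_wedge_le (P := C') (Q := A) hC hA (by ring) p q
  · intro a b hab
    refine hNl.wedge (fun p q => ?_) (fun p q => ?_)
    · have := hab (Sum.inl (p, q))
      simp only [x, y, ω, Sum.elim_inl] at this
      rw [coeff_wedge hC hA (by ring), coeff_wedge hA hB (by ring)] at this
      exact this
    · have := hab (Sum.inr (p, q))
      simp only [x, y, ω, Sum.elim_inr, coeff_neg] at this
      rw [coeff_wedge hB hC (by ring), coeff_wedge hC hA (by ring)] at this
      linear_combination -this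
  · rintro (⟨p, q⟩ | ⟨p, q⟩) N hN <;> rw [← hab] <;>
      simp only [u, ω, Sum.elim_inl, Sum.elim_inr, add_zero] at hN ⊢
    · exact coeff_det_der_eq_zero hv hw hv p q (by omega)
    · exact coeff_det_der_eq_zero hv hw hw p q hN

end Step

section Antiderivative

variable {k : Type*} [Field k]

lemma not_dvd_descFactorial {p : ℕ} [Fact p.Prime] (m i : ℕ) (hi : i < p) :
    ¬ p ∣ (p * m + (p - 1)).descFactorial i := by
  induction i with
  | zero => simpa using (Fact.out : p.Prime).one_lt.ne'
  | succ i ih =>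
    rw [Nat.descFactorial_succ, (Fact.out : p.Prime).dvd_mul]
    rintro (h | h)
    · rw [show p * m + (p - 1) - i = p * m + (p - 1 - i) by omega,
        Nat.dvd_add_right (dvd_mul_right p m)] at h
      have := Nat.le_of_dvd (by omega) h
      omega
    · exact ih (by omega) h

lemma iterate_derivative_mul_of_derivative_eq_zero {a v : k[X]} (hv : derivative v = 0) (n : ℕ) :
    derivative^[n] (a * v) = derivative^[n] a * v := by
  induction n with
  | zero => rfl
  | succ n ih => rw [Function.iterate_succ_apply', ih, derivative_mul, hv, mul_zero, add_zero,
      Function.iterate_succ_apply']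

lemma coeff_eq_zero_of_mul_eq_derivative (p : ℕ) [Fact p.Prime] [CharP k p] {a v w : k[X]} (hv : derivative v = 0) (hv0 : v ≠ 0)
    (h : derivative w = a * v) {n : ℕ} (hn : ((n + 1 : ℕ) : k) = 0) : a.coeff n = 0 := by
  have hp := (Fact.out : p.Prime)
  have h0 : derivative^[p - 1] a = 0 := by
    refine (mul_eq_zero.mp ?_).resolve_right hv0
    rw [← iterate_derivative_mul_of_derivative_eq_zero hv, ← h, ← Function.iterate_succ_apply]
    ext m
    rw [coeff_iterate_derivative, Nat.succ_eq_add_one, Nat.sub_add_cancel hp.one_le, coeff_zero,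
      nsmul_eq_mul, (CharP.cast_eq_zero_iff k p _).mpr, zero_mul]
    exact (Nat.dvd_factorial hp.pos le_rfl).trans (Nat.factorial_dvd_descFactorial _ _)
  obtain ⟨j, hj⟩ := (CharP.cast_eq_zero_iff k p _).mp hn
  obtain ⟨m, rfl⟩ : ∃ m, j = m + 1 := Nat.exists_eq_succ_of_ne_zero (by rintro rfl; simp at hj)
  obtain rfl : n = p * m + (p - 1) := by
    have := hp.one_le
    rw [mul_add] at hj
    omega
  have := congrArg (coeff · (p * m)) h0
  simp only [coeff_iterate_derivative, coeff_zero, nsmul_eq_mul, mul_eq_zero,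
    CharP.cast_eq_zero_iff k p] at this
  exact this.resolve_left (not_dvd_descFactorial m _ (by have := hp.pos; omega))

lemma exists_antiderivative {a : k[X]} (ha : ∀ n, ((n + 1 : ℕ) : k) = 0 → a.coeff n = 0) :
    ∃ b : k[X], derivative b = a ∧ b.natDegree ≤ a.natDegree + 1 := by
  refine ⟨∑ n ∈ Finset.range (a.natDegree + 1), C (a.coeff n * ((n + 1 : ℕ) : k)⁻¹) * X ^ (n + 1),
    ?_, natDegree_sum_le_of_forall_le _ _ fun n hn =>
      (natDegree_C_mul_X_pow_le _ _).trans (Finset.mem_range.mp hn)⟩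
  rw [derivative_sum]
  conv_rhs => rw [a.as_sum_range_C_mul_X_pow]
  refine Finset.sum_congr rfl fun n _ => ?_
  rw [derivative_C_mul_X_pow, Nat.add_sub_cancel]
  by_cases hn : ((n + 1 : ℕ) : k) = 0
  · rw [ha n hn, zero_mul, zero_mul]
  · rw [inv_mul_cancel_right₀ hn]

end Antiderivative

section Families

variable {k : Type*} [Field k] {c : Fin 5 → Fin 5 → Fin 5 → k}

lemma InSpan.exists_coordinates [IsAlgClosed k] {v w u : Fin 5 → k[X]} (hu : InSpan v w u)
    {α β m : ℕ} (hv : ∀ i, (v i).natDegree ≤ α) (hw : ∀ i, (w i).natDegree ≤ β)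
    (hs : ∀ s, Indep (evalRingHom s ∘ v) (evalRingHom s ∘ w))
    (hl : Indep (fun i => (v i).coeff α) (fun i => (w i).coeff β))
    (hm : ∀ i n, m ≤ n → (u i).coeff n = 0) :
    ∃ a b : k[X], u = a • v + b • w ∧ (a = 0 ∨ a.natDegree + α < m) ∧
      (b = 0 ∨ b.natDegree + β < m) := by
  obtain ⟨d, a, b, hd, h⟩ := hu
  obtain ⟨a, b, -, -, hab⟩ := exists_polynomial_coordinates (x := v) (y := w) (u := u)
    (fun s a b h => hs s a b (funext h)) hd (congrFun h)
  have := degree_lt_of_leading_independent (x := v) (y := w) (ω := fun _ => 0) (dx := α) (dy := β)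
    (m := m) (a := a) (b := b) (by simpa using hv) (by simpa using hw)
    (fun a b h => hl a b (funext fun i => by simpa using h i))
    (fun i n hn => by rw [← hab i]; exact hm i n (by omega))
  exact ⟨a, b, funext hab, this⟩

lemma der_coeff_eq_zero {v : Fin 5 → k[X]} {α : ℕ} (hv : ∀ i, (v i).natDegree ≤ α) (i : Fin 5)
    (n : ℕ) (hn : α ≤ n) : (der v i).coeff n = 0 := by
  rw [der, coeff_derivative, coeff_eq_zero_of_natDegree_lt (by have := hv i; omega), zero_mul]

lemma eq_C_comp {v : Fin 5 → k[X]} (hv : ∀ i, (v i).natDegree ≤ 0) :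
    v = C ∘ fun i => (v i).coeff 0 :=
  funext fun i => eq_C_of_natDegree_le_zero (hv i)

lemma exists_smaller_of_eval {v w : Fin 5 → k[X]} (h : IsLine (mapc C c) v w) {α β : ℕ}
    (hv : ∀ i, (v i).natDegree ≤ α) (hw : ∀ i, (w i).natDegree ≤ β) (hαβ : α ≤ β) (hβ : 0 < β)
    {s : k} (hs : ¬ Indep (evalRingHom s ∘ v) (evalRingHom s ∘ w)) :
    ∃ v' w' α' β', IsLine (mapc C c) v' w' ∧ (∀ i, (v' i).natDegree ≤ α') ∧
      (∀ i, (w' i).natDegree ≤ β') ∧ α' + β' < α + β ∧ InSpan v w v' ∧ InSpan v w w' := by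
  have key : ∀ u : Fin 5 → k[X], evalRingHom s ∘ u = 0 → ∃ u', u = (X - C s) • u' ∧
      ∀ i n, (u i).natDegree ≤ n → (u' i).natDegree ≤ n - 1 := by
    intro u hu
    refine ⟨fun i => u i /ₘ (X - C s), funext fun i => ?_, fun i n hn => ?_⟩
    · exact (mul_divByMonic_eq_iff_isRoot.mpr (congrFun hu i)).symm
    · rw [natDegree_divByMonic _ (monic_X_sub_C s), natDegree_X_sub_C]
      omega
  have hX : (X - C s) ≠ 0 := X_sub_C_ne_zero s
  simp only [Indep, not_forall] at hs
  obtain ⟨a, b, hab, hne⟩ := hs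
  by_cases hb : b = 0
  · subst hb
    have ha : a ≠ 0 := by rintro rfl; simp at hne
    have hv0 : evalRingHom s ∘ v = 0 := by simpa [ha] using hab
    obtain ⟨v', h1, h2⟩ := key v hv0
    have hi : InSpan v w v' := ⟨X - C s, 1, 0, hX, by rw [← h1]; simp⟩
    refine ⟨v', w, α - 1, β, h.of_inSpan hi InSpan.right ?_, fun i => h2 i α (hv i), hw, ?_, hi,
      InSpan.right⟩
    · exact (h.1.symm.replace_right one_ne_zero (d := X - C s) (a := 0)
        (by rw [← h1]; simp)).symm
    · rcases Nat.eq_zero_or_pos α with rfl | hα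
      · exfalso
        rw [eq_C_comp hv] at hv0 h
        have h0 : (C ∘ fun i => (v i).coeff 0 : Fin 5 → k[X]) = 0 := by
          funext i
          have := congrFun hv0 i
          simpa using this
        rw [h0] at h
        exact one_ne_zero (h.1 1 0 (by simp)).1
      · omega
  · obtain ⟨u, h1, h2⟩ := key (C a • v + C b • w) (by
      rw [← hab]
      funext i
      simp)
    have hi : InSpan v w u := ⟨X - C s, C a, C b, hX, h1.symm⟩
    refine ⟨v, u, α, β - 1, h.of_inSpan InSpan.left hi
      (h.1.replace_right (C_ne_zero.mpr hb) h1.symm), hv, fun i => h2 i β ?_, by omega,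
      InSpan.left, hi⟩
    exact natDegree_add_le_of_degree_le ((natDegree_C_mul_le _ _).trans ((hv i).trans hαβ))
      ((natDegree_C_mul_le _ _).trans (hw i))

lemma exists_smaller_of_leading {v w : Fin 5 → k[X]} (h : IsLine (mapc C c) v w) {α β : ℕ}
    (hv : ∀ i, (v i).natDegree ≤ α) (hw : ∀ i, (w i).natDegree ≤ β) (hαβ : α ≤ β) (hβ : 0 < β)
    (hl : ¬ Indep (fun i => (v i).coeff α) (fun i => (w i).coeff β)) :
    ∃ v' w' α' β', IsLine (mapc C c) v' w' ∧ (∀ i, (v' i).natDegree ≤ α') ∧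
      (∀ i, (w' i).natDegree ≤ β') ∧ α' + β' < α + β ∧ InSpan v w v' ∧ InSpan v w w' := by
  have key : ∀ (f : k[X]) (n : ℕ), f.natDegree ≤ n → f.coeff n = 0 → f.natDegree ≤ n - 1 := by
    intro f n h1 h2
    rcases h1.eq_or_lt with rfl | h1
    · have : f = 0 := leadingCoeff_eq_zero.mp h2
      simp [this]
    · omega
  simp only [Indep, not_forall] at hl
  obtain ⟨a, b, hab, hne⟩ := hl
  by_cases hb : b = 0
  · subst hb
    have ha : a ≠ 0 := by rintro rfl; simp at hne
    have hv0 : ∀ i, (v i).coeff α = 0 := fun i => by simpa [ha] using congrFun hab i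
    refine ⟨v, w, α - 1, β, h, fun i => key _ _ (hv i) (hv0 i), hw, ?_, InSpan.left, InSpan.right⟩
    rcases Nat.eq_zero_or_pos α with rfl | hα
    · exfalso
      have h0 : v = 0 := by rw [eq_C_comp hv]; funext i; simp [hv0 i]
      rw [h0] at h
      exact one_ne_zero (h.1 1 0 (by simp)).1
    · omega
  · have hi : InSpan v w ((C a * X ^ (β - α)) • v + C b • w) :=
      ⟨1, C a * X ^ (β - α), C b, one_ne_zero, one_smul _ _⟩
    refine ⟨v, _, α, β - 1, h.of_inSpan InSpan.left hi
      (h.1.replace_right (d := 1) (C_ne_zero.mpr hb) (one_smul _ _)), hv,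
      fun i => key _ _ ?_ ?_, by omega, InSpan.left, hi⟩
    · refine natDegree_add_le_of_degree_le ?_ ((natDegree_C_mul_le _ _).trans (hw i))
      refine (natDegree_mul_le_of_le (natDegree_C_mul_X_pow_le _ _) (hv i)).trans ?_
      omega
    · have := congrFun hab i
      simp only [Pi.add_apply, Pi.smul_apply, smul_eq_mul, Pi.zero_apply] at this
      simp only [Pi.add_apply, Pi.smul_apply, smul_eq_mul, coeff_add, coeff_C_mul, mul_assoc]
      have hX : (X ^ (β - α) * v i).coeff β = (v i).coeff α := by
        rw [coeff_X_pow_mul', if_pos (Nat.sub_le β α), Nat.sub_sub_self hαβ]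
      rwa [hX]

lemma IsLine.exists_contraction [IsAlgClosed k] (p : ℕ) [Fact p.Prime] [CharP k p]
    {v w : Fin 5 → k[X]} (h : IsLine (mapc C c) v w) {α β : ℕ}
    (hv : ∀ i, (v i).natDegree ≤ α) (hw : ∀ i, (w i).natDegree ≤ β) (hαβ : α ≤ β)
    (hs : ∀ s, Indep (evalRingHom s ∘ v) (evalRingHom s ∘ w))
    (hl : Indep (fun i => (v i).coeff α) (fun i => (w i).coeff β))
    (hspan : InSpan v w (der v) ∧ InSpan v w (der w)) :
    ∃ v' w' : Fin 5 → k[X], IsLine (mapc C c) v' w' ∧ (∀ i, (v' i).natDegree ≤ α / p) ∧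
      (∀ i, (w' i).natDegree ≤ β / p) ∧ InSpan v w (expand k p ∘ v') ∧
      InSpan v w (expand k p ∘ w') := by
  have hp := (Fact.out : p.Prime)
  obtain ⟨a, b, h1, h2, h3⟩ := hspan.1.exists_coordinates hv hw hs hl (der_coeff_eq_zero hv)
  obtain rfl : a = 0 := h2.resolve_right (by omega)
  obtain rfl : b = 0 := h3.resolve_right (by omega)
  rw [zero_smul, zero_smul, add_zero] at h1
  obtain ⟨a, b, h1', h2, h3⟩ := hspan.2.exists_coordinates hv hw hs hl (der_coeff_eq_zero hw)
  obtain rfl : b = 0 := h3.resolve_right (by omega)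
  rw [zero_smul, add_zero] at h1'
  obtain ⟨i₀, hi₀⟩ : ∃ i, v i ≠ 0 := by
    by_contra! hc
    exact one_ne_zero (h.1 1 0 (by rw [show v = 0 from funext hc]; simp)).1
  obtain ⟨e, he, hdeg⟩ : ∃ e : k[X], derivative e = a ∧ ∀ i, (e * v i).natDegree ≤ β := by
    rcases h2 with rfl | h2
    · exact ⟨0, derivative_zero, fun i => by simp⟩
    · obtain ⟨e, he, hd⟩ := exists_antiderivative (a := a) fun n hn =>
        coeff_eq_zero_of_mul_eq_derivative p (v := v i₀) (w := w i₀) (congrFun h1 i₀) hi₀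
          (congrFun h1' i₀) hn
      refine ⟨e, he, fun i => (natDegree_mul_le_of_le hd (hv i)).trans (by omega)⟩
  have hex : ∀ (u : Fin 5 → k[X]) (n : ℕ), der u = 0 → (∀ i, (u i).natDegree ≤ n) →
      ∃ u', u = expand k p ∘ u' ∧ ∀ i, (u' i).natDegree ≤ n / p := by
    intro u n hu hn
    have := fun i => expand_contract p (congrFun hu i) hp.ne_zero
    refine ⟨fun i => contract p (u i), funext fun i => (this i).symm, fun i => ?_⟩
    rw [Nat.le_div_iff_mul_le hp.pos, ← natDegree_expand, this]
    exact hn i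
  obtain ⟨v', rfl, hv'⟩ := hex v α h1 hv
  obtain ⟨w', hw1, hw'⟩ := hex (w - e • (expand k p ∘ v')) β
    (funext fun i => by
      have q1 := congrFun h1 i
      have q2 := congrFun h1' i
      simp only [der, Pi.zero_apply, Pi.smul_apply, smul_eq_mul, Pi.sub_apply, derivative_sub,
        derivative_mul] at q1 q2 ⊢
      rw [q1, q2, he]; ring)
    (fun i => by
      have := natDegree_sub_le_of_le (hw i) (hdeg i)
      rwa [max_self] at this)
  have hi : InSpan (expand k p ∘ v') w (expand k p ∘ w') :=
    ⟨1, -e, 1, one_ne_zero, by rw [← hw1]; module⟩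
  have hline := h.of_inSpan InSpan.left hi
    (h.1.replace_right (d := 1) (a := -e) one_ne_zero (by rw [← hw1]; module))
  refine ⟨v', w', ?_, hv', hw', InSpan.left, hi⟩
  have inj : Function.Injective (expand k p : k[X] →ₐ[k] k[X]).toRingHom := expand_injective hp.pos
  have hc : mapc (expand k p : k[X] →ₐ[k] k[X]).toRingHom (mapc C c) = mapc C c := by
    funext i j l
    exact expand_C p _
  obtain ⟨l1, l2, l3, l4, l5⟩ := hline
  rw [← hc] at l2 l3 l4 l5
  refine ⟨fun a b hab => ?_, inj ?_, inj ?_, inj ?_, inj ?_⟩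
  · have := l1 (expand k p a) (expand k p b) (funext fun i => by
      have := congrArg (expand k p) (congrFun hab i)
      simpa using this)
    simpa [expand_eq_zero hp.pos] using this
  · rw [map_zero, ← F_map]; exact l2
  · rw [map_zero, ← D_map]; exact l3
  · rw [map_zero, ← D_map]; exact l4
  · rw [map_zero, ← F_map]; exact l5

/-- A family of lines on a smooth cubic threefold parametrized by the affine line is constant. -/
theorem exists_constant_line [IsAlgClosed k] (p : ℕ) [Fact p.Prime] [CharP k p] (hc : Smooth c)
    {v w : Fin 5 → k[X]} (h : IsLine (mapc C c) v w) :
    ∃ v₀ w₀ : Fin 5 → k, IsLine c v₀ w₀ ∧ InSpan v w (C ∘ v₀) ∧ InSpan v w (C ∘ w₀) := by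
  obtain ⟨α, hv⟩ : ∃ α, ∀ i, (v i).natDegree ≤ α :=
    ⟨∑ i, (v i).natDegree, fun i => Finset.single_le_sum (f := fun i => (v i).natDegree)
      (fun _ _ => Nat.zero_le _) (Finset.mem_univ i)⟩
  obtain ⟨β, hw⟩ : ∃ β, ∀ i, (w i).natDegree ≤ β :=
    ⟨∑ i, (w i).natDegree, fun i => Finset.single_le_sum (f := fun i => (w i).natDegree)
      (fun _ _ => Nat.zero_le _) (Finset.mem_univ i)⟩
  induction hn : α + β using Nat.strong_induction_on generalizing v w α β with
  | _ n ih =>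
  subst hn
  wlog hαβ : α ≤ β generalizing v w α β
  · obtain ⟨v₀, w₀, h0, h1, h2⟩ := this h.symm β hw α hv
      (fun m hm v w h α hv β hw e => ih m (by omega) h α hv β hw e) (by omega)
    exact ⟨v₀, w₀, h0, h1.symm, h2.symm⟩
  have descend : ∀ v' w' : Fin 5 → k[X], ∀ α' β' : ℕ, IsLine (mapc C c) v' w' →
      (∀ i, (v' i).natDegree ≤ α') → (∀ i, (w' i).natDegree ≤ β') → α' + β' < α + β →
      InSpan v w v' → InSpan v w w' →
      ∃ v₀ w₀ : Fin 5 → k, IsLine c v₀ w₀ ∧ InSpan v w (C ∘ v₀) ∧ InSpan v w (C ∘ w₀) := by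
    intro v' w' α' β' h' hv' hw' hlt s1 s2
    obtain ⟨v₀, w₀, h0, h1, h2⟩ := ih _ hlt h' α' hv' β' hw' rfl
    exact ⟨v₀, w₀, h0, h1.trans s1 s2, h2.trans s1 s2⟩
  rcases Nat.eq_zero_or_pos β with rfl | hβ
  · obtain rfl : α = 0 := by omega
    have e1 := eq_C_comp hv
    have e2 := eq_C_comp hw
    rw [e1, e2] at h ⊢
    refine ⟨_, _, ?_, InSpan.left, InSpan.right⟩
    have hC : ∀ (s : k) (u : Fin 5 → k), evalRingHom s ∘ (C ∘ u) = u := fun s u => by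
      funext i; simp
    have := h.eval (s := 0) (by
      intro a b hab
      rw [hC, hC] at hab
      have := h.1 (C a) (C b) (by rw [← comp_smul, ← comp_smul, ← comp_add, hab, comp_zero])
      simpa using this)
    rwa [hC, hC] at this
  by_cases hs : ∀ s, Indep (evalRingHom s ∘ v) (evalRingHom s ∘ w)
  swap
  · push Not at hs
    obtain ⟨s, hs⟩ := hs
    obtain ⟨v', w', α', β', q1, q2, q3, q4, q5, q6⟩ := exists_smaller_of_eval h hv hw hαβ hβ hs
    exact descend v' w' α' β' q1 q2 q3 q4 q5 q6
  by_cases hl : Indep (fun i => (v i).coeff α) (fun i => (w i).coeff β)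
  swap
  · obtain ⟨v', w', α', β', q1, q2, q3, q4, q5, q6⟩ := exists_smaller_of_leading h hv hw hαβ hβ hl
    exact descend v' w' α' β' q1 q2 q3 q4 q5 q6
  obtain ⟨v', w', q1, q2, q3, q4, q5⟩ := h.exists_contraction p hv hw hαβ hs hl
    (h.der_inSpan hc hv hw hs hl)
  have hp := (Fact.out : p.Prime)
  obtain ⟨v₀, w₀, h0, h1, h2⟩ := ih _
    (Nat.add_lt_add_of_le_of_lt (Nat.div_le_self α p) (Nat.div_lt_self hβ hp.one_lt)) q1 _ q2 _ q3 rfl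
  have push : ∀ u : Fin 5 → k, InSpan v' w' (C ∘ u) → InSpan v w (C ∘ u) := by
    rintro u ⟨d, a, b, hd, hab⟩
    refine InSpan.trans ⟨expand k p d, expand k p a, expand k p b,
      (expand_eq_zero hp.pos).not.mpr hd, funext fun i => ?_⟩ q4 q5
    have := congrArg (expand k p) (congrFun hab i)
    simpa using this
  exact ⟨v₀, w₀, h0, push _ h1, push _ h2⟩

end Families

end CubicLines

namespace CubicLines

open Polynomial

section Descending

variable {M κ : Type*} [Field M]

/-- A finite family which is dependent over every member of a decreasing sequence of subfields is
dependent over their intersection. -/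
lemma exists_common_relation (S : ℕ → Subfield M) (hS : Antitone S) (b : κ → M) (s : Finset κ)
    (h : ∀ n, ∃ c : κ → M, (∀ i, c i ∈ S n) ∧ (∃ i ∈ s, c i ≠ 0) ∧ ∑ i ∈ s, c i * b i = 0) :
    ∃ c : κ → M, (∀ i n, c i ∈ S n) ∧ (∃ i ∈ s, c i ≠ 0) ∧ ∑ i ∈ s, c i * b i = 0 := by
  classical
  induction s using Finset.induction_on with
  | empty => obtain ⟨c, -, ⟨i, hi, -⟩, -⟩ := h 0; simp at hi
  | insert a s ha ih =>
    by_cases hd : ∀ n, ∃ c : κ → M, (∀ i, c i ∈ S n) ∧ (∃ i ∈ s, c i ≠ 0) ∧ ∑ i ∈ s, c i * b i = 0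
    · obtain ⟨c, h1, ⟨i, hi, hi0⟩, h3⟩ := ih hd
      refine ⟨Function.update c a 0, fun j n => ?_, ⟨i, Finset.mem_insert_of_mem hi, ?_⟩, ?_⟩
      · rcases eq_or_ne j a with rfl | hj
        · rw [Function.update_self]; exact zero_mem _
        · rw [Function.update_of_ne hj]; exact h1 j n
      · rwa [Function.update_of_ne (ne_of_mem_of_not_mem hi ha)]
      · rw [Finset.sum_insert ha, Function.update_self, zero_mul, zero_add, ← h3]
        exact Finset.sum_congr rfl fun j hj => by
          rw [Function.update_of_ne (ne_of_mem_of_not_mem hj ha)]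
    · push Not at hd
      obtain ⟨m, hm⟩ := hd
      have hm' : ∀ c : κ → M, (∀ i, c i ∈ S m) → ∑ i ∈ s, c i * b i = 0 → ∀ i ∈ s, c i = 0 := by
        intro c h1 h2 i hi
        by_contra hc
        exact hm c h1 ⟨i, hi, hc⟩ h2
      have key : ∀ n, m ≤ n → ∃ c : κ → M, (∀ i, c i ∈ S n) ∧ b a + ∑ i ∈ s, c i * b i = 0 := by
        intro n hn
        obtain ⟨c, h1, ⟨i, hi, hi0⟩, h3⟩ := h n
        rw [Finset.sum_insert ha] at h3
        have hca : c a ≠ 0 := by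
          intro hca
          rw [hca, zero_mul, zero_add] at h3
          rcases Finset.mem_insert.mp hi with rfl | hi
          · exact hi0 hca
          · exact hi0 (hm' c (fun i => hS hn (h1 i)) h3 i hi)
        refine ⟨fun i => (c a)⁻¹ * c i, fun i => mul_mem (inv_mem (h1 a)) (h1 i), ?_⟩
        simp only [mul_assoc, ← Finset.mul_sum]
        field_simp
        linear_combination h3
      obtain ⟨c, h1, h2⟩ := key m le_rfl
      have h4 : ∀ n, m ≤ n → ∀ i ∈ s, c i ∈ S n := by
        intro n hn i hi
        obtain ⟨c', h1', h2'⟩ := key n hn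
        have := hm' (fun i => c i - c' i) (fun i => sub_mem (h1 i) (hS hn (h1' i)))
          (by simp only [sub_mul, Finset.sum_sub_distrib]; linear_combination h2 - h2') i hi
        rw [sub_eq_zero.mp this]
        exact h1' i
      refine ⟨fun i => if i = a then 1 else if i ∈ s then c i else 0, fun i n => ?_,
        ⟨a, Finset.mem_insert_self _ _, by simp⟩, ?_⟩
      · dsimp only
        split_ifs with h5 h6
        · exact one_mem _
        · exact hS (le_max_right m n) (h4 _ (le_max_left m n) i h6)
        · exact zero_mem _
      · rw [Finset.sum_insert ha, ← h2]
        dsimp only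
        rw [if_pos rfl, one_mul]
        congr 1
        exact Finset.sum_congr rfl fun i hi => by
          rw [if_neg (ne_of_mem_of_not_mem hi ha), if_pos hi]

end Descending

section FrobeniusPowers

variable {𝕜 E : Type*} [Field 𝕜] [Field E] [Algebra 𝕜[X] E] [IsFractionRing 𝕜[X] E]

lemma natDegree_eq_zero_of_pow_dvd {a c : 𝕜[X]} {p n : ℕ} (ha : a ≠ 0) (hn : a.natDegree < p ^ n)
    (h : c ^ p ^ n ∣ a) : c.natDegree = 0 := by
  have h1 := natDegree_le_of_dvd h ha
  rw [natDegree_pow] at h1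
  by_contra hc
  have := Nat.le_mul_of_pos_right (p ^ n) (Nat.pos_of_ne_zero hc)
  omega

lemma mem_range_C_of_forall_exists_pow {p : ℕ} (hp : 1 < p) (x : E)
    (h : ∀ n, ∃ y : E, y ^ p ^ n = x) : ∃ a : 𝕜, algebraMap 𝕜[X] E (C a) = x := by
  have inj := IsFractionRing.injective 𝕜[X] E
  rcases eq_or_ne x 0 with rfl | hx
  · exact ⟨0, by simp⟩
  obtain ⟨a, b, hb, rfl⟩ := IsFractionRing.div_surjective (A := 𝕜[X]) x
  have hb0 := nonZeroDivisors.ne_zero hb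
  have ha0 : a ≠ 0 := by rintro rfl; simp at hx
  obtain ⟨n, hn⟩ : ∃ n, a.natDegree + b.natDegree < p ^ n := ⟨_, Nat.lt_pow_self hp⟩
  obtain ⟨y, hy⟩ := h n
  obtain ⟨c, d, hcd, rfl⟩ := IsFractionRing.exists_reduced_fraction (A := 𝕜[X]) y
  rw [IsFractionRing.mk'_eq_div] at hy
  have hd0 := nonZeroDivisors.ne_zero d.2
  have hd0' : algebraMap 𝕜[X] E d ≠ 0 := (map_ne_zero_iff _ inj).mpr hd0
  have hb0' : algebraMap 𝕜[X] E b ≠ 0 := (map_ne_zero_iff _ inj).mpr hb0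
  have heq : c ^ p ^ n * b = a * (d : 𝕜[X]) ^ p ^ n := by
    apply inj
    simp only [map_mul, map_pow]
    rw [div_pow, div_eq_div_iff (pow_ne_zero _ hd0') hb0'] at hy
    exact hy
  have hco : IsCoprime (c ^ p ^ n) ((d : 𝕜[X]) ^ p ^ n) := (hcd.isCoprime).pow
  have h1 := natDegree_eq_zero_of_pow_dvd ha0 (n := n) (p := p) (by omega)
    (hco.dvd_of_dvd_mul_right ⟨b, heq.symm⟩)
  have h2 := natDegree_eq_zero_of_pow_dvd hb0 (n := n) (p := p) (c := (d : 𝕜[X])) (by omega)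
    (hco.symm.dvd_of_dvd_mul_left ⟨a, by rw [heq, mul_comm]⟩)
  obtain ⟨c', hc'⟩ := natDegree_eq_zero.mp h1
  obtain ⟨d', hd'⟩ := natDegree_eq_zero.mp h2
  have hd'0 : d' ≠ 0 := by rintro rfl; rw [C_0] at hd'; exact hd0 hd'.symm
  refine ⟨(c' / d') ^ p ^ n, ?_⟩
  have : (C (c' / d') : 𝕜[X]) * d = c := by rw [← hc', ← hd', ← C_mul, div_mul_cancel₀ _ hd'0]
  rw [← hy, C_pow, map_pow]
  congr 1
  rw [eq_div_iff hd0', ← map_mul, this]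

variable {M : Type*} [Field M] [Algebra E M]

lemma mem_range_of_forall_exists_pow [IsAlgClosed 𝕜] [FiniteDimensional E M] (p : ℕ) [Fact p.Prime]
    [CharP E p] (x : M) (h : ∀ n, ∃ y : M, y ^ p ^ n = x) :
    ∃ a : 𝕜, algebraMap E M (algebraMap 𝕜[X] E (C a)) = x := by
  have hp := (Fact.out : p.Prime)
  have : CharP M p := charP_of_injective_algebraMap (algebraMap E M).injective p
  have : ExpChar E p := ExpChar.prime hp
  have : ExpChar M p := ExpChar.prime hp
  let S : ℕ → Subfield M := fun n => ((iterateFrobenius E p n).fieldRange).map (algebraMap E M)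
  have hSmem : ∀ n z, z ∈ S n ↔ ∃ y : E, algebraMap E M (y ^ p ^ n) = z := by
    intro n z
    simp [S, Subfield.mem_map, iterateFrobenius_def]
  have hS : Antitone S := by
    refine antitone_nat_of_succ_le fun n z hz => ?_
    obtain ⟨y, hy⟩ := (hSmem _ _).mp hz
    exact (hSmem _ _).mpr ⟨y ^ p, by rw [← hy, ← pow_mul, ← pow_succ']⟩
  obtain ⟨c, h1, ⟨i, hi, hi0⟩, h3⟩ := exists_common_relation S hS (fun i : ℕ => x ^ i)
    (Finset.range (Module.finrank E M + 1)) (by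
      intro n
      obtain ⟨y, hy⟩ := h n
      have hint : IsIntegral E y := Algebra.IsIntegral.isIntegral y
      have hdeg := minpoly.natDegree_le (A := E) y
      refine ⟨fun i => algebraMap E M ((minpoly E y).coeff i ^ p ^ n),
        fun i => (hSmem _ _).mpr ⟨_, rfl⟩,
        ⟨(minpoly E y).natDegree, Finset.mem_range.mpr (by omega), ?_⟩, ?_⟩
      · dsimp only
        rw [show (minpoly E y).coeff (minpoly E y).natDegree = 1 from minpoly.monic hint]
        simp
      · have := minpoly.aeval E y
        rw [aeval_eq_sum_range' (n := Module.finrank E M + 1) (by omega)] at this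
        have := congrArg (· ^ p ^ n) this
        simp only [sum_pow_char_pow] at this
        rw [zero_pow (pow_ne_zero _ hp.ne_zero)] at this
        rw [← this]
        refine Finset.sum_congr rfl fun i _ => ?_
        dsimp only
        rw [← hy, Algebra.smul_def, mul_pow, map_pow, ← pow_mul, ← pow_mul, mul_comm i])
  have hc : ∀ i, ∃ a : 𝕜, algebraMap E M (algebraMap 𝕜[X] E (C a)) = c i := by
    intro i
    obtain ⟨z, hz⟩ := (hSmem 0 _).mp (h1 i 0)
    obtain ⟨a, ha⟩ := mem_range_C_of_forall_exists_pow (𝕜 := 𝕜) hp.one_lt (z ^ p ^ 0) fun n => by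
      obtain ⟨y, hy⟩ := (hSmem n _).mp (h1 i n)
      exact ⟨y, (algebraMap E M).injective (hy.trans hz.symm)⟩
    exact ⟨a, by rw [ha, hz]⟩
  choose a ha using hc
  let ι : 𝕜 →+* M := (algebraMap E M).comp ((algebraMap 𝕜[X] E).comp C)
  let _ : Algebra 𝕜 M := ι.toAlgebra
  have hint : IsIntegral 𝕜 x := by
    rw [← isAlgebraic_iff_isIntegral]
    refine ⟨∑ i ∈ Finset.range (Module.finrank E M + 1), C (a i) * X ^ i, fun h0 => hi0 ?_, ?_⟩
    · have := congrArg (coeff · i) h0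
      simp only [finsetSum_coeff, coeff_C_mul, coeff_X_pow, mul_ite, mul_one, mul_zero,
        Finset.sum_ite_eq, hi, if_true, coeff_zero] at this
      rw [← ha, this]; simp
    · rw [map_sum, ← h3]
      refine Finset.sum_congr rfl fun i _ => ?_
      rw [map_mul, aeval_C, map_pow, aeval_X, ← ha]
      rfl
  obtain ⟨b, hb⟩ := minpoly.mem_range_of_degree_eq_one 𝕜 x
    (IsAlgClosed.degree_eq_one_of_irreducible 𝕜 (minpoly.irreducible hint))
  exact ⟨b, hb⟩

end FrobeniusPowers

section Filtration

variable {𝕜 : Type*} [Field 𝕜] (h : 𝕜[X][X])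

/-- The span of the `t ^ a * u ^ m` with `a ≤ d` and `m < deg h` in the ring `𝕜[t][u]/(h)`. -/
noncomputable def Fil (d : ℕ) : Submodule 𝕜 (AdjoinRoot h) :=
  Submodule.span 𝕜 (Set.range fun x : Fin (d + 1) × Fin h.natDegree =>
    AdjoinRoot.of h X ^ (x.1 : ℕ) * AdjoinRoot.root h ^ (x.2 : ℕ))

instance finiteDimensional_fil (d : ℕ) : FiniteDimensional 𝕜 (Fil h d) :=
  FiniteDimensional.span_of_finite 𝕜 (Set.finite_range _)

lemma finrank_fil_le (d : ℕ) : Module.finrank 𝕜 (Fil h d) ≤ (d + 1) * h.natDegree := by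
  refine (finrank_range_le_card _).trans ?_
  simp

variable {h}

lemma mem_fil {d a m : ℕ} (ha : a ≤ d) (hm : m < h.natDegree) :
    AdjoinRoot.of h X ^ a * AdjoinRoot.root h ^ m ∈ Fil h d :=
  Submodule.subset_span ⟨(⟨a, by omega⟩, ⟨m, hm⟩), rfl⟩

lemma fil_induction {d : ℕ} (S : Submodule 𝕜 (AdjoinRoot h)) (r : AdjoinRoot h)
    (hS : ∀ a m, a ≤ d → m < h.natDegree →
      r * (AdjoinRoot.of h X ^ a * AdjoinRoot.root h ^ m) ∈ S) {x : AdjoinRoot h}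
    (hx : x ∈ Fil h d) : r * x ∈ S := by
  refine Submodule.span_induction ?_ ?_ ?_ ?_ hx
  · rintro _ ⟨⟨a, m⟩, rfl⟩
    exact hS a m (by omega) m.2
  · rw [mul_zero]; exact zero_mem _
  · intro x y _ _ h1 h2
    rw [mul_add]; exact add_mem h1 h2
  · intro a x _ h1
    rw [mul_smul_comm]; exact S.smul_mem a h1

lemma fil_mono {d d' : ℕ} (hd : d ≤ d') : Fil h d ≤ Fil h d' := fun x hx => by
  rw [← one_mul x]
  refine fil_induction _ 1 (fun a m ha hm => ?_) hx
  rw [one_mul]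
  exact mem_fil (by omega) hm

lemma of_C_mul (a : 𝕜) (x : AdjoinRoot h) : AdjoinRoot.of h (C a) * x = a • x := by
  rw [Algebra.smul_def]; rfl

lemma t_pow_mul_mem_fil {d : ℕ} (n : ℕ) {x : AdjoinRoot h} (hx : x ∈ Fil h d) :
    AdjoinRoot.of h X ^ n * x ∈ Fil h (d + n) :=
  fil_induction _ _ (fun a m ha hm => by
    rw [← mul_assoc, ← pow_add]
    exact mem_fil (by omega) hm) hx

lemma of_mul_mem_fil {d e : ℕ} {f : 𝕜[X]} (hf : f.natDegree ≤ e) {x : AdjoinRoot h}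
    (hx : x ∈ Fil h d) : AdjoinRoot.of h f * x ∈ Fil h (d + e) := by
  rw [f.as_sum_range_C_mul_X_pow, map_sum, Finset.sum_mul]
  refine sum_mem fun i hi => ?_
  rw [map_mul, mul_assoc, of_C_mul, map_pow]
  refine Submodule.smul_mem _ _ (fil_mono ?_ (t_pow_mul_mem_fil i hx))
  have := Finset.mem_range.mp hi
  omega

lemma root_pow_natDegree_mem (hm : h.Monic) {e : ℕ} (he : ∀ i, (h.coeff i).natDegree ≤ e) :
    AdjoinRoot.root h ^ h.natDegree ∈ Fil h e := by
  have h1 : AdjoinRoot.mk h h = 0 := AdjoinRoot.mk_self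
  conv at h1 => lhs; arg 2; rw [hm.as_sum]
  rw [map_add, map_pow, AdjoinRoot.mk_X, map_sum] at h1
  rw [eq_neg_of_add_eq_zero_left h1]
  refine neg_mem (sum_mem fun i hi => ?_)
  rw [map_mul, AdjoinRoot.mk_C, map_pow, AdjoinRoot.mk_X]
  have := of_mul_mem_fil (h := h) (d := 0) (he i)
    (mem_fil (a := 0) (le_refl 0) (Finset.mem_range.mp hi))
  simpa using this

lemma root_mul_mem_fil (hm : h.Monic) {d e : ℕ} (he : ∀ i, (h.coeff i).natDegree ≤ e)
    {x : AdjoinRoot h} (hx : x ∈ Fil h d) : AdjoinRoot.root h * x ∈ Fil h (d + e) := by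
  refine fil_induction _ _ (fun a m ha hm' => ?_) hx
  rw [mul_left_comm, ← pow_succ']
  rcases (Nat.succ_le_of_lt hm').eq_or_lt with h1 | h1
  · rw [← Nat.succ_eq_add_one, h1]
    exact fil_mono (by omega) (t_pow_mul_mem_fil a (root_pow_natDegree_mem hm he))
  · exact mem_fil (by omega) h1

lemma root_pow_mul_mem_fil (hm : h.Monic) {d e : ℕ} (he : ∀ i, (h.coeff i).natDegree ≤ e) (n : ℕ)
    {x : AdjoinRoot h} (hx : x ∈ Fil h d) :
    AdjoinRoot.root h ^ n * x ∈ Fil h (d + e * n) := by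
  induction n with
  | zero => simpa using hx
  | succ n ih =>
    rw [pow_succ', mul_assoc]
    have := root_mul_mem_fil hm he ih
    rwa [mul_add, mul_one, ← add_assoc]

lemma one_mem_fil (hN : 0 < h.natDegree) : (1 : AdjoinRoot h) ∈ Fil h 0 := by
  have := mem_fil (h := h) (a := 0) (le_refl 0) hN
  simpa using this

lemma t_pow_mul_root_pow_mem_fil (hm : h.Monic) (hN : 0 < h.natDegree) {e : ℕ}
    (he : ∀ i, (h.coeff i).natDegree ≤ e) (a m : ℕ) :
    AdjoinRoot.of h X ^ a * AdjoinRoot.root h ^ m ∈ Fil h (a + e * m) := by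
  have := t_pow_mul_mem_fil a (root_pow_mul_mem_fil hm he m (one_mem_fil hN))
  rw [mul_one] at this
  exact fil_mono (by omega) this

lemma exists_mem_fil (hm : h.Monic) (hN : 0 < h.natDegree) (x : AdjoinRoot h) :
    ∃ d, x ∈ Fil h d := by
  obtain ⟨e, he⟩ : ∃ e, ∀ i, (h.coeff i).natDegree ≤ e :=
    ⟨∑ i ∈ h.support, (h.coeff i).natDegree, fun i => by
      by_cases hi : i ∈ h.support
      · exact Finset.single_le_sum (f := fun i => (h.coeff i).natDegree)
          (fun _ _ => Nat.zero_le _) hi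
      · rw [notMem_support_iff.mp hi, natDegree_zero]; exact Nat.zero_le _⟩
  obtain ⟨f, rfl⟩ := AdjoinRoot.mk_surjective x
  induction f using Polynomial.induction_on' with
  | add f g hf hg =>
    obtain ⟨d, hd⟩ := hf
    obtain ⟨d', hd'⟩ := hg
    refine ⟨max d d', ?_⟩
    rw [map_add]
    exact add_mem (fil_mono (le_max_left _ _) hd) (fil_mono (le_max_right _ _) hd')
  | monomial n a =>
    refine ⟨0 + e * n + a.natDegree, ?_⟩
    rw [← C_mul_X_pow_eq_monomial, map_mul, AdjoinRoot.mk_C, map_pow, AdjoinRoot.mk_X]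
    have := root_pow_mul_mem_fil hm he n (one_mem_fil hN)
    rw [mul_one] at this
    exact of_mul_mem_fil le_rfl this

lemma exists_polynomial_of_mem_fil {d : ℕ} {x : AdjoinRoot h} (hx : x ∈ Fil h d) :
    ∃ f : 𝕜[X][X], f ∈ degreeLT 𝕜[X] h.natDegree ∧ (∀ i, (f.coeff i).natDegree ≤ d) ∧
      AdjoinRoot.mk h f = x := by
  refine Submodule.span_induction ?_ ?_ ?_ ?_ hx
  · rintro _ ⟨⟨a, m⟩, rfl⟩
    refine ⟨C (X ^ (a : ℕ)) * X ^ (m : ℕ), ?_, fun i => ?_, ?_⟩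
    · rw [mem_degreeLT]
      exact (degree_C_mul_X_pow_le _ _).trans_lt (by exact_mod_cast m.2)
    · rw [coeff_C_mul_X_pow]
      split_ifs
      · rw [natDegree_X_pow]; omega
      · simp
    · simp
  · exact ⟨0, zero_mem _, by simp, map_zero _⟩
  · rintro x y _ _ ⟨f, h1, h2, rfl⟩ ⟨g, h3, h4, rfl⟩
    exact ⟨f + g, add_mem h1 h3, fun i => by
      rw [coeff_add]; exact natDegree_add_le_of_degree_le (h2 i) (h4 i), map_add _ _ _⟩
  · rintro a x _ ⟨f, h1, h2, rfl⟩
    refine ⟨C (C a) * f, ?_, fun i => ?_, ?_⟩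
    · rw [← smul_eq_C_mul]; exact Submodule.smul_mem _ _ h1
    · rw [coeff_C_mul]; exact (natDegree_C_mul_le _ _).trans (h2 i)
    · rw [map_mul, AdjoinRoot.mk_C, of_C_mul]

/-- An element of the `D`-th step of the filtration which vanishes at all points over more than `D`
values of `t` is zero. -/
lemma eq_zero_of_forall_lift_eq_zero [IsAlgClosed 𝕜] (hm : h.Monic) {d : ℕ} {x : AdjoinRoot h}
    (hx : x ∈ Fil h d) (S : Finset 𝕜) (hS : d < S.card)
    (hsep : ∀ s ∈ S, (h.map (evalRingHom s)).Separable)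
    (hzero : ∀ s ∈ S, ∀ (u : 𝕜) (hu : h.eval₂ (evalRingHom s) u = 0),
      AdjoinRoot.lift (evalRingHom s) u hu x = 0) : x = 0 := by
  classical
  obtain ⟨f, h1, h2, rfl⟩ := exists_polynomial_of_mem_fil hx
  have key : ∀ s ∈ S, f.map (evalRingHom s) = 0 := by
    intro s hs
    have hne : h.map (evalRingHom s) ≠ 0 := (hm.map _).ne_zero
    by_contra hf
    have hcard : (h.map (evalRingHom s)).roots.toFinset.card = h.natDegree := by
      rw [Multiset.toFinset_card_of_nodup (nodup_roots (hsep s hs)),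
        ← hm.natDegree_map (evalRingHom s)]
      exact (splits_iff_card_roots.mp (IsAlgClosed.splits _))
    have hle : (h.map (evalRingHom s)).roots.toFinset ⊆ (f.map (evalRingHom s)).roots.toFinset := by
      intro u hu
      rw [Multiset.mem_toFinset, mem_roots hne, IsRoot.def, eval_map] at hu
      rw [Multiset.mem_toFinset, mem_roots hf, IsRoot.def, eval_map]
      have := hzero s hs u hu
      rwa [AdjoinRoot.lift_mk] at this
    have h3 := (Finset.card_le_card hle).trans (Multiset.toFinset_card_le _)
    have h4 := card_roots' (f.map (evalRingHom s))
    have h5 : (f.map (evalRingHom s)).degree < h.natDegree :=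
      degree_map_le.trans_lt (mem_degreeLT.mp h1)
    rw [degree_eq_natDegree hf, Nat.cast_lt] at h5
    omega
  have : f = 0 := by
    ext1 i
    rw [coeff_zero]
    refine eq_zero_of_natDegree_lt_card_of_eval_eq_zero' _ S (fun s hs => ?_)
      ((h2 i).trans_lt hS)
    have := congrArg (coeff · i) (key s hs)
    simpa using this
  rw [this, map_zero]

end Filtration

section Independence

variable {𝕜 : Type*} [Field 𝕜] {h : 𝕜[X][X]}

lemma monomials_independent (hm : h.Monic) {A N : ℕ} (hN : N ≤ h.natDegree) (a : Fin A × Fin N → 𝕜)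
    (ha : ∑ x, a x • (AdjoinRoot.of h X ^ (x.1 : ℕ) * AdjoinRoot.root h ^ (x.2 : ℕ)) = 0) :
    a = 0 := by
  have h1 : AdjoinRoot.mk h (∑ x, C (C (a x) * X ^ (x.1 : ℕ)) * X ^ (x.2 : ℕ)) = 0 := by
    rw [← ha, map_sum]
    refine Finset.sum_congr rfl fun x _ => ?_
    rw [map_mul, map_pow, AdjoinRoot.mk_C, AdjoinRoot.mk_X, map_mul, map_pow, mul_assoc, of_C_mul]
  have h2 : (∑ x, C (C (a x) * X ^ (x.1 : ℕ)) * X ^ (x.2 : ℕ) : 𝕜[X][X]) = 0 := by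
    refine eq_zero_of_dvd_of_degree_lt (AdjoinRoot.mk_eq_zero.mp h1) ?_
    rw [degree_eq_natDegree hm.ne_zero]
    refine mem_degreeLT.mp (sum_mem fun x _ => mem_degreeLT.mpr ?_)
    exact (degree_C_mul_X_pow_le _ _).trans_lt (by exact_mod_cast x.2.2.trans_le hN)
  funext ⟨r, l⟩
  have := congrArg (fun f => (f.coeff (l : ℕ)).coeff (r : ℕ)) h2
  simp only [finsetSum_coeff, coeff_C_mul_X_pow, coeff_zero] at this
  rw [Finset.sum_eq_single (r, l), if_pos rfl, coeff_C_mul_X_pow, if_pos rfl] at this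
  · exact this
  · rintro ⟨i, j⟩ - hij
    split_ifs with h3
    · rw [coeff_C_mul_X_pow, if_neg]
      intro h4
      exact hij (Prod.ext (Fin.ext h4.symm) (Fin.ext h3.symm))
    · exact coeff_zero _
  · simp

variable (E : Type*) [Field E] [Algebra 𝕜[X] E] [IsFractionRing 𝕜[X] E]

lemma adjoinRoot_map_injective (hm : h.Monic) :
    Function.Injective (AdjoinRoot.map (algebraMap 𝕜[X] E) h (h.map (algebraMap 𝕜[X] E)) dvd_rfl) := by
  rw [injective_iff_map_eq_zero]
  intro x hx
  obtain ⟨f, rfl⟩ := AdjoinRoot.mk_surjective x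
  rw [AdjoinRoot.map, AdjoinRoot.lift_mk, ← eval₂_map, ← AdjoinRoot.algebraMap_eq, ← aeval_def,
    AdjoinRoot.aeval_eq, AdjoinRoot.mk_eq_zero, map_dvd_map _ (IsFractionRing.injective 𝕜[X] E) hm] at hx
  exact AdjoinRoot.mk_eq_zero.mpr hx

/-- The monomials `t ^ r * u ^ l` with `r < A` are linearly independent over sufficiently high
Frobenius powers. -/
lemma exists_frobenius_level [IsAlgClosed 𝕜] (p : ℕ) [Fact p.Prime] [CharP 𝕜 p] (hm : h.Monic)
    (hirr : Irreducible (h.map (algebraMap 𝕜[X] E))) (A N : ℕ) (hN : N ≤ h.natDegree) :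
    ∃ n₀, ∀ n, n₀ ≤ n → ∀ z : Fin A × Fin N → AdjoinRoot h,
      ∑ x, z x ^ p ^ n * (AdjoinRoot.of h X ^ (x.1 : ℕ) * AdjoinRoot.root h ^ (x.2 : ℕ)) = 0 →
        z = 0 := by
  by_contra! hcon
  have hp := (Fact.out : p.Prime)
  let hE := h.map (algebraMap 𝕜[X] E)
  have : Fact (Irreducible hE) := ⟨hirr⟩
  let M := AdjoinRoot hE
  have hmE : hE.Monic := hm.map _
  have inj := IsFractionRing.injective 𝕜[X] E
  have : CharP 𝕜[X] p := inferInstance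
  have : CharP E p := charP_of_injective_ringHom inj p
  have : CharP M p := charP_of_injective_ringHom (algebraMap E M).injective p
  have : ExpChar M p := ExpChar.prime hp
  have : FiniteDimensional E M := (AdjoinRoot.powerBasis hmE.ne_zero).finite
  let j : AdjoinRoot h →+* M := AdjoinRoot.map (algebraMap 𝕜[X] E) h hE dvd_rfl
  have hj : Function.Injective j := adjoinRoot_map_injective E hm
  let S : ℕ → Subfield M := fun n => (iterateFrobenius M p n).fieldRange
  have hSmem : ∀ n z, z ∈ S n ↔ ∃ y : M, y ^ p ^ n = z := by
    intro n z
    simp [S, iterateFrobenius_def]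
  have hS : Antitone S := by
    intro m n hmn z hz
    obtain ⟨y, hy⟩ := (hSmem _ _).mp hz
    refine (hSmem _ _).mpr ⟨y ^ p ^ (n - m), ?_⟩
    rw [← hy, ← pow_mul, ← pow_add, Nat.sub_add_cancel hmn]
  let b : Fin A × Fin N → AdjoinRoot h := fun x =>
    AdjoinRoot.of h X ^ (x.1 : ℕ) * AdjoinRoot.root h ^ (x.2 : ℕ)
  obtain ⟨c, h1, ⟨i, -, hi0⟩, h3⟩ := exists_common_relation S hS (fun x => j (b x)) Finset.univ
    (by
      intro n
      obtain ⟨m, hmn, z, hz, hz0⟩ := hcon n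
      obtain ⟨x, hx⟩ := Function.ne_iff.mp hz0
      refine ⟨fun x => j (z x) ^ p ^ m, fun x => hS hmn ((hSmem _ _).mpr ⟨_, rfl⟩),
        ⟨x, Finset.mem_univ x, pow_ne_zero _ ((map_ne_zero_iff j hj).mpr hx)⟩, ?_⟩
      rw [← map_zero j, ← hz, map_sum]
      exact Finset.sum_congr rfl fun x _ => by
        simp only [b, map_mul, map_pow])
  have hc : ∀ x, ∃ a : 𝕜, algebraMap E M (algebraMap 𝕜[X] E (C a)) = c x := fun x =>
    mem_range_of_forall_exists_pow p (c x) fun n => (hSmem _ _).mp (h1 x n)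
  choose a ha using hc
  have hja : ∀ a : 𝕜, j (AdjoinRoot.of h (C a)) = algebraMap E M (algebraMap 𝕜[X] E (C a)) := by
    intro a
    exact AdjoinRoot.map_of _ _ _ dvd_rfl _
  have := monomials_independent hm hN a (hj (by
    rw [map_zero, ← h3, map_sum]
    refine Finset.sum_congr rfl fun x _ => ?_
    rw [← of_C_mul, map_mul, hja, ha]))
  apply hi0
  rw [← ha, this]
  simp

end Independence

section AuxiliaryFunction

variable {𝕜 : Type*} [Field 𝕜] {h : 𝕜[X][X]}

/-- The components of the auxiliary function with coefficient vector `γ`, as a linear map. -/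
noncomputable def auxComponent (h : 𝕜[X][X]) (P I N A : ℕ) (j : Fin N) :
    (Fin I → Fin N → Fin A × Fin N → 𝕜) →ₗ[𝕜] AdjoinRoot h where
  toFun γ := ∑ i : Fin I, ∑ x : Fin A × Fin N, γ i j x •
    (AdjoinRoot.of h X ^ (x.1 * P + i : ℕ) * AdjoinRoot.root h ^ (x.2 * P : ℕ))
  map_add' γ δ := by simp only [Pi.add_apply, add_smul, Finset.sum_add_distrib]
  map_smul' a γ := by
    simp only [Pi.smul_apply, smul_eq_mul, mul_smul, Finset.smul_sum, RingHom.id_apply]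

lemma auxComponent_apply (P I N A : ℕ) (j : Fin N) (γ : Fin I → Fin N → Fin A × Fin N → 𝕜) :
    auxComponent h P I N A j γ = ∑ i : Fin I, ∑ x : Fin A × Fin N, γ i j x •
      (AdjoinRoot.of h X ^ (x.1 * P + i : ℕ) * AdjoinRoot.root h ^ (x.2 * P : ℕ)) := rfl

lemma auxComponent_mem_fil (hm : h.Monic) {e : ℕ} (he : ∀ i, (h.coeff i).natDegree ≤ e)
    {P I N A : ℕ} (hN : h.natDegree = N) (hN0 : 0 < N) (j : Fin N)
    (γ : Fin I → Fin N → Fin A × Fin N → 𝕜) :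
    auxComponent h P I N A j γ ∈ Fil h (A * P + I + e * N * P) := by
  rw [auxComponent_apply]
  refine sum_mem fun i _ => sum_mem fun x _ => Submodule.smul_mem _ _ ?_
  refine fil_mono ?_ (t_pow_mul_root_pow_mem_fil hm (hN ▸ hN0) he _ _)
  have h1 : (x.1 : ℕ) * P ≤ A * P := Nat.mul_le_mul_right _ x.1.2.le
  have h2 : e * (x.2 * P : ℕ) ≤ e * N * P := by
    rw [mul_assoc]; exact Nat.mul_le_mul_left _ (Nat.mul_le_mul_right _ x.2.2.le)
  have := i.2
  omega

lemma mul_mem_fil {C₀ d : ℕ} {g x : AdjoinRoot h}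
    (hg : ∀ m < h.natDegree, AdjoinRoot.root h ^ m * g ∈ Fil h C₀) (hx : x ∈ Fil h d) :
    x * g ∈ Fil h (d + C₀) := by
  rw [mul_comm]
  refine fil_induction _ _ (fun a m ha hm => ?_) hx
  rw [mul_left_comm, mul_comm g]
  exact fil_mono (by omega) (t_pow_mul_mem_fil a (hg m hm))

lemma exists_auxiliary (hm : h.Monic) {e n C₀ P I A : ℕ} (he : ∀ i, (h.coeff i).natDegree ≤ e)
    (hN : h.natDegree = n + 1) (g : Fin n → AdjoinRoot h)
    (hg : ∀ j, ∀ m < h.natDegree, AdjoinRoot.root h ^ m * g j ∈ Fil h C₀)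
    (hcount : n * ((A * P + I + e * (n + 1) * P + C₀ + 1) * (n + 1)) <
      I * ((n + 1) * (A * (n + 1)))) :
    ∃ γ : Fin I → Fin (n + 1) → Fin A × Fin (n + 1) → 𝕜, γ ≠ 0 ∧ ∀ j : Fin n,
      auxComponent h P I (n + 1) A j.castSucc γ =
        auxComponent h P I (n + 1) A (Fin.last n) γ * g j := by
  have hmem : ∀ (j : Fin n) γ, (auxComponent h P I (n + 1) A j.castSucc -
      LinearMap.mulRight 𝕜 (g j) ∘ₗ auxComponent h P I (n + 1) A (Fin.last n)) γ ∈
        Fil h (A * P + I + e * (n + 1) * P + C₀) := fun j γ =>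
    sub_mem (fil_mono (Nat.le_add_right _ _) (auxComponent_mem_fil hm he hN n.succ_pos _ γ))
      (mul_mem_fil (hg j) (auxComponent_mem_fil hm he hN n.succ_pos _ γ))
  let Φ := LinearMap.pi fun j => LinearMap.codRestrict _ _ (hmem j)
  have hker : LinearMap.ker Φ ≠ ⊥ := by
    apply LinearMap.ker_ne_bot_of_finrank_lt
    rw [Module.finrank_pi_fintype]
    refine (Finset.sum_le_card_nsmul _ _ _ fun j _ => finrank_fil_le h _).trans_lt ?_
    simp only [Module.finrank_pi_fintype, Module.finrank_self, hN]
    simpa using hcount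
  obtain ⟨γ, h1, h2⟩ := Submodule.exists_mem_ne_zero_of_ne_bot hker
  refine ⟨γ, h2, fun j => sub_eq_zero.mp ?_⟩
  exact congrArg Subtype.val (congrFun (LinearMap.mem_ker.mp h1) j)

end AuxiliaryFunction

section Cofactor

variable {𝕜 : Type*} [Field 𝕜] {h : 𝕜[X][X]}

/-- The quotient of `h` by `X - u`, where `u` is the root of `h` in `𝕜[t][u]/(h)`. -/
noncomputable def cofactor (h : 𝕜[X][X]) : (AdjoinRoot h)[X] :=
  h.map (AdjoinRoot.of h) /ₘ (X - C (AdjoinRoot.root h))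

lemma mul_cofactor : (X - C (AdjoinRoot.root h)) * cofactor h = h.map (AdjoinRoot.of h) := by
  rw [cofactor, mul_divByMonic_eq_iff_isRoot, IsRoot, eval_map, AdjoinRoot.eval₂_root]

lemma cofactor_eval (hm : h.Monic) {n : ℕ} (hN : h.natDegree = n + 1) {T : Type*} [Field T]
    (ev : AdjoinRoot h →+* T) (w : T) :
    (w - ev (AdjoinRoot.root h)) *
      ((∑ j : Fin n, ev ((cofactor h).coeff j) * w ^ (j : ℕ)) + w ^ n) =
      h.eval₂ (ev.comp (AdjoinRoot.of h)) w := by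
  have hmon : (cofactor h).Monic :=
    (monic_X_sub_C _).of_mul_monic_left (mul_cofactor (h := h) ▸ hm.map _)
  have : Nontrivial (AdjoinRoot h) := ev.domain_nontrivial
  have hdeg : (cofactor h).natDegree = n := by
    have := congrArg natDegree (mul_cofactor (h := h))
    rw [(monic_X_sub_C _).natDegree_mul hmon, natDegree_X_sub_C, hm.natDegree_map, hN] at this
    omega
  have h1 := congrArg (eval₂ ev w) (mul_cofactor (h := h))
  rw [eval₂_mul, eval₂_map, eval₂_sub, eval₂_X, eval₂_C] at h1
  rw [← h1, eval₂_eq_sum_range, hdeg, Finset.sum_range_succ, Finset.sum_range]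
  have h2 : (cofactor h).coeff n = 1 := by rw [← hdeg]; exact hmon
  rw [h2, map_one, one_mul]

end Cofactor

lemma exists_stepanov_parameters {p : ℕ} (hp : 1 < p) (e n C₀ : ℕ) :
    ∃ μ I A, p ^ μ = I + e * (n + 1) + 1 ∧
      n * ((A * p ^ μ + I + e * (n + 1) * p ^ μ + C₀ + 1) * (n + 1)) <
        I * ((n + 1) * (A * (n + 1))) := by
  obtain ⟨μ, hμ⟩ : ∃ μ, (n + 1) * (e * (n + 1) + 1) + e * (n + 1) + 1 < p ^ μ :=
    ⟨_, Nat.lt_pow_self hp⟩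
  obtain ⟨I, hI⟩ := Nat.exists_eq_add_of_lt hμ
  obtain ⟨J, hJ⟩ : ∃ J, J = (n + 1) * (e * (n + 1) + 1) + I + 1 := ⟨_, rfl⟩
  refine ⟨μ, J, n * (J + e * (n + 1) * p ^ μ + C₀ + 1) + 1, by rw [hI, hJ]; ring, ?_⟩
  obtain ⟨K, hK⟩ : ∃ K, K = J + e * (n + 1) * p ^ μ + C₀ + 1 := ⟨_, rfl⟩
  have h1 : n * p ^ μ + 1 ≤ J * (n + 1) := by
    have : p ^ μ = J + e * (n + 1) + 1 := by rw [hI, hJ]; ring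
    rw [this]
    nlinarith
  have h2 : (n * K + 1) * (n * p ^ μ + 1) ≤ (n * K + 1) * (J * (n + 1)) :=
    Nat.mul_le_mul_left _ h1
  rw [← hK]
  have h3 : n * ((n * K + 1) * p ^ μ + J + e * (n + 1) * p ^ μ + C₀ + 1) <
      (n * K + 1) * (J * (n + 1)) := by
    refine lt_of_lt_of_le ?_ h2
    have : (n * K + 1) * p ^ μ + J + e * (n + 1) * p ^ μ + C₀ + 1 = (n * K + 1) * p ^ μ + K := by
      rw [hK]; ring
    rw [this]
    nlinarith
  calc _ = n * ((n * K + 1) * p ^ μ + J + e * (n + 1) * p ^ μ + C₀ + 1) * (n + 1) := by ring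
    _ < (n * K + 1) * (J * (n + 1)) * (n + 1) := Nat.mul_lt_mul_of_pos_right h3 n.succ_pos
    _ = _ := by ring

lemma exists_many_frobenius_fixed {𝕜 : Type*} [Field 𝕜] [IsAlgClosed 𝕜] (p : ℕ) [Fact p.Prime]
    [CharP 𝕜 p] (bad : Finset 𝕜) {m : ℕ} (hm : m ≠ 0) :
    ∃ S : Finset 𝕜, p ^ m ≤ S.card + bad.card ∧ ∀ s ∈ S, s ∉ bad ∧ s ^ p ^ m = s := by
  classical
  have h1 : 1 < p ^ m := Nat.one_lt_pow hm (Fact.out : p.Prime).one_lt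
  have hsep := galois_poly_separable (K := 𝕜) p (p ^ m) (dvd_pow_self p hm)
  have hcard : (X ^ p ^ m - X : 𝕜[X]).roots.toFinset.card = p ^ m := by
    rw [Multiset.toFinset_card_of_nodup (nodup_roots hsep),
      IsAlgClosed.card_roots_eq_natDegree, FiniteField.X_pow_card_sub_X_natDegree_eq _ h1]
  refine ⟨(X ^ p ^ m - X : 𝕜[X]).roots.toFinset \ bad, ?_, fun s hs => ?_⟩
  · have := Finset.le_card_sdiff bad (X ^ p ^ m - X : 𝕜[X]).roots.toFinset
    omega
  · obtain ⟨h2, h3⟩ := Finset.mem_sdiff.mp hs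
    refine ⟨h3, ?_⟩
    rw [Multiset.mem_toFinset, mem_roots hsep.ne_zero] at h2
    simpa [sub_eq_zero] using h2

section Stepanov

variable {𝕜 : Type*} [Field 𝕜] {h : 𝕜[X][X]}

lemma lift_smul {s u : 𝕜} (hu : h.eval₂ (evalRingHom s) u = 0) (a : 𝕜) (x : AdjoinRoot h) :
    AdjoinRoot.lift (evalRingHom s) u hu (a • x) = a * AdjoinRoot.lift (evalRingHom s) u hu x := by
  rw [← of_C_mul, map_mul, AdjoinRoot.lift_of, coe_evalRingHom, eval_C]

lemma lift_monomial {s u : 𝕜} (hu : h.eval₂ (evalRingHom s) u = 0) (a b : ℕ) :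
    AdjoinRoot.lift (evalRingHom s) u hu (AdjoinRoot.of h X ^ a * AdjoinRoot.root h ^ b) =
      s ^ a * u ^ b := by
  rw [map_mul, map_pow, map_pow, AdjoinRoot.lift_of, AdjoinRoot.lift_root, coe_evalRingHom, eval_X]

lemma eval_frobenius_eq_zero (p : ℕ) [Fact p.Prime] [CharP 𝕜 p] {m : ℕ}
    (hfix : ∀ i j, ((h.coeff i).coeff j) ^ p ^ m = (h.coeff i).coeff j) {s u : 𝕜}
    (hs : s ^ p ^ m = s) (hu : h.eval₂ (evalRingHom s) u = 0) :
    h.eval₂ (evalRingHom s) (u ^ p ^ m) = 0 := by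
  have h1 : ∀ i, (h.coeff i).eval s ^ p ^ m = (h.coeff i).eval s := by
    intro i
    rw [eval_eq_sum_range, sum_pow_char_pow]
    refine Finset.sum_congr rfl fun j _ => ?_
    rw [mul_pow, hfix, ← pow_mul, mul_comm j, pow_mul, hs]
  have h2 := congrArg (· ^ p ^ m) hu
  simp only [eval₂_eq_sum_range, coe_evalRingHom, sum_pow_char_pow, mul_pow, h1] at h2 ⊢
  rw [zero_pow (pow_ne_zero _ (Fact.out : p.Prime).ne_zero)] at h2
  rw [← h2]
  exact Finset.sum_congr rfl fun i _ => by ring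

end Stepanov

section Stepanov

variable {𝕜 : Type*} [Field 𝕜] {h : 𝕜[X][X]}

/-- Stepanov's auxiliary function, after extraction of a `P`-th root. -/
noncomputable def auxRoot (h : 𝕜[X][X]) (Q I N A : ℕ) (α : Fin I → Fin N → Fin A × Fin N → 𝕜) :
    AdjoinRoot h :=
  ∑ j : Fin N, ∑ i : Fin I, ∑ x : Fin A × Fin N, α i j x •
    (AdjoinRoot.of h X ^ (x.1 + i * Q : ℕ) * AdjoinRoot.root h ^ (x.2 + j * Q : ℕ))

lemma auxRoot_mem_fil (hm : h.Monic) {e : ℕ} (he : ∀ i, (h.coeff i).natDegree ≤ e)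
    {Q I N A : ℕ} (hN0 : 0 < h.natDegree) (α : Fin I → Fin N → Fin A × Fin N → 𝕜) :
    auxRoot h Q I N A α ∈ Fil h (A + I * Q + e * (N + N * Q)) := by
  refine sum_mem fun j _ => sum_mem fun i _ => sum_mem fun x _ => Submodule.smul_mem _ _ ?_
  refine fil_mono ?_ (t_pow_mul_root_pow_mem_fil hm hN0 he _ _)
  refine add_le_add (add_le_add x.1.2.le (Nat.mul_le_mul_right _ i.2.le))
    (Nat.mul_le_mul_left _ (add_le_add x.2.2.le (Nat.mul_le_mul_right _ j.2.le)))

lemma lift_auxRoot_pow (p : ℕ) [Fact p.Prime] [CharP 𝕜 p] {μ Q I N A : ℕ}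
    {α γ : Fin I → Fin N → Fin A × Fin N → 𝕜} (hα : ∀ i j x, α i j x ^ p ^ μ = γ i j x) {s u : 𝕜}
    (hs : s ^ (p ^ μ * Q) = s) (hu : h.eval₂ (evalRingHom s) u = 0) :
    AdjoinRoot.lift (evalRingHom s) u hu (auxRoot h Q I N A α) ^ p ^ μ =
      ∑ j : Fin N, AdjoinRoot.lift (evalRingHom s) u hu (auxComponent h (p ^ μ) I N A j γ) *
        (u ^ (p ^ μ * Q)) ^ (j : ℕ) := by
  simp only [auxRoot, auxComponent_apply, map_sum, sum_pow_char_pow, lift_smul, lift_monomial,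
    Finset.sum_mul]
  refine Finset.sum_congr rfl fun j _ => Finset.sum_congr rfl fun i _ =>
    Finset.sum_congr rfl fun x _ => ?_
  rw [mul_pow, hα, mul_assoc, mul_pow]
  congr 1
  have h1 : (s ^ ((x.1 : ℕ) + i * Q)) ^ p ^ μ = s ^ (x.1 * p ^ μ + i : ℕ) := by
    rw [← pow_mul, add_mul, pow_add, pow_add, mul_assoc, mul_comm Q, mul_comm (i : ℕ), pow_mul s _ (i : ℕ), hs]
  have h2 : (u ^ ((x.2 : ℕ) + j * Q)) ^ p ^ μ = u ^ (x.2 * p ^ μ : ℕ) * (u ^ (p ^ μ * Q)) ^ (j : ℕ) := by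
    rw [← pow_mul, add_mul, pow_add, mul_assoc (j : ℕ), mul_comm Q, mul_comm (j : ℕ), pow_mul u _ (j : ℕ)]
  rw [h1, h2, mul_assoc]

lemma auxRoot_eq (p : ℕ) [Fact p.Prime] [CharP 𝕜 p] [CharP (AdjoinRoot h) p] {n I N A : ℕ}
    {α β : Fin I → Fin N → Fin A × Fin N → 𝕜} (hβ : ∀ i j x, β i j x ^ p ^ n = α i j x) :
    auxRoot h (p ^ n) I N A α = ∑ x : Fin A × Fin N,
      (∑ y : Fin I × Fin N, β y.1 y.2 x •
        (AdjoinRoot.of h X ^ (y.1 : ℕ) * AdjoinRoot.root h ^ (y.2 : ℕ))) ^ p ^ n *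
          (AdjoinRoot.of h X ^ (x.1 : ℕ) * AdjoinRoot.root h ^ (x.2 : ℕ)) := by
  simp only [sum_pow_char_pow, Finset.sum_mul, auxRoot]
  rw [Finset.sum_comm (s := (Finset.univ : Finset (Fin A × Fin N)))]
  rw [Fintype.sum_prod_type, Finset.sum_comm]
  refine Finset.sum_congr rfl fun i _ => Finset.sum_congr rfl fun j _ =>
    Finset.sum_congr rfl fun x _ => ?_
  rw [_root_.smul_pow, hβ, smul_mul_assoc]
  congr 1
  rw [pow_add, pow_add, pow_mul, pow_mul]
  ring

lemma sum_lift_auxComponent_eq_zero (hm : h.Monic) {n P I A : ℕ} (hN : h.natDegree = n + 1)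
    (γ : Fin I → Fin (n + 1) → Fin A × Fin (n + 1) → 𝕜)
    (hγ : ∀ j : Fin n, auxComponent h P I (n + 1) A j.castSucc γ =
      auxComponent h P I (n + 1) A (Fin.last n) γ * (cofactor h).coeff j)
    {s u w : 𝕜} (hu : h.eval₂ (evalRingHom s) u = 0) (hwu : w ≠ u)
    (hw : h.eval₂ (evalRingHom s) w = 0) :
    ∑ j : Fin (n + 1), AdjoinRoot.lift (evalRingHom s) u hu (auxComponent h P I (n + 1) A j γ) *
      w ^ (j : ℕ) = 0 := by
  have h1 := cofactor_eval hm hN (AdjoinRoot.lift (evalRingHom s) u hu) w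
  have h2 : (AdjoinRoot.lift (evalRingHom s) u hu).comp (AdjoinRoot.of h) = evalRingHom s :=
    AdjoinRoot.lift_comp_of hu
  rw [h2, hw, AdjoinRoot.lift_root, mul_eq_zero, or_iff_right (sub_ne_zero.mpr hwu)] at h1
  rw [Fin.sum_univ_castSucc]
  simp only [hγ, map_mul, Fin.val_castSucc, Fin.val_last]
  generalize AdjoinRoot.lift (evalRingHom s) u hu (auxComponent h P I (n + 1) A (Fin.last n) γ) = y
  rw [← mul_zero y, ← h1, mul_add, Finset.mul_sum]
  simp only [mul_assoc]

lemma exists_forall_root_pow_mul_mem_fil (hm : h.Monic) (hN0 : 0 < h.natDegree) {n : ℕ}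
    (g : Fin n → AdjoinRoot h) (N : ℕ) :
    ∃ C₀, ∀ j, ∀ m < N, AdjoinRoot.root h ^ m * g j ∈ Fil h C₀ := by
  choose d hd using fun (j : Fin n) (m : ℕ) =>
    exists_mem_fil hm hN0 (AdjoinRoot.root h ^ m * g j)
  refine ⟨∑ j, ∑ m ∈ Finset.range N, d j m, fun j m hmN => fil_mono ?_ (hd j m)⟩
  exact (Finset.single_le_sum (f := d j) (fun _ _ => Nat.zero_le _)
    (Finset.mem_range.mpr hmN)).trans (Finset.single_le_sum
      (f := fun j => ∑ m ∈ Finset.range N, d j m) (fun _ _ => Nat.zero_le _) (Finset.mem_univ j))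

/-- A geometrically arbitrary affine plane curve `h = 0` has points over all sufficiently large
fields of definition: a Stepanov type argument. -/
theorem exists_frobenius_fixed_zero [IsAlgClosed 𝕜] (p : ℕ) [Fact p.Prime] [CharP 𝕜 p]
    (E : Type*) [Field E] [Algebra 𝕜[X] E] [IsFractionRing 𝕜[X] E] (hm : h.Monic)
    (hirr : Irreducible (h.map (algebraMap 𝕜[X] E))) (bad : Finset 𝕜)
    (hgood : ∀ s ∉ bad, (h.map (evalRingHom s)).Separable) :
    ∃ m₀, ∀ m, m₀ ≤ m → (∀ i j, ((h.coeff i).coeff j) ^ p ^ m = (h.coeff i).coeff j) →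
      ∃ t u, t ∉ bad ∧ t ^ p ^ m = t ∧ u ^ p ^ m = u ∧ h.eval₂ (evalRingHom t) u = 0 := by
  have hp := (Fact.out : p.Prime)
  have hN0 : 0 < h.natDegree := by
    have := hirr.natDegree_pos
    rwa [hm.natDegree_map] at this
  obtain ⟨n, hN⟩ : ∃ n, h.natDegree = n + 1 := Nat.exists_eq_succ_of_ne_zero hN0.ne'
  have : Nontrivial (AdjoinRoot h) := AdjoinRoot.nontrivial _ (by
    rw [degree_eq_natDegree hm.ne_zero]; exact_mod_cast hN0.ne')
  have : CharP (AdjoinRoot h) p :=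
    charP_of_injective_ringHom (algebraMap 𝕜 (AdjoinRoot h)).injective p
  obtain ⟨e, he⟩ : ∃ e, ∀ i, (h.coeff i).natDegree ≤ e :=
    ⟨∑ i ∈ h.support, (h.coeff i).natDegree, fun i => by
      by_cases hi : i ∈ h.support
      · exact Finset.single_le_sum (f := fun i => (h.coeff i).natDegree)
          (fun _ _ => Nat.zero_le _) hi
      · rw [notMem_support_iff.mp hi, natDegree_zero]; exact Nat.zero_le _⟩
  obtain ⟨C₀, hC₀⟩ := exists_forall_root_pow_mul_mem_fil hm hN0
    (fun j : Fin n => (cofactor h).coeff j) h.natDegree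
  obtain ⟨μ, I, A, hI, hcount⟩ := exists_stepanov_parameters hp.one_lt e n C₀
  obtain ⟨γ, hγ0, hγ⟩ := exists_auxiliary hm he hN _ hC₀ hcount
  obtain ⟨n₀, hn₀⟩ := exists_frobenius_level E p hm hirr A (n + 1) hN.ge
  refine ⟨μ + (n₀ + (A + e * (n + 1) + bad.card) + 1), fun m hmm hfix => ?_⟩
  obtain ⟨ν, rfl⟩ := Nat.exists_eq_add_of_le (le_trans (Nat.le_add_right _ _) hmm)
  have hν : n₀ + (A + e * (n + 1) + bad.card) + 1 ≤ ν := by omega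
  have hQ : A + e * (n + 1) + bad.card < p ^ ν :=
    lt_of_lt_of_le (Nat.lt_pow_self hp.one_lt) (Nat.pow_le_pow_right hp.pos (by omega))
  by_contra! hno
  have hroot : ∀ k (a : 𝕜), ∃ z : 𝕜, z ^ p ^ k = a := fun k a =>
    IsAlgClosed.exists_pow_nat_eq a (pow_pos hp.pos k)
  choose α hα using fun i j x => hroot μ (γ i j x)
  choose β hβ using fun i j x => hroot ν (α i j x)
  obtain ⟨S, hS1, hS2⟩ := exists_many_frobenius_fixed p bad (m := μ + ν) (by omega)
  have hzero : auxRoot h (p ^ ν) I (n + 1) A α = 0 := by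
    refine eq_zero_of_forall_lift_eq_zero hm (auxRoot_mem_fil hm he hN0 α) S ?_
      (fun s hs => hgood s (hS2 s hs).1) fun s hs u hu => ?_
    · rw [pow_add, hI] at hS1
      nlinarith
    · obtain ⟨hsb, hsf⟩ := hS2 s hs
      refine pow_eq_zero_iff (pow_ne_zero μ hp.ne_zero) |>.mp ?_
      rw [lift_auxRoot_pow p hα (by rw [← pow_add]; exact hsf) hu, ← pow_add]
      exact sum_lift_auxComponent_eq_zero hm hN γ hγ hu (fun h3 => hno s u hsb hsf h3 hu)
        (eval_frobenius_eq_zero p hfix hsf hu)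
  rw [auxRoot_eq p hβ] at hzero
  have h1 := hn₀ ν (by omega) _ hzero
  apply hγ0
  funext i j x
  have h2 := congrFun (monomials_independent hm hN.ge (fun y => β y.1 y.2 x)
    (A := I) (congrFun h1 x)) (i, j)
  have h3 : β i j x = 0 := h2
  rw [← hα, ← hβ, h3, zero_pow (pow_ne_zero _ hp.ne_zero), zero_pow (pow_ne_zero _ hp.ne_zero)]
  rfl

end Stepanov

section ScaleRoots

variable {E : Type*} [Field E]

lemma irreducible_scaleRoots {f : E[X]} (hf : Irreducible f) {s : E} (hs : s ≠ 0) :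
    Irreducible (f.scaleRoots s) := by
  have hinv : ∀ g : E[X], (g.scaleRoots s).scaleRoots s⁻¹ = g := fun g => by
    rw [← scaleRoots_mul, mul_inv_cancel₀ hs, scaleRoots_one]
  have hunit : ∀ g : E[X], IsUnit (g.scaleRoots s⁻¹) → IsUnit g := fun g hg => by
    rw [isUnit_iff_degree_eq_zero] at hg ⊢
    rwa [degree_scaleRoots] at hg
  refine ⟨fun h => hf.not_isUnit ?_, fun a b hab => ?_⟩
  · rw [isUnit_iff_degree_eq_zero] at h ⊢
    rwa [degree_scaleRoots] at h
  · have h1 : f = a.scaleRoots s⁻¹ * b.scaleRoots s⁻¹ := by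
      rw [← mul_scaleRoots_of_noZeroDivisors, ← hab, hinv]
    exact (hf.isUnit_or_isUnit h1).imp (hunit a) (hunit b)

lemma separable_scaleRoots {f : E[X]} (hf : Irreducible f) (hsep : f.Separable) {s : E}
    (hs : s ≠ 0) : (f.scaleRoots s).Separable := by
  rw [separable_iff_derivative_ne_zero (irreducible_scaleRoots hf hs)]
  rw [separable_iff_derivative_ne_zero hf] at hsep
  contrapose! hsep
  ext i
  have h1 := congrArg (fun g => g.coeff i) hsep
  simp only [coeff_derivative, coeff_scaleRoots, coeff_zero] at h1 ⊢
  have : s ^ (f.natDegree - (i + 1)) ≠ 0 := pow_ne_zero _ hs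
  have h2 : f.coeff (i + 1) * (i + 1) * s ^ (f.natDegree - (i + 1)) = 0 := by rw [← h1]; ring
  exact (mul_eq_zero.mp h2).resolve_right this

end ScaleRoots

section Frobenius

variable {𝕜 : Type*} [Field 𝕜] (p : ℕ)

lemma pow_pow_mul_eq {p m : ℕ} {x : 𝕜} (hx : x ^ p ^ m = x) (r : ℕ) : x ^ p ^ (m * r) = x := by
  induction r with
  | zero => simp
  | succ r ih => rw [Nat.mul_succ, pow_add, pow_mul, ih, hx]

lemma map_iterateFrobenius_eq_iff [Fact p.Prime] [CharP 𝕜 p] {m : ℕ} {f : 𝕜[X]} :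
    f.map (iterateFrobenius 𝕜 p m) = f ↔ ∀ j, f.coeff j ^ p ^ m = f.coeff j := by
  rw [Polynomial.ext_iff]
  simp [iterateFrobenius_def]

variable (E : Type*) [Field E] [Algebra 𝕜[X] E] [IsFractionRing 𝕜[X] E]

lemma exists_finset_separable {h : 𝕜[X][X]} (hsep : (h.map (algebraMap 𝕜[X] E)).Separable) :
    ∃ bad : Finset 𝕜, ∀ s ∉ bad, (h.map (evalRingHom s)).Separable := by
  classical
  have inj := IsFractionRing.injective 𝕜[X] E
  obtain ⟨a, b, hab⟩ := hsep
  obtain ⟨d₁, hd₁, h1⟩ := IsLocalization.integerNormalization_spec (nonZeroDivisors 𝕜[X]) a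
  obtain ⟨d₂, hd₂, h2⟩ := IsLocalization.integerNormalization_spec (nonZeroDivisors 𝕜[X]) b
  set a' := IsLocalization.integerNormalization (nonZeroDivisors 𝕜[X]) a
  set b' := IsLocalization.integerNormalization (nonZeroDivisors 𝕜[X]) b
  have h3 : C d₂ * a' * h + C d₁ * b' * derivative h = C (d₁ * d₂) := by
    apply map_injective _ inj
    rw [Polynomial.map_add, Polynomial.map_mul, Polynomial.map_mul, Polynomial.map_mul,
      Polynomial.map_mul, h1, h2, map_C, map_C, map_C, ← derivative_map]
    have e1 : ∀ (x : 𝕜[X]) (f : E[X]), x • f = C (algebraMap 𝕜[X] E x) * f := fun x f => by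
      rw [← smul_eq_C_mul, algebraMap_smul]
    simp only [e1, map_mul]
    linear_combination C (algebraMap 𝕜[X] E d₁) * C (algebraMap 𝕜[X] E d₂) * hab
  refine ⟨(d₁ * d₂).roots.toFinset, fun s hs => ?_⟩
  have hd : d₁ * d₂ ≠ 0 := mul_ne_zero (nonZeroDivisors.ne_zero hd₁) (nonZeroDivisors.ne_zero hd₂)
  rw [Multiset.mem_toFinset, mem_roots hd, IsRoot] at hs
  have h4 := congrArg (Polynomial.map (evalRingHom s)) h3
  rw [Polynomial.map_add, Polynomial.map_mul, Polynomial.map_mul (evalRingHom s) (q := derivative h), map_C,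
    ← derivative_map, coe_evalRingHom] at h4
  refine ⟨C (eval s (d₁ * d₂))⁻¹ * map (evalRingHom s) (C d₂ * a'),
    C (eval s (d₁ * d₂))⁻¹ * map (evalRingHom s) (C d₁ * b'), ?_⟩
  rw [mul_assoc, mul_assoc, ← mul_add, h4, ← C_mul, inv_mul_cancel₀ hs, C_1]

variable [IsAlgClosed 𝕜] [Fact p.Prime] [CharP 𝕜 p]

lemma exists_frobenius_fixed_zero_of_separable {h : 𝕜[X][X]}
    (hirr : Irreducible (h.map (algebraMap 𝕜[X] E)))
    (hsep : (h.map (algebraMap 𝕜[X] E)).Separable) {k : ℕ} (hk : k ≠ 0)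
    (hfix : ∀ i j, ((h.coeff i).coeff j) ^ p ^ k = (h.coeff i).coeff j) (bad : Finset 𝕜) :
    ∃ r₀, ∀ r, r₀ ≤ r → ∃ t u, t ∉ bad ∧ t ^ p ^ (k * r) = t ∧ u ^ p ^ (k * r) = u ∧
      h.eval₂ (evalRingHom t) u = 0 := by
  classical
  have inj := IsFractionRing.injective 𝕜[X] E
  have h0 : h ≠ 0 := fun h0 => hirr.ne_zero (by rw [h0, Polynomial.map_zero])
  have hb : h.leadingCoeff ≠ 0 := leadingCoeff_ne_zero.mpr h0
  have hbE : algebraMap 𝕜[X] E h.leadingCoeff ≠ 0 := (map_ne_zero_iff _ inj).mpr hb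
  have hmon := monic_integralNormalization h0
  have hE : (h.integralNormalization.map (algebraMap 𝕜[X] E)) * C (algebraMap 𝕜[X] E h.leadingCoeff)
      = (h.map (algebraMap 𝕜[X] E)).scaleRoots (algebraMap 𝕜[X] E h.leadingCoeff) := by
    rw [← map_scaleRoots _ _ _ hbE, ← integralNormalization_mul_C_leadingCoeff, Polynomial.map_mul,
      map_C]
  have hu : IsUnit (C (algebraMap 𝕜[X] E h.leadingCoeff)) := isUnit_C.mpr hbE.isUnit
  have hirr' : Irreducible (h.integralNormalization.map (algebraMap 𝕜[X] E)) := by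
    rw [← irreducible_mul_isUnit hu, hE]
    exact irreducible_scaleRoots hirr hbE
  have hsep' : (h.integralNormalization.map (algebraMap 𝕜[X] E)).Separable := by
    have := separable_scaleRoots hirr hsep hbE
    rw [← hE] at this
    exact this.of_mul_left
  obtain ⟨bad', hbad'⟩ := exists_finset_separable E hsep'
  obtain ⟨m₀, hm₀⟩ := exists_frobenius_fixed_zero p E hmon hirr'
    (bad ∪ bad' ∪ h.leadingCoeff.roots.toFinset) (fun s hs => hbad' s fun h2 => hs (by simp [h2]))
  have hfix' : ∀ i, (h.coeff i).map (iterateFrobenius 𝕜 p k) = h.coeff i := fun i =>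
    (map_iterateFrobenius_eq_iff p).mpr (hfix i)
  have hfix'' : ∀ i j, (h.integralNormalization.coeff i).coeff j ^ p ^ k =
      (h.integralNormalization.coeff i).coeff j := by
    intro i
    rw [← map_iterateFrobenius_eq_iff, integralNormalization_coeff]
    split_ifs
    · rw [Polynomial.map_one]
    · rw [Polynomial.map_mul, Polynomial.map_pow, hfix', leadingCoeff, hfix']
  refine ⟨m₀, fun r hr => ?_⟩
  obtain ⟨t, w, ht, htf, hwf, hw⟩ := hm₀ (k * r) (hr.trans (Nat.le_mul_of_pos_left _ (by omega)))
    (fun i j => pow_pow_mul_eq (hfix'' i j) r)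
  simp only [Finset.mem_union, Multiset.mem_toFinset, mem_roots hb, IsRoot, not_or] at ht
  refine ⟨t, w / h.leadingCoeff.eval t, ht.1.1, htf, ?_, ?_⟩
  · have : h.leadingCoeff.eval t ^ p ^ (k * r) = h.leadingCoeff.eval t := by
      rw [eval_eq_sum_range, sum_pow_char_pow]
      refine Finset.sum_congr rfl fun j _ => ?_
      rw [mul_pow, leadingCoeff, pow_pow_mul_eq (hfix _ _) r, ← pow_mul, mul_comm j, pow_mul, htf]
    rw [div_pow, hwf, this]
  · have h5 := congrArg (eval₂ (evalRingHom t) w) (integralNormalization_mul_C_leadingCoeff h)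
    have h6 := scaleRoots_eval₂_mul (p := h) (evalRingHom t) (w / h.leadingCoeff.eval t)
      h.leadingCoeff
    rw [coe_evalRingHom, mul_div_cancel₀ _ ht.2, ← h5, eval₂_mul, hw, zero_mul] at h6
    exact (mul_eq_zero.mp h6.symm).resolve_left (pow_ne_zero _ ht.2)

/-- An irreducible plane curve of positive degree in the second variable has points over
all large extensions of a finite field of definition. -/
theorem exists_frobenius_fixed_zero_of_irreducible {h : 𝕜[X][X]}
    (hirr : Irreducible (h.map (algebraMap 𝕜[X] E))) {k : ℕ} (hk : k ≠ 0)
    (hfix : ∀ i j, ((h.coeff i).coeff j) ^ p ^ k = (h.coeff i).coeff j) (bad : Finset 𝕜) :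
    ∃ r₀, ∀ r, r₀ ≤ r → ∃ t u, t ∉ bad ∧ t ^ p ^ (k * r) = t ∧ u ^ p ^ (k * r) = u ∧
      h.eval₂ (evalRingHom t) u = 0 := by
  have hp := (Fact.out : p.Prime)
  have inj := IsFractionRing.injective 𝕜[X] E
  have : CharP E p := charP_of_injective_ringHom inj p
  obtain ⟨n, g, hg1, hg2⟩ := exists_separable_of_irreducible p hirr hp.ne_zero
  have hpn : p ^ n ≠ 0 := pow_ne_zero _ hp.ne_zero
  have hg3 : (h.contract (p ^ n)).map (algebraMap 𝕜[X] E) = g := by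
    rw [map_contract hpn, ← hg2, contract_expand _ hpn]
  have hh : expand 𝕜[X] (p ^ n) (h.contract (p ^ n)) = h := by
    apply map_injective _ inj
    rw [map_expand, hg3, hg2]
  have hgirr : Irreducible g := of_irreducible_expand hpn (hg2 ▸ hirr)
  obtain ⟨r₀, hr₀⟩ := exists_frobenius_fixed_zero_of_separable p E (hg3 ▸ hgirr) (hg3 ▸ hg1) hk
    (fun i j => by rw [coeff_contract hpn]; exact hfix _ _) bad
  refine ⟨r₀, fun r hr => ?_⟩
  obtain ⟨t, w, ht, htf, hwf, hw⟩ := hr₀ r hr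
  obtain ⟨u, hu⟩ := IsAlgClosed.exists_pow_nat_eq w (pow_pos hp.pos n)
  refine ⟨t, u, ht, htf, ?_, ?_⟩
  · apply iterateFrobenius_inj 𝕜 p n
    rw [iterateFrobenius_def, iterateFrobenius_def, ← pow_mul, mul_comm, pow_mul, hu, hwf]
  · rw [← hh, expand_eq_comp_X_pow, eval₂_comp, eval₂_X_pow, hu, hw]

end Frobenius

section CoprimeField

variable (𝕜 : Type*) [Field 𝕜] (p : ℕ) [Fact p.Prime] [CharP 𝕜 p] (a : ℕ)

/-- The union of the finite subfields with `p ^ (a * m)` elements, where `3 ∤ m`. -/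
def coprimeField : Subfield 𝕜 where
  carrier := {x | ∃ m, ¬ 3 ∣ m ∧ x ^ p ^ (a * m) = x}
  mul_mem' := by
    rintro x y ⟨m, hm, hx⟩ ⟨n, hn, hy⟩
    refine ⟨m * n, fun h => (Nat.prime_three.dvd_mul.mp h).elim hm hn, ?_⟩
    rw [mul_pow, ← mul_assoc, pow_pow_mul_eq hx, mul_assoc, mul_comm m, ← mul_assoc,
      pow_pow_mul_eq hy]
  one_mem' := ⟨1, by norm_num, one_pow _⟩
  add_mem' := by
    rintro x y ⟨m, hm, hx⟩ ⟨n, hn, hy⟩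
    refine ⟨m * n, fun h => (Nat.prime_three.dvd_mul.mp h).elim hm hn, ?_⟩
    rw [add_pow_char_pow, ← mul_assoc, pow_pow_mul_eq hx, mul_assoc, mul_comm m, ← mul_assoc,
      pow_pow_mul_eq hy]
  zero_mem' := ⟨1, by norm_num, zero_pow (pow_ne_zero _ (Fact.out : p.Prime).ne_zero)⟩
  neg_mem' := by
    rintro x ⟨m, hm, hx⟩
    refine ⟨m, hm, ?_⟩
    have := sub_pow_char_pow (p := p) (0 : 𝕜) x (n := a * m)
    rwa [zero_sub, zero_pow (pow_ne_zero _ (Fact.out : p.Prime).ne_zero), zero_sub, hx] at this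
  inv_mem' := by
    rintro x ⟨m, hm, hx⟩
    exact ⟨m, hm, by rw [inv_pow, hx]⟩

variable {𝕜 p a}

lemma mem_coprimeField {x : 𝕜} :
    x ∈ coprimeField 𝕜 p a ↔ ∃ m, ¬ 3 ∣ m ∧ x ^ p ^ (a * m) = x := Iff.rfl

lemma exists_common_exponent {ι : Type*} (s : Finset ι) (x : ι → 𝕜)
    (hx : ∀ i ∈ s, x i ∈ coprimeField 𝕜 p a) :
    ∃ m, ¬ 3 ∣ m ∧ ∀ i ∈ s, x i ^ p ^ (a * m) = x i := by
  classical
  induction s using Finset.induction_on with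
  | empty => exact ⟨1, by norm_num, by simp⟩
  | insert i s _ ih =>
    obtain ⟨m, hm, h1⟩ := ih fun j hj => hx j (Finset.mem_insert_of_mem hj)
    obtain ⟨n, hn, h2⟩ := mem_coprimeField.mp (hx i (Finset.mem_insert_self i s))
    refine ⟨m * n, fun h => (Nat.prime_three.dvd_mul.mp h).elim hm hn, fun j hj => ?_⟩
    rcases Finset.mem_insert.mp hj with rfl | hj
    · rw [mul_comm m, ← mul_assoc, pow_pow_mul_eq h2]
    · rw [← mul_assoc, pow_pow_mul_eq (h1 j hj)]

end CoprimeField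

section Descent

variable {𝕜 : Type*} [Field 𝕜]

lemma exists_irreducible_factor_natDegree_ne_zero {g : 𝕜[X][X]} (hg : g.natDegree ≠ 0) :
    ∃ f, Irreducible f ∧ f ∣ g ∧ f.natDegree ≠ 0 := by
  by_contra! hcon
  have h0 : g ≠ 0 := fun h => hg (by rw [h, natDegree_zero])
  obtain ⟨s, hs, u, hu⟩ := UniqueFactorizationMonoid.exists_prime_factors g h0
  apply hg
  rw [← hu, natDegree_mul (by intro h; rw [h, zero_mul] at hu; exact h0 hu.symm) u.ne_zero,
    natDegree_eq_zero_of_isUnit u.isUnit, add_zero, natDegree_multiset_prod _ (fun h => (hs _ h).ne_zero rfl),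
    Multiset.sum_eq_zero]
  intro n hn
  obtain ⟨f, hf, rfl⟩ := Multiset.mem_map.mp hn
  refine hcon f (hs f hf).irreducible ?_
  rw [← hu]
  exact (Multiset.dvd_prod hf).mul_right _

/-- The action of an automorphism on the coefficients of a polynomial in two variables. -/
noncomputable def coeffEquiv (σ : 𝕜 ≃+* 𝕜) : 𝕜[X][X] ≃+* 𝕜[X][X] :=
  mapEquiv (mapEquiv σ)

lemma coeffEquiv_coeff (σ : 𝕜 ≃+* 𝕜) (f : 𝕜[X][X]) (i j : ℕ) :
    ((coeffEquiv σ f).coeff i).coeff j = σ ((f.coeff i).coeff j) := by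
  simp [coeffEquiv]

lemma coeffEquiv_natDegree (σ : 𝕜 ≃+* 𝕜) (f : 𝕜[X][X]) :
    (coeffEquiv σ f).natDegree = f.natDegree := by
  rw [coeffEquiv, mapEquiv_apply]
  exact natDegree_map_eq_of_injective (mapEquiv σ).injective f

lemma associated_coeffEquiv_sq (σ : 𝕜 ≃+* 𝕜) {g f : 𝕜[X][X]} (hg0 : g ≠ 0)
    (hg : g.natDegree < 9) (hσ : coeffEquiv σ g = g) (hf : Irreducible f) (hfg : f ∣ g)
    (hd : 3 ≤ f.natDegree) : Associated (coeffEquiv σ (coeffEquiv σ f)) f := by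
  by_contra hcon
  have hdvd : ∀ x, x ∣ g → coeffEquiv σ x ∣ g := fun x hx => by
    conv_rhs => rw [← hσ]
    exact _root_.map_dvd (coeffEquiv σ) hx
  have hassoc : ∀ x y, Associated (coeffEquiv σ x) (coeffEquiv σ y) ↔ Associated x y :=
    fun x y => ⟨fun h => by simpa using h.map (coeffEquiv σ).symm, fun h => h.map (coeffEquiv σ)⟩
  have hcon' : ¬ Associated (coeffEquiv σ f) f := fun h =>
    hcon (((hassoc _ _).mpr h).trans h)
  have h1 : Prime f := hf.prime
  have h2 : Prime (coeffEquiv σ f) := (MulEquiv.prime_iff (coeffEquiv σ)).mpr h1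
  have h3 : Prime (coeffEquiv σ (coeffEquiv σ f)) := (MulEquiv.prime_iff (coeffEquiv σ)).mpr h2
  obtain ⟨y, hy⟩ := hfg
  have h4 : coeffEquiv σ f ∣ y := by
    have := hdvd f ⟨y, hy⟩
    rw [hy] at this
    exact (h2.dvd_mul.mp this).resolve_left fun h => hcon' (h2.associated_of_dvd h1 h)
  obtain ⟨z, rfl⟩ := h4
  have h5 : coeffEquiv σ (coeffEquiv σ f) ∣ z := by
    have := hdvd _ (hdvd f ⟨_, hy⟩)
    rw [hy] at this
    rcases h3.dvd_mul.mp this with h | h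
    · exact absurd (h3.associated_of_dvd h1 h) hcon
    · exact (h3.dvd_mul.mp h).resolve_left fun h =>
        hcon' ((hassoc _ _).mp (h3.associated_of_dvd h2 h))
  obtain ⟨w, rfl⟩ := h5
  have hne : coeffEquiv σ f * (coeffEquiv σ (coeffEquiv σ f) * w) ≠ 0 := fun h => hg0 (by
    rw [hy, h, mul_zero])
  have hne' := right_ne_zero_of_mul hne
  rw [hy, natDegree_mul hf.ne_zero hne, natDegree_mul h2.ne_zero hne',
    natDegree_mul h3.ne_zero (right_ne_zero_of_mul hne'), coeffEquiv_natDegree,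
    coeffEquiv_natDegree] at hg
  rw [coeffEquiv_natDegree] at hg
  omega

lemma exists_fixed_associate (τ : 𝕜 ≃+* 𝕜) {f : 𝕜[X][X]} (hf : f ≠ 0)
    (h : Associated (coeffEquiv τ f) f) :
    ∃ f', Associated f' f ∧ coeffEquiv τ f' = f' := by
  obtain ⟨i, hi⟩ : ∃ i, f.coeff i ≠ 0 := by
    by_contra! hcon
    exact hf (Polynomial.ext (by simpa using hcon))
  obtain ⟨j, hj⟩ : ∃ j, (f.coeff i).coeff j ≠ 0 := by
    by_contra! hcon
    exact hi (Polynomial.ext (by simpa using hcon))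
  set l := (f.coeff i).coeff j with hl
  have hunit : IsUnit (C (C l⁻¹) : 𝕜[X][X]) :=
    isUnit_C.mpr (isUnit_C.mpr (inv_ne_zero hj).isUnit)
  have h1 : Associated (C (C l⁻¹) * f) f := associated_unit_mul_left f _ hunit
  refine ⟨C (C l⁻¹) * f, h1, ?_⟩
  have h2 : Associated (C (C l⁻¹) * f) (coeffEquiv τ (C (C l⁻¹) * f)) :=
    h1.trans (h.symm.trans (h1.map (coeffEquiv τ)).symm)
  obtain ⟨u, hu⟩ := h2
  obtain ⟨v, hv, hv'⟩ := isUnit_iff.mp u.isUnit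
  obtain ⟨c, hc, rfl⟩ := isUnit_iff.mp hv
  rw [← hv'] at hu
  have h3 := congrArg (fun g => (g.coeff i).coeff j) hu
  simp only [coeffEquiv_coeff, coeff_mul_C, coeff_C_mul, ← hl, inv_mul_cancel₀ hj, one_mul,
    map_one] at h3
  rw [← hu, h3, C_1, C_1, mul_one]

end Descent

/-- Every plane curve over `K` of degree at most six in the second variable with only finitely
many `K`-points in the domain of regularity has a linear or quadratic factor over `𝕜(t)`. -/
def HasLowFactors (K 𝕜 : Type*) [Field K] [Field 𝕜] [Algebra K 𝕜] : Prop :=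
  ∀ (g : K[X][X]) (bad : Finset K), g.natDegree ≠ 0 → g.natDegree ≤ 6 →
    (∀ t ∉ bad, ∀ u, g.eval₂ (evalRingHom t) u ≠ 0) →
      ∃ f : (FractionRing 𝕜[X])[X], Irreducible f ∧ f.natDegree ≤ 2 ∧
        f ∣ (g.map (mapRingHom (algebraMap K 𝕜))).map (algebraMap 𝕜[X] (FractionRing 𝕜[X]))

theorem hasLowFactors_coprimeField (𝕜 : Type*) [Field 𝕜] [IsAlgClosed 𝕜] (p : ℕ) [Fact p.Prime]
    [CharP 𝕜 p] {a : ℕ} (ha : a ≠ 0) : HasLowFactors (coprimeField 𝕜 p a) 𝕜 := by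
  classical
  set K := coprimeField 𝕜 p a
  intro g bad hg0 hg6 hno
  set G := g.map (mapRingHom (algebraMap K 𝕜)) with hG
  have hinj : Function.Injective (mapRingHom (algebraMap K 𝕜)) :=
    map_injective _ (algebraMap K 𝕜).injective
  have hGdeg : G.natDegree = g.natDegree := natDegree_map_eq_of_injective hinj g
  obtain ⟨m, hm, hm'⟩ := exists_common_exponent
    (g.support.sigma fun i => (g.coeff i).support) (fun x => (((g.coeff x.1).coeff x.2 : K) : 𝕜))
    (fun x _ => ((g.coeff x.1).coeff x.2).2)
  have hp := (Fact.out : p.Prime)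
  have hfix : ∀ i j, (G.coeff i).coeff j ^ p ^ (a * m) = (G.coeff i).coeff j := by
    intro i j
    have h1 : (G.coeff i).coeff j = (((g.coeff i).coeff j : K) : 𝕜) := by
      rw [hG, coeff_map, coe_mapRingHom, coeff_map]; rfl
    rw [h1]
    by_cases hj : (g.coeff i).coeff j = 0
    · rw [hj]
      exact zero_pow (pow_ne_zero _ hp.ne_zero)
    · refine hm' ⟨i, j⟩ (Finset.mem_sigma.mpr ⟨?_, mem_support_iff.mpr hj⟩)
      rw [mem_support_iff]
      intro h2
      exact hj (by rw [h2, coeff_zero])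
  let σ := iterateFrobeniusEquiv 𝕜 p (a * m)
  have hσ : ∀ x, σ x = x ^ p ^ (a * m) := fun x => iterateFrobeniusEquiv_def 𝕜 p (a * m) x
  have hσG : coeffEquiv σ G = G := by
    ext i j
    rw [coeffEquiv_coeff, hσ, hfix]
  obtain ⟨f, hf, hfG, hfd⟩ := exists_irreducible_factor_natDegree_ne_zero (hGdeg ▸ hg0)
  have hirr : ∀ f : 𝕜[X][X], Irreducible f → f.natDegree ≠ 0 →
      Irreducible (f.map (algebraMap 𝕜[X] (FractionRing 𝕜[X]))) := fun f hf hfd =>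
    (hf.isPrimitive hfd).irreducible_iff_irreducible_map_fraction_map.mp hf
  rcases le_or_gt f.natDegree 2 with hle | hlt
  · exact ⟨f.map (algebraMap _ _), hirr f hf hfd, natDegree_map_le.trans hle,
      Polynomial.map_dvd _ hfG⟩
  exfalso
  have hG0 : G ≠ 0 := fun h => hg0 (by rw [← hGdeg, h, natDegree_zero])
  have hassoc := associated_coeffEquiv_sq σ hG0 (by omega) hσG hf hfG hlt
  have hτ : ∀ f, coeffEquiv (σ.trans σ) f = coeffEquiv σ (coeffEquiv σ f) := fun f => by
    ext i j
    simp only [coeffEquiv_coeff, RingEquiv.trans_apply]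
  rw [← hτ] at hassoc
  obtain ⟨f', hf', hfix'⟩ := exists_fixed_associate (σ.trans σ) hf.ne_zero hassoc
  have hfix2 : ∀ i j, (f'.coeff i).coeff j ^ p ^ (a * m * 2) = (f'.coeff i).coeff j := by
    intro i j
    conv_rhs => rw [← hfix', coeffEquiv_coeff, RingEquiv.trans_apply, hσ, hσ]
    rw [← pow_mul, ← pow_add, mul_two]
  have hm0 : m ≠ 0 := fun h => hm (h ▸ dvd_zero 3)
  have hirr' : Irreducible f' := hf'.irreducible_iff.mpr hf
  have hdeg' : f'.natDegree ≠ 0 := by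
    rw [natDegree_eq_of_degree_eq (degree_eq_degree_of_associated hf')]
    exact hfd
  obtain ⟨r, hr⟩ := exists_frobenius_fixed_zero_of_irreducible p (FractionRing 𝕜[X])
    (hirr f' hirr' hdeg') (k := a * m * 2) (by positivity) hfix2 (bad.image (algebraMap K 𝕜))
  obtain ⟨t, u, ht, htf, huf, h0⟩ := hr (3 * r + 1) (by omega)
  have hmem : ∀ x : 𝕜, x ^ p ^ (a * m * 2 * (3 * r + 1)) = x → x ∈ K := by
    intro x hx
    refine mem_coprimeField.mpr ⟨m * 2 * (3 * r + 1), ?_, ?_⟩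
    · rw [Nat.prime_three.dvd_mul, Nat.prime_three.dvd_mul]
      omega
    · rwa [← mul_assoc, ← mul_assoc]
  refine hno ⟨t, hmem t htf⟩ (fun h => ht (Finset.mem_image.mpr ⟨_, h, rfl⟩))
    ⟨u, hmem u huf⟩ ?_
  apply (algebraMap K 𝕜).injective
  have h1 : G.eval₂ (evalRingHom t) u = 0 := by
    obtain ⟨y, hy⟩ := hf'.dvd.trans hfG
    rw [hy, eval₂_mul, h0, zero_mul]
  rw [map_zero, ← h1, hG, eval₂_map, hom_eval₂]
  congr 1
  refine RingHom.ext fun x => ?_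
  simp only [RingHom.comp_apply, coe_evalRingHom, coe_mapRingHom]
  rw [eval_map, ← eval₂_at_apply]
  rfl

section Independence

variable {A R : Type*} [CommRing A] [CommRing R]

lemma mapc_mapc {ι S : Type*} [CommRing S] (ψ : R →+* S) (φ : A →+* R) (c : ι → ι → ι → A) :
    mapc ψ (mapc φ c) = mapc (ψ.comp φ) c := rfl

lemma eq_zero_of_det_ne_zero [IsDomain A] {a b c d e : Fin 5 → A}
    (h : (Matrix.of ![a, b, c, d, e]).det ≠ 0) {r₀ r₁ r₂ r₃ r₄ : A}
    (hr : r₀ • a + r₁ • b + r₂ • c + r₃ • d + r₄ • e = 0) :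
    r₀ = 0 ∧ r₁ = 0 ∧ r₂ = 0 ∧ r₃ = 0 ∧ r₄ = 0 := by
  have := Matrix.eq_zero_of_vecMul_eq_zero h (v := ![r₀, r₁, r₂, r₃, r₄]) (by
    rw [Matrix.vecMul_eq_sum, ← hr]
    simp [Fin.sum_univ_succ, add_assoc]
    rfl)
  exact ⟨congrFun this 0, congrFun this 1, congrFun this 2, congrFun this 3, congrFun this 4⟩

lemma exists_relation_of_dotProduct_eq_zero [IsDomain A] {a b c d e l : Fin 5 → A} (hl : l ≠ 0)
    (ha : a ⬝ᵥ l = 0) (hb : b ⬝ᵥ l = 0) (hc : c ⬝ᵥ l = 0) (hd : d ⬝ᵥ l = 0) (he : e ⬝ᵥ l = 0) :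
    ∃ r₀ r₁ r₂ r₃ r₄ : A, r₀ • a + r₁ • b + r₂ • c + r₃ • d + r₄ • e = 0 ∧
      ¬ (r₀ = 0 ∧ r₁ = 0 ∧ r₂ = 0 ∧ r₃ = 0 ∧ r₄ = 0) := by
  have hdet : (Matrix.of ![a, b, c, d, e]).det = 0 :=
    Matrix.exists_mulVec_eq_zero_iff.mp ⟨l, hl, by
      funext i
      fin_cases i <;> [exact ha; exact hb; exact hc; exact hd; exact he]⟩
  obtain ⟨r, hr, h⟩ := Matrix.exists_vecMul_eq_zero_iff.mpr hdet
  refine ⟨r 0, r 1, r 2, r 3, r 4, ?_, fun ⟨h0, h1, h2, h3, h4⟩ => hr ?_⟩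
  · rw [← h, Matrix.vecMul_eq_sum]
    simp [Fin.sum_univ_succ, add_assoc]
    rfl
  · funext i
    fin_cases i <;> assumption

lemma det_comp_ne_zero {φ : A →+* R} (hφ : Function.Injective φ) {a b c d e : Fin 5 → A}
    (h : (Matrix.of ![a, b, c, d, e]).det ≠ 0) :
    (Matrix.of ![φ ∘ a, φ ∘ b, φ ∘ c, φ ∘ d, φ ∘ e]).det ≠ 0 := by
  rw [det_comp]
  exact (map_ne_zero_iff φ hφ).mpr h

lemma indep_C {k : Type*} [Field k] {v w : Fin 5 → k} (h : Indep v w) :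
    Indep (C ∘ v : Fin 5 → k[X]) (C ∘ w) := by
  intro a b hab
  constructor <;> ext n
  · refine (h (a.coeff n) (b.coeff n) (funext fun i => ?_)).1
    simpa using congrArg (coeff · n) (congrFun hab i)
  · refine (h (a.coeff n) (b.coeff n) (funext fun i => ?_)).2
    simpa using congrArg (coeff · n) (congrFun hab i)

end Independence

section Resultant

variable {A : Type*} [CommRing A]

lemma natDegree_le_one_of_pencil {ι : Type*} (w w' : ι → A) (i : ι) :
    ((C ∘ w + (X : A[X]) • C ∘ w') i).natDegree ≤ 1 := by
  have : (C ∘ w + (X : A[X]) • C ∘ w') i = C (w' i) * X + C (w i) := by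
    simp only [Pi.add_apply, Pi.smul_apply, Function.comp_apply, smul_eq_mul]
    ring
  rw [this]
  exact natDegree_linear_le

lemma coeff_one_pencil {ι : Type*} (w w' : ι → A) :
    (fun i => ((C ∘ w + (X : A[X]) • C ∘ w') i).coeff 1) = w' := by
  funext i
  simp [coeff_C]

lemma natDegree_comp_C {ι : Type*} (w : ι → A) (i : ι) : ((C ∘ w : ι → A[X]) i).natDegree ≤ 0 := by
  simp

lemma coeff_comp_C {ι : Type*} (w : ι → A) : (fun i => ((C ∘ w : ι → A[X]) i).coeff 0) = w := by
  funext i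
  simp

variable {ι : Type*} [Fintype ι] (c : ι → ι → ι → A) (y e₁ e₂ e₃ : ι → A)

lemma res_natDegree_le_and_coeff :
    (res (mapc C c) (C ∘ y) (C ∘ e₁) (C ∘ e₂ + (X : A[X]) • C ∘ e₃)).natDegree ≤ 6 ∧
    (res (mapc C c) (C ∘ y) (C ∘ e₁) (C ∘ e₂ + (X : A[X]) • C ∘ e₃)).coeff 6 =
      res c y e₁ e₃ := by
  have hw := natDegree_le_one_of_pencil e₂ e₃
  have cw := coeff_one_pencil e₂ e₃
  set w : ι → A[X] := C ∘ e₂ + (X : A[X]) • C ∘ e₃ with hwdef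
  have ny := natDegree_comp_C y
  have n1 := natDegree_comp_C e₁
  have cy := coeff_comp_C y
  have c1 := coeff_comp_C e₁
  have d1 : (B (mapc C c) (C ∘ e₁) w (C ∘ y)).natDegree ≤ 1 := B_natDegree_le c n1 hw ny
  have d2 : (D (mapc C c) w (C ∘ y)).natDegree ≤ 2 := D_natDegree_le c hw ny
  have d3 : (D (mapc C c) (C ∘ e₁) w).natDegree ≤ 1 := D_natDegree_le c n1 hw
  have d4 : (D (mapc C c) w (C ∘ e₁)).natDegree ≤ 2 := D_natDegree_le c hw n1
  have d5 : (F (mapc C c) w).natDegree ≤ 3 := T_natDegree_le c hw hw hw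
  have k1 : (B (mapc C c) (C ∘ e₁) w (C ∘ y)).coeff 1 = B c e₁ e₃ y := by
    have := B_coeff c n1 hw ny; rwa [cy, c1, cw] at this
  have k2 : (D (mapc C c) w (C ∘ y)).coeff 2 = D c e₃ y := by
    have := D_coeff c hw ny; rwa [cy, cw] at this
  have k3 : (D (mapc C c) (C ∘ e₁) w).coeff 1 = D c e₁ e₃ := by
    have := D_coeff c n1 hw; rwa [c1, cw] at this
  have k4 : (D (mapc C c) w (C ∘ e₁)).coeff 2 = D c e₃ e₁ := by
    have := D_coeff c hw n1; rwa [c1, cw] at this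
  have k5 : (F (mapc C c) w).coeff 3 = F c e₃ := by
    have := F_coeff c hw; rwa [cw] at this
  have mul : ∀ {P Q : A[X]} {m n N : ℕ} {a b : A}, (P.natDegree ≤ m ∧ P.coeff m = a) →
      (Q.natDegree ≤ n ∧ Q.coeff n = b) → m + n = N →
      ((P * Q).natDegree ≤ N ∧ (P * Q).coeff N = a * b) := by
    rintro P Q m n N a b ⟨h1, rfl⟩ ⟨h2, rfl⟩ rfl
    exact ⟨natDegree_mul_le_of_le h1 h2, coeff_mul_add_eq_of_natDegree_le h1 h2⟩
  have sub : ∀ {P Q : A[X]} {N : ℕ} {a b : A}, (P.natDegree ≤ N ∧ P.coeff N = a) →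
      (Q.natDegree ≤ N ∧ Q.coeff N = b) → ((P - Q).natDegree ≤ N ∧ (P - Q).coeff N = a - b) := by
    rintro P Q N a b ⟨h1, rfl⟩ ⟨h2, rfl⟩
    exact ⟨(natDegree_sub_le_of_le h1 h2).trans (max_self N).le, coeff_sub _ _ _⟩
  have add : ∀ {P Q : A[X]} {N : ℕ} {a b : A}, (P.natDegree ≤ N ∧ P.coeff N = a) →
      (Q.natDegree ≤ N ∧ Q.coeff N = b) → ((P + Q).natDegree ≤ N ∧ (P + Q).coeff N = a + b) := by
    rintro P Q N a b ⟨h1, rfl⟩ ⟨h2, rfl⟩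
    exact ⟨(natDegree_add_le_of_le h1 h2).trans (max_self N).le, coeff_add _ _ _⟩
  have pow : ∀ {P : A[X]} {m N : ℕ} {a : A}, (P.natDegree ≤ m ∧ P.coeff m = a) →
      m + m = N → ((P ^ 2).natDegree ≤ N ∧ (P ^ 2).coeff N = a ^ 2) := by
    intro P m N a h hN
    rw [sq, sq]
    exact mul h h hN
  have const : ∀ a : A, (C a).natDegree ≤ 0 ∧ (C a).coeff 0 = a := fun a => by simp
  have hF1 : (F (mapc C c) (C ∘ e₁)).natDegree ≤ 0 ∧
      (F (mapc C c) (C ∘ e₁)).coeff 0 = F c e₁ := by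
    rw [F_map c C]; exact const _
  have hκ : (D (mapc C c) (C ∘ e₁) (C ∘ y)).natDegree ≤ 0 ∧
      (D (mapc C c) (C ∘ e₁) (C ∘ y)).coeff 0 = D c e₁ y := by
    rw [D_map c C]; exact const _
  have lin : _ ∧ _ = remLin c y e₁ e₃ := add (sub (sub (mul hF1 (pow ⟨d1, k1⟩ rfl) rfl)
    (mul (mul hκ hF1 rfl) ⟨d2, k2⟩ rfl)) (mul (mul hκ ⟨d3, k3⟩ rfl) ⟨d1, k1⟩ rfl))
    (mul (pow hκ rfl) ⟨d4, k4⟩ rfl)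
  have cst : _ ∧ _ = remConst c y e₁ e₃ := sub (add (mul (mul hF1 ⟨d1, k1⟩ rfl) ⟨d2, k2⟩ rfl)
    (mul (pow hκ rfl) ⟨d5, k5⟩ rfl)) (mul (mul hκ ⟨d3, k3⟩ rfl) ⟨d2, k2⟩ rfl)
  exact add (sub (mul hκ (pow cst rfl) rfl) (mul (mul ⟨d1, k1⟩ lin rfl) cst rfl))
    (mul ⟨d2, k2⟩ (pow lin rfl) rfl)

end Resultant

section Quadratic

variable {E : Type*} [Field E]

lemma exists_root_of_irreducible_of_natDegree_le_two {f : E[X]} (hf : Irreducible f)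
    (hd : f.natDegree ≤ 2) : ∃ (θ : AlgebraicClosure E) (m₁ m₀ : E), aeval θ f = 0 ∧
      θ ^ 2 + algebraMap E (AlgebraicClosure E) m₁ * θ +
        algebraMap E (AlgebraicClosure E) m₀ = 0 := by
  obtain ⟨θ, hθ⟩ := IsAlgClosed.exists_aeval_eq_zero (AlgebraicClosure E) f
    (degree_pos_of_irreducible hf).ne'
  have hd' := hf.natDegree_pos
  have hlc : f.coeff f.natDegree ≠ 0 := leadingCoeff_ne_zero.mpr hf.ne_zero
  refine ⟨θ, ?_⟩
  have hθ' := hθ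
  rw [aeval_eq_sum_range] at hθ'
  set φ := algebraMap E (AlgebraicClosure E)
  obtain h | h : f.natDegree = 1 ∨ f.natDegree = 2 := by omega
  · rw [h] at hlc hθ'
    have hlc' : φ (f.coeff 1) ≠ 0 := (map_ne_zero φ).mpr hlc
    simp only [Finset.sum_range_succ, Finset.sum_range_zero, Algebra.smul_def] at hθ'
    set a := f.coeff 1
    set b := f.coeff 0
    refine ⟨b / a, 0, hθ, ?_⟩
    rw [map_div₀, map_zero]
    field_simp
    linear_combination θ * hθ'
  · rw [h] at hlc hθ'
    have hlc' : φ (f.coeff 2) ≠ 0 := (map_ne_zero φ).mpr hlc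
    simp only [Finset.sum_range_succ, Finset.sum_range_zero, Algebra.smul_def] at hθ'
    set a := f.coeff 2
    set b := f.coeff 1
    set e := f.coeff 0
    refine ⟨b / a, e / a, hθ, ?_⟩
    rw [map_div₀, map_div₀]
    field_simp
    linear_combination hθ'

lemma exists_root_of_natDegree_eq_three {g f : E[X]} (hg : g.natDegree = 3) (hf : Irreducible f)
    (hd : f.natDegree ≤ 2) (hfg : f ∣ g) : ∃ u, g.eval u = 0 := by
  have root : ∀ h : E[X], h ∣ g → h.natDegree = 1 → ∃ u, g.eval u = 0 := by
    rintro h ⟨h', rfl⟩ h1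
    obtain ⟨u, hu⟩ := exists_root_of_degree_eq_one ((degree_eq_iff_natDegree_eq_of_pos one_pos).mpr h1)
    exact ⟨u, by rw [eval_mul, hu.eq_zero, zero_mul]⟩
  have hd' := hf.natDegree_pos
  obtain h | h : f.natDegree = 1 ∨ f.natDegree = 2 := by omega
  · exact root f hfg h
  · obtain ⟨f', rfl⟩ := hfg
    have h0 : f * f' ≠ 0 := by rintro h0; simp [h0] at hg
    rw [natDegree_mul hf.ne_zero (right_ne_zero_of_mul h0)] at hg
    exact root f' (dvd_mul_left _ _) (by omega)

end Quadratic

section Maps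

lemma comp_pencil {ι A L : Type*} [CommRing A] [CommRing L] {Φ : A[X] →+* L} {ψ : A →+* L} (hΦ : ∀ a, Φ (C a) = ψ a) {θ : L} (hX : Φ X = θ)
    (w w' : ι → A) : Φ ∘ (C ∘ w + (X : A[X]) • C ∘ w') = ψ ∘ w + θ • ψ ∘ w' := by
  funext i
  simp only [Function.comp_apply, Pi.add_apply, Pi.smul_apply, smul_eq_mul, map_add, map_mul, hΦ, hX]

variable {ι A L : Type*} [Fintype ι] [CommRing A] [CommRing L] {c : ι → ι → ι → A}

lemma map_res_pencil {Φ : A[X] →+* L} {ψ : A →+* L} (hΦ : ∀ a, Φ (C a) = ψ a) {θ : L} (hX : Φ X = θ)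
    (y e₁ e₂ e₃ : ι → A) :
    Φ (res (mapc C c) (C ∘ y) (C ∘ e₁) (C ∘ e₂ + (X : A[X]) • C ∘ e₃)) =
      res (mapc ψ c) (ψ ∘ y) (ψ ∘ e₁) (ψ ∘ e₂ + θ • ψ ∘ e₃) := by
  rw [← res_map, comp_pencil hΦ hX]
  congr 1
  · funext i j k; exact hΦ _
  · funext i; exact hΦ _
  · funext i; exact hΦ _

lemma map_F_pencil {Φ : A[X] →+* L} {ψ : A →+* L} (hΦ : ∀ a, Φ (C a) = ψ a) {θ : L} (hX : Φ X = θ)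
    (e₂ e₃ : ι → A) :
    Φ (F (mapc C c) (C ∘ e₂ + (X : A[X]) • C ∘ e₃)) = F (mapc ψ c) (ψ ∘ e₂ + θ • ψ ∘ e₃) := by
  rw [← F_map, comp_pencil hΦ hX]
  congr 1
  funext i j k; exact hΦ _

lemma IsLine.of_map {φ : A →+* L} (hφ : Function.Injective φ) {v w : ι → A}
    (h : IsLine (mapc φ c) (φ ∘ v) (φ ∘ w)) : IsLine c v w := by
  obtain ⟨hi, h1, h2, h3, h4⟩ := h
  rw [F_map, map_eq_zero_iff φ hφ] at h1 h4
  rw [D_map, map_eq_zero_iff φ hφ] at h2 h3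
  refine ⟨fun a b hab => ?_, h1, h2, h3, h4⟩
  have := hi (φ a) (φ b) (by rw [← comp_smul, ← comp_smul, ← comp_add, hab, comp_zero])
  rwa [map_eq_zero_iff φ hφ, map_eq_zero_iff φ hφ] at this

lemma IsLine.smul [IsDomain A] {v w : ι → A} (h : IsLine c v w) {a b : A} (ha : a ≠ 0) (hb : b ≠ 0) :
    IsLine c (a • v) (b • w) := by
  obtain ⟨hi, h1, h2, h3, h4⟩ := h
  refine ⟨fun x y hxy => ?_, ?_⟩
  · have := hi (x * a) (y * b) (by rw [← hxy, smul_smul, smul_smul])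
    simpa [ha, hb] using this
  · simp [F_smul, D_smul_left, D_smul_right, h1, h2, h3, h4]

lemma exists_polynomial_multiple {𝕜 : Type*} [Field 𝕜] (v : ι → FractionRing 𝕜[X]) :
    ∃ (d : 𝕜[X]) (w : ι → 𝕜[X]), d ≠ 0 ∧
      algebraMap 𝕜[X] (FractionRing 𝕜[X]) ∘ w = algebraMap 𝕜[X] (FractionRing 𝕜[X]) d • v := by
  obtain ⟨d, w, hd, h⟩ := exists_common_denominator (𝕜 := 𝕜) (E := FractionRing 𝕜[X]) v
  exact ⟨d, w, hd, funext h⟩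

end Maps

section Specialization

variable {K : Type*} [Field K] {c : Fin 5 → Fin 5 → Fin 5 → K}

/-- The vectors `e₁`, `e₂`, `e₃` complete the point `y` to a basis of its tangent space, and the
tangent hyperplane section does not have an Eckardt point at `y`. -/
structure TangentFrame {A : Type*} [CommRing A] (c : Fin 5 → Fin 5 → Fin 5 → A)
    (y e₁ e₂ e₃ m : Fin 5 → A) : Prop where
  det_ne_zero : (Matrix.of ![y, e₁, e₂, e₃, m]).det ≠ 0
  F_eq_zero : F c y = 0
  tangent₁ : D c y e₁ = 0
  tangent₂ : D c y e₂ = 0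
  tangent₃ : D c y e₃ = 0
  quadratic_ne_zero : D c e₁ y ≠ 0

lemma TangentFrame.map {A R : Type*} [CommRing A] [CommRing R] {c : Fin 5 → Fin 5 → Fin 5 → A}
    {y e₁ e₂ e₃ m : Fin 5 → A} (h : TangentFrame c y e₁ e₂ e₃ m) (φ : A →+* R)
    (hdet : φ (Matrix.of ![y, e₁, e₂, e₃, m]).det ≠ 0) (hq : φ (D c e₁ y) ≠ 0) :
    TangentFrame (mapc φ c) (φ ∘ y) (φ ∘ e₁) (φ ∘ e₂) (φ ∘ e₃) (φ ∘ m) where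
  det_ne_zero := by rwa [det_comp]
  F_eq_zero := by rw [F_map, h.F_eq_zero, map_zero]
  tangent₁ := by rw [D_map, h.tangent₁, map_zero]
  tangent₂ := by rw [D_map, h.tangent₂, map_zero]
  tangent₃ := by rw [D_map, h.tangent₃, map_zero]
  quadratic_ne_zero := by rwa [D_map]

lemma TangentFrame.swap {A : Type*} [CommRing A] {c : Fin 5 → Fin 5 → Fin 5 → A}
    {y e₁ e₂ e₃ m : Fin 5 → A} (h : TangentFrame c y e₁ e₂ e₃ m) :
    TangentFrame c y e₁ e₃ e₂ m where
  det_ne_zero := by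
    have : Matrix.of ![y, e₁, e₃, e₂, m] =
        (Matrix.of ![y, e₁, e₂, e₃, m]).submatrix (Equiv.swap (2 : Fin 5) 3) id := by
      funext i
      fin_cases i <;> rfl
    rw [this, Matrix.det_permute, Equiv.Perm.sign_swap (by decide)]
    simpa using h.det_ne_zero
  F_eq_zero := h.F_eq_zero
  tangent₁ := h.tangent₁
  tangent₂ := h.tangent₃
  tangent₃ := h.tangent₂
  quadratic_ne_zero := h.quadratic_ne_zero

lemma TangentFrame.tangentLine {y e₁ e₂ e₃ m : Fin 5 → K} (h : TangentFrame c y e₁ e₂ e₃ m)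
    {L : Type*} [Field L] [Algebra K L] [IsAlgClosed L] {θ : L} {m₁ m₀ : K}
    (hθ : θ ^ 2 + algebraMap K L m₁ * θ + algebraMap K L m₀ = 0)
    (hres : res (mapc (algebraMap K L) c) (algebraMap K L ∘ y) (algebraMap K L ∘ e₁)
      (algebraMap K L ∘ e₂ + θ • algebraMap K L ∘ e₃) = 0) : TangentLine c y := by
  refine tangentLine_of_res_eq_zero (fun r₀ r₁ r₂ r₃ hr => ?_) h.F_eq_zero h.tangent₁ h.tangent₂
    h.tangent₃ h.quadratic_ne_zero hθ hres
  obtain ⟨a, b, c, d, -⟩ := eq_zero_of_det_ne_zero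
    (det_comp_ne_zero (algebraMap K L).injective h.det_ne_zero) (r₄ := 0)
    (by rw [hr, zero_smul, add_zero])
  exact ⟨a, b, c, d⟩

lemma TangentFrame.res_ne_zero (hno : ∀ v w, ¬ IsLine c v w) {y e₁ e₂ e₃ m : Fin 5 → K} (h : TangentFrame c y e₁ e₂ e₃ m)
    (u : K) : res c y e₁ (e₂ + u • e₃) ≠ 0 := by
  intro h0
  obtain ⟨v, w, hl, -⟩ := h.tangentLine (L := AlgebraicClosure K) (θ := algebraMap K _ u) (m₁ := -u)
    (m₀ := 0) (by rw [map_neg, map_zero]; ring) (by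
      rw [← comp_smul, ← comp_add, res_map, h0, map_zero])
  exact hno v w hl

lemma TangentFrame.res_ne_zero' (hno : ∀ v w, ¬ IsLine c v w) {y e₁ e₂ e₃ m : Fin 5 → K} (h : TangentFrame c y e₁ e₂ e₃ m) :
    res c y e₁ e₃ ≠ 0 := by
  simpa using TangentFrame.res_ne_zero hno h.swap 0

end Specialization

section ConstantLines

variable {K 𝕜 : Type*} [Field K] [Infinite K] [Field 𝕜] [IsAlgClosed 𝕜] [Algebra K 𝕜]
  {c : Fin 5 → Fin 5 → Fin 5 → K}

lemma exists_eval_ne_zero {δ : K[X]} (h : δ ≠ 0) : ∃ t, δ.eval t ≠ 0 := by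
  by_contra! h'
  exact h (funext fun t => by rw [h' t, eval_zero])

lemma TangentFrame.resultant_spec (hno : ∀ v w, ¬ IsLine c v w)
    {y e₁ e₂ e₃ m : Fin 5 → K[X]} (h : TangentFrame (mapc C c) y e₁ e₂ e₃ m) :
    let g := res (mapc C (mapc C c)) (C ∘ y) (C ∘ e₁) (C ∘ e₂ + (X : K[X][X]) • C ∘ e₃)
    g.natDegree ≠ 0 ∧ g.natDegree ≤ 6 ∧
      ∃ bad : Finset K, ∀ t ∉ bad, ∀ u, g.eval₂ (evalRingHom t) u ≠ 0 := by
  classical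
  intro g
  set δ := (Matrix.of ![y, e₁, e₂, e₃, m]).det * D (mapc C c) e₁ y with hδ
  have hδ0 : δ ≠ 0 := mul_ne_zero h.det_ne_zero h.quadratic_ne_zero
  have spec : ∀ t, δ.eval t ≠ 0 → TangentFrame c (evalRingHom t ∘ y) (evalRingHom t ∘ e₁)
      (evalRingHom t ∘ e₂) (evalRingHom t ∘ e₃) (evalRingHom t ∘ m) := by
    intro t ht
    rw [hδ, eval_mul] at ht
    have := h.map (evalRingHom t) (left_ne_zero_of_mul ht) (right_ne_zero_of_mul ht)
    rwa [mapc_eval] at this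
  obtain ⟨hle, hcoeff⟩ := res_natDegree_le_and_coeff (mapc C c) y e₁ e₂ e₃
  refine ⟨fun h0 => ?_, hle, δ.roots.toFinset, fun t ht u => ?_⟩
  · obtain ⟨t, ht⟩ := exists_eval_ne_zero hδ0
    have := TangentFrame.res_ne_zero' hno (spec t ht)
    rw [← mapc_eval c t, res_map, ← hcoeff] at this
    refine this ?_
    rw [coeff_eq_zero_of_natDegree_lt (by change g.natDegree < 6; omega), map_zero]
  · have ht' : δ.eval t ≠ 0 := fun h0 => ht (by simp [hδ0, h0])
    have := TangentFrame.res_ne_zero hno (spec t ht') u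
    have key := map_res_pencil (c := mapc C c) (Φ := eval₂RingHom (evalRingHom t) u)
      (ψ := evalRingHom t) (fun a => by simp) (θ := u) (by simp) y e₁ e₂ e₃
    rw [mapc_eval] at key
    rwa [← key] at this

lemma TangentLine.exists_constant (p : ℕ) [Fact p.Prime] [CharP 𝕜 p]
    {c : Fin 5 → Fin 5 → Fin 5 → 𝕜} (hs : Smooth c) {y : Fin 5 → 𝕜[X]}
    (h : TangentLine (mapc (algebraMap 𝕜[X] (FractionRing 𝕜[X])) (mapc C c))
      (algebraMap 𝕜[X] (FractionRing 𝕜[X]) ∘ y)) :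
    ∃ v₀ w₀ : Fin 5 → 𝕜, IsLine c v₀ w₀ ∧ D (mapc C c) y (C ∘ v₀) = 0 ∧
      D (mapc C c) y (C ∘ w₀) = 0 := by
  obtain ⟨v, w, hl, hv, hw⟩ := h
  have hinj := IsFractionRing.injective 𝕜[X] (FractionRing 𝕜[X])
  obtain ⟨d, v', hd, hv'⟩ := exists_polynomial_multiple v
  obtain ⟨d', w', hd', hw'⟩ := exists_polynomial_multiple w
  have hl' : IsLine (mapc C c) v' w' := by
    refine IsLine.of_map hinj ?_
    rw [hv', hw']
    exact hl.smul ((map_ne_zero_iff _ hinj).mpr hd) ((map_ne_zero_iff _ hinj).mpr hd')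
  have hDv : D (mapc C c) y v' = 0 := hinj (by
    rw [← D_map, hv', D_smul_right, hv, mul_zero, map_zero])
  have hDw : D (mapc C c) y w' = 0 := hinj (by
    rw [← D_map, hw', D_smul_right, hw, mul_zero, map_zero])
  obtain ⟨v₀, w₀, h0, h1, h2⟩ := exists_constant_line p hs hl'
  have key : ∀ u, InSpan v' w' u → D (mapc C c) y u = 0 := by
    rintro u ⟨d, a, b, hd, hu⟩
    have := congrArg (D (mapc C c) y) hu
    rw [D_add_right, D_smul_right, D_smul_right, D_smul_right, hDv, hDw] at this
    simpa [hd] using this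
  exact ⟨v₀, w₀, h0, key _ h1, key _ h2⟩

/-- If the cubic threefold contains no line over the ground field, a rational family of tangent
hyperplanes has a line over the algebraic closure contained in all of them. -/
theorem TangentFrame.exists_constant_line (p : ℕ) [Fact p.Prime] [CharP 𝕜 p]
    (hs : Smooth (mapc (algebraMap K 𝕜) c)) (hno : ∀ v w, ¬ IsLine c v w)
    (hlow : HasLowFactors K 𝕜) {y e₁ e₂ e₃ m : Fin 5 → K[X]}
    (h : TangentFrame (mapc C c) y e₁ e₂ e₃ m) :
    ∃ v₀ w₀ : Fin 5 → 𝕜, IsLine (mapc (algebraMap K 𝕜) c) v₀ w₀ ∧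
      D (mapc C (mapc (algebraMap K 𝕜) c)) (mapRingHom (algebraMap K 𝕜) ∘ y) (C ∘ v₀) = 0 ∧
      D (mapc C (mapc (algebraMap K 𝕜) c)) (mapRingHom (algebraMap K 𝕜) ∘ y) (C ∘ w₀) = 0 := by
  obtain ⟨h1, h2, bad, h3⟩ := h.resultant_spec hno
  obtain ⟨f, hf, hdeg, hdvd⟩ := hlow _ bad h1 h2 h3
  obtain ⟨θ, m₁, m₀, hroot, hθ⟩ := exists_root_of_irreducible_of_natDegree_le_two hf hdeg
  refine TangentLine.exists_constant p hs ?_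
  set E := FractionRing 𝕜[X]
  set ρ : K[X] →+* 𝕜[X] := mapRingHom (algebraMap K 𝕜)
  have hρ : Function.Injective ρ := map_injective _ (algebraMap K 𝕜).injective
  have hinj := IsFractionRing.injective 𝕜[X] E
  have hC : mapc ρ (mapc C c) = mapc C (mapc (algebraMap K 𝕜) c) := by
    funext i j k; simp [mapc, ρ]
  set ψ : K[X] →+* E := (algebraMap 𝕜[X] E).comp ρ
  have hψ : Function.Injective ψ := hinj.comp hρ
  have hframe := h.map ψ ((map_ne_zero_iff ψ hψ).mpr h.det_ne_zero)
    ((map_ne_zero_iff ψ hψ).mpr h.quadratic_ne_zero)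
  rw [← hC]
  refine hframe.tangentLine hθ ?_
  have key := map_res_pencil (c := mapc C c)
    (Φ := (aeval θ).toRingHom.comp ((mapRingHom (algebraMap 𝕜[X] E)).comp (mapRingHom ρ)))
    (ψ := (algebraMap E (AlgebraicClosure E)).comp ψ)
    (fun a => by simp [ψ]; rfl) (θ := θ) (by simp) y e₁ e₂ e₃
  refine key.symm.trans ?_
  obtain ⟨f', hf'⟩ := hdvd
  simp only [RingHom.comp_apply, coe_mapRingHom]
  erw [hf']
  rw [_root_.map_mul]
  erw [hroot]
  rw [zero_mul]

end ConstantLines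

section EckardtFrames

/-- The vectors `f₂`, `f₃` span with `y` a plane whose intersection with the cubic is a cone
with vertex `y`. -/
structure ConeFrame {A : Type*} [CommRing A] (c : Fin 5 → Fin 5 → Fin 5 → A)
    (y f₂ f₃ m m' : Fin 5 → A) : Prop where
  det_ne_zero : (Matrix.of ![y, f₂, f₃, m, m']).det ≠ 0
  F_eq_zero : F c y = 0
  tangent₂ : D c y f₂ = 0
  tangent₃ : D c y f₃ = 0
  quadratic₂ : D c f₂ y = 0
  quadratic₃ : D c f₃ y = 0
  quadratic₂₃ : B c f₂ f₃ y = 0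

lemma ConeFrame.map {A R : Type*} [CommRing A] [CommRing R] {c : Fin 5 → Fin 5 → Fin 5 → A}
    {y f₂ f₃ m m' : Fin 5 → A} (h : ConeFrame c y f₂ f₃ m m') (φ : A →+* R)
    (hdet : φ (Matrix.of ![y, f₂, f₃, m, m']).det ≠ 0) :
    ConeFrame (mapc φ c) (φ ∘ y) (φ ∘ f₂) (φ ∘ f₃) (φ ∘ m) (φ ∘ m') where
  det_ne_zero := by rwa [det_comp]
  F_eq_zero := by rw [F_map, h.F_eq_zero, map_zero]
  tangent₂ := by rw [D_map, h.tangent₂, map_zero]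
  tangent₃ := by rw [D_map, h.tangent₃, map_zero]
  quadratic₂ := by rw [D_map, h.quadratic₂, map_zero]
  quadratic₃ := by rw [D_map, h.quadratic₃, map_zero]
  quadratic₂₃ := by rw [B_map, h.quadratic₂₃, map_zero]

lemma ConeFrame.isLine {A : Type*} [CommRing A] [IsDomain A] {c : Fin 5 → Fin 5 → Fin 5 → A}
    {y f₂ f₃ m m' : Fin 5 → A} (h : ConeFrame c y f₂ f₃ m m') {a b : A} (hab : ¬ (a = 0 ∧ b = 0))
    (hF : F c (a • f₂ + b • f₃) = 0) : IsLine c y (a • f₂ + b • f₃) := by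
  refine ⟨fun r s hrs => ?_, h.F_eq_zero, ?_, ?_, hF⟩
  · obtain ⟨h0, h1, h2, -, -⟩ := eq_zero_of_det_ne_zero h.det_ne_zero (r₀ := r) (r₁ := s * a)
      (r₂ := s * b) (r₃ := 0) (r₄ := 0) (by rw [← hrs]; module)
    refine ⟨h0, by_contra fun hs => hab ⟨?_, ?_⟩⟩
    · exact (mul_eq_zero.mp h1).resolve_left hs
    · exact (mul_eq_zero.mp h2).resolve_left hs
  · simp [D_add_right, D_smul_right, h.tangent₂, h.tangent₃]
  · simp [D_add_left, D_smul_left, B_smul₁, B_smul₂, h.quadratic₂, h.quadratic₃, h.quadratic₂₃]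

lemma F_pencil_natDegree_le_and_coeff {ι A : Type*} [Fintype ι] [CommRing A]
    (c : ι → ι → ι → A) (f₂ f₃ : ι → A) :
    (F (mapc C c) (C ∘ f₂ + (X : A[X]) • C ∘ f₃)).natDegree ≤ 3 ∧
    (F (mapc C c) (C ∘ f₂ + (X : A[X]) • C ∘ f₃)).coeff 3 = F c f₃ := by
  have hw := natDegree_le_one_of_pencil f₂ f₃
  refine ⟨T_natDegree_le c hw hw hw, ?_⟩
  have := F_coeff c hw
  rwa [coeff_one_pencil f₂ f₃] at this

variable {K 𝕜 : Type*} [Field K] [Infinite K] {c : Fin 5 → Fin 5 → Fin 5 → K}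

lemma ConeFrame.pencil_spec (hno : ∀ v w, ¬ IsLine c v w)
    {y f₂ f₃ m m' : Fin 5 → K[X]} (h : ConeFrame (mapc C c) y f₂ f₃ m m') :
    let g := F (mapc C (mapc C c)) (C ∘ f₂ + (X : K[X][X]) • C ∘ f₃)
    g.natDegree = 3 ∧ ∃ bad : Finset K, ∀ t ∉ bad, ∀ u, g.eval₂ (evalRingHom t) u ≠ 0 := by
  classical
  intro g
  set δ := (Matrix.of ![y, f₂, f₃, m, m']).det with hδ
  have hδ0 : δ ≠ 0 := h.det_ne_zero
  have spec : ∀ t, δ.eval t ≠ 0 → ∀ a b : K, ¬ (a = 0 ∧ b = 0) →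
      F c (a • (evalRingHom t ∘ f₂) + b • (evalRingHom t ∘ f₃)) ≠ 0 := by
    intro t ht a b hab h0
    have := h.map (evalRingHom t) ht
    rw [mapc_eval] at this
    exact hno _ _ (this.isLine hab h0)
  obtain ⟨hle, hcoeff⟩ := F_pencil_natDegree_le_and_coeff (mapc C c) f₂ f₃
  refine ⟨le_antisymm hle (not_lt.mp fun hlt => ?_), δ.roots.toFinset, fun t ht u => ?_⟩
  · obtain ⟨t, ht⟩ := exists_eval_ne_zero hδ0
    have := spec t ht 0 1 (by simp)
    rw [zero_smul, zero_add, one_smul, ← mapc_eval c t, F_map, ← hcoeff,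
      coeff_eq_zero_of_natDegree_lt hlt, map_zero] at this
    exact this rfl
  · have ht' : δ.eval t ≠ 0 := fun h0 => ht (by simp [hδ0, h0])
    have := spec t ht' 1 u (by simp)
    have key := map_F_pencil (c := mapc C c) (Φ := eval₂RingHom (evalRingHom t) u)
      (ψ := evalRingHom t) (fun a => by simp) (θ := u) (by simp) f₂ f₃
    rw [mapc_eval] at key
    rw [one_smul] at this
    rwa [← key] at this

variable [Field 𝕜] [IsAlgClosed 𝕜] [Algebra K 𝕜]

/-- If the cubic threefold contains no line over the ground field, the lines through the vertices
of a rational family of plane sections that are cones contain a constant line. -/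
theorem ConeFrame.exists_constant_line (p : ℕ) [Fact p.Prime] [CharP 𝕜 p]
    (hs : Smooth (mapc (algebraMap K 𝕜) c)) (hno : ∀ v w, ¬ IsLine c v w)
    (hlow : HasLowFactors K 𝕜) {y f₂ f₃ m m' : Fin 5 → K[X]}
    (h : ConeFrame (mapc C c) y f₂ f₃ m m') :
    ∃ (v₀ w₀ : Fin 5 → 𝕜) (a b : 𝕜[X]), IsLine (mapc (algebraMap K 𝕜) c) v₀ w₀ ∧ a ≠ 0 ∧
      InSpan (mapRingHom (algebraMap K 𝕜) ∘ y) (a • mapRingHom (algebraMap K 𝕜) ∘ f₂ +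
        b • mapRingHom (algebraMap K 𝕜) ∘ f₃) (C ∘ v₀) ∧
      InSpan (mapRingHom (algebraMap K 𝕜) ∘ y) (a • mapRingHom (algebraMap K 𝕜) ∘ f₂ +
        b • mapRingHom (algebraMap K 𝕜) ∘ f₃) (C ∘ w₀) := by
  obtain ⟨h1, bad, h3⟩ := h.pencil_spec hno
  obtain ⟨f, hf, hdeg, hdvd⟩ := hlow _ bad (by rw [h1]; simp) (by rw [h1]; simp) h3
  set E := FractionRing 𝕜[X]
  set ρ : K[X] →+* 𝕜[X] := mapRingHom (algebraMap K 𝕜)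
  have hρ : Function.Injective ρ := map_injective _ (algebraMap K 𝕜).injective
  have hinj := IsFractionRing.injective 𝕜[X] E
  have hC : mapc ρ (mapc C c) = mapc C (mapc (algebraMap K 𝕜) c) := by
    funext i j k; simp [mapc, ρ]
  set ψ : K[X] →+* E := (algebraMap 𝕜[X] E).comp ρ
  obtain ⟨u, hu⟩ := exists_root_of_natDegree_eq_three
    (by rw [natDegree_map_eq_of_injective hinj, natDegree_map_eq_of_injective hρ, h1]) hf hdeg hdvd
  have key := map_F_pencil (c := mapc C c)
    (Φ := (evalRingHom u).comp ((mapRingHom (algebraMap 𝕜[X] E)).comp (mapRingHom ρ)))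
    (ψ := ψ) (fun a => by simp [ψ]) (θ := u) (by simp) f₂ f₃
  have hroot : F (mapc ψ (mapc C c)) (ψ ∘ f₂ + u • ψ ∘ f₃) = 0 := key.symm.trans hu
  obtain ⟨b, a, ha, hab⟩ := IsFractionRing.div_surjective (A := 𝕜[X]) u
  have ha0 := nonZeroDivisors.ne_zero ha
  have haE : algebraMap 𝕜[X] E a ≠ 0 := (map_ne_zero_iff _ hinj).mpr ha0
  have hcone := h.map ρ ((map_ne_zero_iff ρ hρ).mpr h.det_ne_zero)
  rw [hC] at hcone
  have hline := hcone.isLine (a := a) (b := b) (fun h0 => ha0 h0.1) (hinj (by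
    rw [map_zero, ← F_map, comp_add, comp_smul, comp_smul, ← hC, mapc_mapc,
      show algebraMap 𝕜[X] E a • ⇑(algebraMap 𝕜[X] E) ∘ ⇑ρ ∘ f₂ +
        algebraMap 𝕜[X] E b • ⇑(algebraMap 𝕜[X] E) ∘ ⇑ρ ∘ f₃ =
        algebraMap 𝕜[X] E a • (ψ ∘ f₂ + u • ψ ∘ f₃) by
          rw [smul_add, smul_smul, ← hab, mul_div_cancel₀ _ haE]; rfl,
      F_smul]
    exact mul_eq_zero_of_right _ hroot))
  obtain ⟨v₀, w₀, h0, hv, hw⟩ := CubicLines.exists_constant_line p hs hline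
  exact ⟨v₀, w₀, a, b, h0, ha0, hv, hw⟩

end EckardtFrames

section LinearAlgebra

variable {E : Type*} [Field E]

lemma exists_coordinates {a b c d e : Fin 5 → E} (h : (Matrix.of ![a, b, c, d, e]).det ≠ 0)
    (v : Fin 5 → E) : ∃ r₀ r₁ r₂ r₃ r₄ : E, v = r₀ • a + r₁ • b + r₂ • c + r₃ • d + r₄ • e := by
  obtain ⟨r, hr⟩ := Matrix.vecMul_surjective_iff_isUnit.mpr
    ((Matrix.isUnit_iff_isUnit_det _).mpr h.isUnit) v
  refine ⟨r 0, r 1, r 2, r 3, r 4, ?_⟩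
  rw [← hr]
  dsimp only
  rw [Matrix.vecMul_eq_sum]
  simp [Fin.sum_univ_succ, add_assoc]
  rfl

lemma det_ne_zero_of_forall {A : Type*} [CommRing A] [IsDomain A] {a b c d e : Fin 5 → A}
    (h : ∀ r₀ r₁ r₂ r₃ r₄ : A, r₀ • a + r₁ • b + r₂ • c + r₃ • d + r₄ • e = 0 →
      r₀ = 0 ∧ r₁ = 0 ∧ r₂ = 0 ∧ r₃ = 0 ∧ r₄ = 0) :
    (Matrix.of ![a, b, c, d, e]).det ≠ 0 := by
  intro hdet
  obtain ⟨r, hr, h0⟩ := Matrix.exists_vecMul_eq_zero_iff.mpr hdet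
  obtain ⟨h0, h1, h2, h3, h4⟩ := h (r 0) (r 1) (r 2) (r 3) (r 4) (by
    rw [← h0, Matrix.vecMul_eq_sum]
    simp [Fin.sum_univ_succ, add_assoc]
    rfl)
  refine hr (funext fun i => ?_)
  fin_cases i <;> assumption

variable {φ : (Fin 5 → E) →ₗ[E] E}

lemma four_le_finrank_ker (φ : (Fin 5 → E) →ₗ[E] E) :
    4 ≤ Module.finrank E (LinearMap.ker φ) := by
  have h1 := φ.finrank_range_add_finrank_ker
  have h2 := (LinearMap.range φ).finrank_le
  simp only [Module.finrank_fin_fun, Module.finrank_self] at h1 h2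
  omega

lemma exists_indep_mem_ker {v : Fin 5 → E} (hv : φ v = 0) (hv0 : v ≠ 0) :
    ∃ w, φ w = 0 ∧ Indep v w := by
  have h1 : LinearIndependent E ![(⟨v, hv⟩ : LinearMap.ker φ)] :=
    LinearIndependent.of_subsingleton (0 : Fin 1) (fun h => hv0 (congrArg Subtype.val h))
  obtain ⟨w, h2⟩ := exists_linearIndependent_snoc_of_lt_finrank h1
    (by have := four_le_finrank_ker φ; omega)
  refine ⟨w, w.2, fun a b hab => ?_⟩
  have := Fintype.linearIndependent_iff.mp h2 ![a, b] (by
    rw [Fin.sum_univ_two]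
    exact Subtype.ext hab)
  exact ⟨this 0, this 1⟩

lemma exists_basis_of_ker (hφ : φ ≠ 0) {v w : Fin 5 → E} (hv : φ v = 0) (hw : φ w = 0)
    (h : Indep v w) : ∃ e₂ e₃ m, φ e₂ = 0 ∧ φ e₃ = 0 ∧ φ m ≠ 0 ∧
      (Matrix.of ![v, w, e₂, e₃, m]).det ≠ 0 := by
  have h2 : LinearIndependent E ![(⟨v, hv⟩ : LinearMap.ker φ), ⟨w, hw⟩] :=
    LinearIndependent.pair_iff.mpr fun a b hab => h a b (congrArg Subtype.val hab)
  have h4 := four_le_finrank_ker φ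
  obtain ⟨e₂, h3⟩ := exists_linearIndependent_snoc_of_lt_finrank h2 (by omega)
  obtain ⟨e₃, h4⟩ := exists_linearIndependent_snoc_of_lt_finrank h3 (by omega)
  obtain ⟨m, hm⟩ : ∃ m, φ m ≠ 0 := by
    by_contra! h'
    exact hφ (LinearMap.ext h')
  refine ⟨e₂, e₃, m, e₂.2, e₃.2, hm, det_ne_zero_of_forall fun r₀ r₁ r₂ r₃ r₄ hr => ?_⟩
  have hr4 : r₄ = 0 := by
    have := congrArg φ hr
    simpa [hv, hw, hm] using this
  rw [hr4, zero_smul, add_zero] at hr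
  have := Fintype.linearIndependent_iff.mp h4 ![r₀, r₁, r₂, r₃] (by
    rw [Fin.sum_univ_four]
    exact Subtype.ext hr)
  exact ⟨this 0, this 1, this 2, this 3, hr4⟩

end LinearAlgebra

section Tangent

variable {ι A : Type*} [Fintype ι] [CommRing A] (c : ι → ι → ι → A)

/-- The derivative at `x` as a linear form. -/
def tangentForm (x : ι → A) : (ι → A) →ₗ[A] A where
  toFun := D c x
  map_add' := D_add_right c x
  map_smul' r y := D_smul_right c r x y

lemma tangentForm_apply (x y : ι → A) : tangentForm c x y = D c x y := rfl

variable {c}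

lemma Smooth.of_mapc {L : Type*} [CommRing L] {φ : A →+* L} (hφ : Function.Injective φ)
    (h : Smooth (mapc φ c)) : Smooth c := by
  classical
  intro x hx hD
  have := h (φ ∘ x) (by rw [F_map, hx, map_zero]) (fun y => by
    rw [D_eq_dotProduct]
    refine (congrArg (· ⬝ᵥ y) (funext fun i => ?_)).trans (zero_dotProduct y)
    rw [← comp_single_one φ i, D_map, hD, map_zero, Pi.zero_apply])
  funext i
  exact hφ ((congrFun this i).trans (map_zero φ).symm)

lemma Smooth.tangentForm_ne_zero (h : Smooth c) {x : ι → A} (hx : F c x = 0) (hx0 : x ≠ 0) :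
    tangentForm c x ≠ 0 := fun h0 => hx0 (h x hx fun y => LinearMap.congr_fun h0 y)

end Tangent

section Eckardt

variable {K 𝕜 : Type*} [Field K] [Infinite K] [Field 𝕜] [IsAlgClosed 𝕜] [Algebra K 𝕜]
  {c : Fin 5 → Fin 5 → Fin 5 → K}

lemma evalRingHom_comp_C {ι k : Type*} [CommRing k] (t : k) (w : ι → k) :
    evalRingHom t ∘ (C ∘ w) = w := by
  funext i; simp

lemma not_indep_of_proportional {𝕜 : Type*} [Field 𝕜] {y : Fin 5 → 𝕜[X]} {v w : Fin 5 → 𝕜}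
    {d a d' a' : 𝕜[X]} (hd : d ≠ 0) (hd' : d' ≠ 0) (h : d • (C ∘ v : Fin 5 → 𝕜[X]) = a • y)
    (h' : d' • (C ∘ w : Fin 5 → 𝕜[X]) = a' • y) : ¬ Indep v w := by
  intro hi
  have hC := indep_C hi
  have h1 := (hC (a' * d) (-(a * d')) (by
    rw [mul_smul, neg_smul, mul_smul, h, h', smul_smul, smul_smul, mul_comm a, add_neg_cancel])).1
  have ha' : a' = 0 := (mul_eq_zero.mp h1).resolve_right hd
  exact hd' (hC 0 d' (by rw [h', ha', zero_smul, zero_smul, add_zero])).2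

/-- A smooth cubic threefold without lines over the ground field has no Eckardt point over the
ground field. -/
theorem exists_quadratic_ne_zero (p : ℕ) [Fact p.Prime] [CharP 𝕜 p]
    (hs : Smooth (mapc (algebraMap K 𝕜) c)) (hno : ∀ v w, ¬ IsLine c v w)
    (hlow : HasLowFactors K 𝕜) {y : Fin 5 → K} (hy : F c y = 0) (hy0 : y ≠ 0) :
    ∃ z, D c y z = 0 ∧ D c z y ≠ 0 := by
  by_contra! hE
  have hφ := (hs.of_mapc (algebraMap K 𝕜).injective).tangentForm_ne_zero hy hy0
  have hyy : D c y y = 0 := by rw [D_self, hy, mul_zero]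
  obtain ⟨z₁, hz₁, hi⟩ := exists_indep_mem_ker (φ := tangentForm c y) hyy hy0
  obtain ⟨z₃, z₂, m, hz₃, hz₂, -, hdet⟩ := exists_basis_of_ker hφ hyy hz₁ hi
  rw [tangentForm_apply] at hz₁ hz₂ hz₃
  have hB : ∀ z z', D c y z = 0 → D c y z' = 0 → B c z z' y = 0 := by
    intro z z' hz hz'
    have h1 := hE (z + z') (by rw [D_add_right, hz, hz', add_zero])
    rwa [D_add_left, hE z hz, hE z' hz', zero_add, add_zero] at h1
  have hdet' : (Matrix.of ![(C ∘ y : Fin 5 → K[X]), C ∘ z₁ + (X : K[X]) • C ∘ z₂, C ∘ z₃,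
      C ∘ z₂, C ∘ m]).det ≠ 0 := by
    intro h0
    have := congrArg (evalRingHom (0 : K)) h0
    rw [← det_comp, map_zero] at this
    simp only [evalRingHom_comp_C, comp_add, comp_smul] at this
    exact hdet (by simpa using this)
  have hcone : ConeFrame (mapc C c) (C ∘ y) (C ∘ z₁ + (X : K[X]) • C ∘ z₂) (C ∘ z₃) (C ∘ z₂)
      (C ∘ m) :=
    { det_ne_zero := hdet'
      F_eq_zero := by rw [F_map, hy, map_zero]
      tangent₂ := by simp [D_add_right, D_smul_right, D_map, hz₁, hz₂]
      tangent₃ := by simp [D_map, hz₃]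
      quadratic₂ := by
        simp [D_add_left, D_smul_left, B_smul₂, D_map, B_map, hE, hz₁, hz₂, hB]
      quadratic₃ := by simp [D_map, hE, hz₃]
      quadratic₂₃ := by simp [B_add₁, B_smul₁, B_map, hB, hz₁, hz₂, hz₃] }
  obtain ⟨v₀, w₀, a, b, hl, ha, ⟨d, α, β, hd, hv⟩, ⟨d', α', β', hd', hw⟩⟩ :=
    hcone.exists_constant_line p hs hno hlow
  set ψ := algebraMap K 𝕜
  have hρC : ∀ u : Fin 5 → K, mapRingHom ψ ∘ (C ∘ u) = C ∘ (ψ ∘ u) := fun u => by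
    funext i; simp
  have hρX : mapRingHom ψ X = X := by simp
  simp only [comp_add, comp_smul, hρC, hρX] at hv hw
  have hdetψ := det_comp_ne_zero ψ.injective hdet
  have hdetC := det_comp_ne_zero (C_injective (R := 𝕜)) hdetψ
  have key : ∀ (u : Fin 5 → 𝕜) (d α β : 𝕜[X]), d ≠ 0 → d • (C ∘ u : Fin 5 → 𝕜[X]) =
      α • C ∘ (ψ ∘ y) + β • (a • (C ∘ (ψ ∘ z₁) + (X : 𝕜[X]) • C ∘ (ψ ∘ z₂)) +
        b • C ∘ (ψ ∘ z₃)) → d • (C ∘ u : Fin 5 → 𝕜[X]) = α • C ∘ (ψ ∘ y) := by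
    intro u d α β hd hu
    obtain ⟨s₀, s₁, s₂, s₃, s₄, rfl⟩ := exists_coordinates hdetψ u
    simp only [comp_add, comp_smul] at hu
    obtain ⟨-, q1, -, q3, -⟩ := eq_zero_of_det_ne_zero hdetC (r₀ := d * C s₀ - α)
      (r₁ := d * C s₁ - β * a) (r₂ := d * C s₂ - β * b) (r₃ := d * C s₃ - β * a * X)
      (r₄ := d * C s₄) (by rw [← sub_eq_zero] at hu; rw [← hu]; module)
    have h1 : d * (C s₃ - C s₁ * X) = 0 := by linear_combination q3 - X * q1
    have h2 := (mul_eq_zero.mp h1).resolve_left hd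
    have h3 : s₁ = 0 := by simpa [coeff_C] using congrArg (coeff · 1) h2
    rw [h3, map_zero, mul_zero, zero_sub, neg_eq_zero] at q1
    have h4 : β = 0 := (mul_eq_zero.mp q1).resolve_right ha
    simp only [comp_add, comp_smul]
    rw [hu, h4, zero_smul, add_zero]
  exact not_indep_of_proportional hd hd' (key _ _ _ _ hd hv) (key _ _ _ _ hd' hw) hl.1

end Eckardt

section Residual

variable {ι A R : Type*} [Fintype ι] [CommRing A] [CommRing R] (c : ι → ι → ι → A)

/-- If `z` is tangent at `y` to the cubic, this is the third intersection point of the line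
spanned by `y` and `z` with the cubic. -/
def residual (y z : ι → A) : ι → A := D c z y • z + (-F c z) • y

lemma residual_map (φ : A →+* R) (y z : ι → A) :
    residual (mapc φ c) (φ ∘ y) (φ ∘ z) = φ ∘ residual c y z := by
  rw [residual, residual, comp_add, comp_smul, comp_smul, D_map, F_map, map_neg]

variable {c}

lemma F_residual {y z : ι → A} (hy : F c y = 0) (hD : D c y z = 0) : F c (residual c y z) = 0 := by
  rw [residual, F_add, F_smul, F_smul, D_smul_left, D_smul_right, D_smul_left, D_smul_right, hy, hD]
  ring

lemma D_residual (y z x : ι → A) : D c (residual c y z) x =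
    D c z y * (D c z y * D c z x - F c z * B c z y x) + F c z ^ 2 * D c y x := by
  rw [residual, D_add_left, D_smul_left, D_smul_left, B_smul₁, B_smul₂]
  ring

lemma residual_ne_zero (hno : ∀ v w, ¬ IsLine c v w) {y z : ι → A} (hy : F c y = 0)
    (hD : D c y z = 0) (hi : Indep y z) : residual c y z ≠ 0 := by
  intro h0
  obtain ⟨h1, h2⟩ := hi.symm _ _ h0
  exact hno y z ⟨hi, hy, hD, h1, neg_eq_zero.mp h2⟩

end Residual

lemma indep_of_quadratic_ne_zero {ι k : Type*} [Fintype ι] [Field k] {c : ι → ι → ι → k}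
    {y z : ι → k} (hy : F c y = 0) (hQ : D c z y ≠ 0) : Indep y z := by
  have hyy : D c y y = 0 := by rw [D_self, hy, mul_zero]
  have hy0 : y ≠ 0 := by
    rintro rfl
    exact hQ (D_zero_right _ _)
  intro a b hab
  have hb : b = 0 := by
    by_contra hb
    have : b • z = (-a) • y := by rw [neg_smul, eq_neg_iff_add_eq_zero, add_comm, hab]
    have h2 := congrArg (D c · y) this
    simp only [D_smul_left, hyy, mul_zero] at h2
    exact hQ ((mul_eq_zero.mp h2).resolve_left (pow_ne_zero 2 hb))
  rw [hb, zero_smul, add_zero] at hab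
  exact ⟨(smul_eq_zero.mp hab).resolve_right hy0, hb⟩

section Frames

variable {K 𝕜 : Type*} [Field K] [Infinite K] [Field 𝕜] [IsAlgClosed 𝕜] [Algebra K 𝕜]
  {c : Fin 5 → Fin 5 → Fin 5 → K}

theorem exists_tangentFrame (p : ℕ) [Fact p.Prime] [CharP 𝕜 p]
    (hs : Smooth (mapc (algebraMap K 𝕜) c)) (hno : ∀ v w, ¬ IsLine c v w)
    (hlow : HasLowFactors K 𝕜) {y : Fin 5 → K[X]} (hy : F (mapc C c) y = 0)
    (hy0 : evalRingHom 0 ∘ y ≠ 0) : ∃ e₁ e₂ e₃ m, TangentFrame (mapc C c) y e₁ e₂ e₃ m := by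
  set y₀ := evalRingHom 0 ∘ y with hy₀
  have hF : F c y₀ = 0 := by rw [← mapc_eval c 0, F_map, hy, map_zero]
  have hφ := (hs.of_mapc (algebraMap K 𝕜).injective).tangentForm_ne_zero hF hy0
  have hyy : D c y₀ y₀ = 0 := by rw [D_self, hF, mul_zero]
  obtain ⟨e₁, h1, hκ⟩ := exists_quadratic_ne_zero p hs hno hlow hF hy0
  have hi := indep_of_quadratic_ne_zero hF hκ
  obtain ⟨e₂, e₃, m, h2, h3, hm, hdet⟩ := exists_basis_of_ker hφ hyy h1 hi
  rw [tangentForm_apply] at h2 h3 hm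
  let e : (Fin 5 → K) → Fin 5 → K[X] := fun u =>
    D (mapc C c) y (C ∘ m) • (C ∘ u : Fin 5 → K[X]) + (-D (mapc C c) y (C ∘ u)) • C ∘ m
  have he : ∀ u, D (mapc C c) y (e u) = 0 := fun u => by
    simp only [e, D_add_right, D_smul_right]; ring
  have hD0 : ∀ u, evalRingHom 0 (D (mapc C c) y (C ∘ u)) = D c y₀ u := fun u => by
    rw [← D_map, mapc_eval, evalRingHom_comp_C]
  have he0 : ∀ u, D c y₀ u = 0 → evalRingHom 0 ∘ e u = D c y₀ m • u := fun u hu => by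
    simp only [e, comp_add, comp_smul, evalRingHom_comp_C, hD0, map_neg, hu, neg_zero, zero_smul,
      add_zero]
  refine ⟨e e₁, e e₂, e e₃, C ∘ m, ?_, hy, he _, he _, he _, ?_⟩
  · refine ne_zero_of_map (f := evalRingHom (0 : K)) ?_
    rw [← det_comp, evalRingHom_comp_C, he0 _ h1, he0 _ h2, he0 _ h3, ← hy₀]
    refine det_ne_zero_of_forall fun r₀ r₁ r₂ r₃ r₄ hr => ?_
    simp only [smul_smul] at hr
    simpa [hm] using eq_zero_of_det_ne_zero hdet hr
  · refine ne_zero_of_map (f := evalRingHom (0 : K)) ?_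
    rw [← D_map, mapc_eval, he0 _ h1, D_smul_left]
    exact mul_ne_zero (pow_ne_zero 2 hm) hκ

end Frames

section ConstantDirections

variable {𝕜 : Type*} [Field 𝕜] [IsAlgClosed 𝕜]

lemma constant_tangent_spec {c : Fin 5 → Fin 5 → Fin 5 → 𝕜} {y z₁ z₂ x : Fin 5 → 𝕜}
    (hQ : D c z₂ y ≠ 0) (hcop : ∀ t : 𝕜, D c (z₁ + t • z₂) y = 0 → F c (z₁ + t • z₂) ≠ 0)
    (h : D (mapc C c) (residual (mapc C c) (C ∘ y) (C ∘ z₁ + (X : 𝕜[X]) • C ∘ z₂)) (C ∘ x) = 0) :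
    D c y x = 0 ∧ B c z₁ y x = 0 ∧ B c z₂ y x = 0 ∧ D c z₁ x = 0 ∧ D c z₂ x = 0 ∧
      B c z₁ z₂ x = 0 := by
  set z : Fin 5 → 𝕜[X] := C ∘ z₁ + (X : 𝕜[X]) • C ∘ z₂ with hz
  have ez : ∀ t, evalRingHom t ∘ z = z₁ + t • z₂ := fun t => by
    rw [hz, comp_add, comp_smul, evalRingHom_comp_C, evalRingHom_comp_C]; simp
  set Q := D (mapc C c) z (C ∘ y) with hQdef
  have eQ : ∀ t, Q.eval t = D c (z₁ + t • z₂) y := fun t => by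
    rw [hQdef, ← coe_evalRingHom, ← D_map, mapc_eval, evalRingHom_comp_C, ez]
  have eF : ∀ t, (F (mapc C c) z).eval t = F c (z₁ + t • z₂) := fun t => by
    rw [← coe_evalRingHom, ← F_map, mapc_eval, ez]
  have dz : ∀ u : Fin 5 → 𝕜, D (mapc C c) z (C ∘ u) =
      C (D c z₁ u) + X * C (B c z₁ z₂ u) + X ^ 2 * C (D c z₂ u) := fun u => by
    rw [hz, D_add_left, D_smul_left, B_smul₂, D_map, D_map, B_map]
  have bz : B (mapc C c) z (C ∘ y) (C ∘ x) = C (B c z₁ y x) + X * C (B c z₂ y x) := by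
    rw [hz, B_add₁, B_smul₁, B_map, B_map]
  have hdeg : Q.natDegree = 2 := by
    have : Q = C (D c z₂ y) * X ^ 2 + C (B c z₁ z₂ y) * X + C (D c z₁ y) := by
      rw [hQdef, dz]; ring
    rw [this, natDegree_quadratic hQ]
  rw [D_residual, ← hQdef] at h
  obtain ⟨t, ht⟩ := IsAlgClosed.exists_root Q (by
    rw [degree_eq_natDegree (by rintro h0; simp [h0] at hdeg), hdeg]; norm_num)
  have hyx : D c y x = 0 := by
    have h1 := congrArg (eval t) h
    rw [D_map, eval_add, eval_mul, ht.eq_zero, zero_mul, zero_add, eval_mul, eval_pow, eval_C,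
      eval_zero, eF] at h1
    exact (mul_eq_zero.mp h1).resolve_left (pow_ne_zero 2 (hcop t ((eQ t).symm.trans ht.eq_zero)))
  rw [D_map, hyx, map_zero, mul_zero, add_zero] at h
  have hQ0 : Q ≠ 0 := by rintro h0; simp [h0] at hdeg
  have h1 := sub_eq_zero.mp ((mul_eq_zero.mp h).resolve_left hQ0)
  have hc : IsCoprime Q (F (mapc C c) z) := by
    rw [isCoprime_iff_aeval_ne_zero_of_isAlgClosed 𝕜 𝕜]
    intro a
    by_contra! h0
    simp only [coe_aeval_eq_eval, eQ, eF] at h0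
    exact hcop a h0.1 h0.2
  have hB : B (mapc C c) z (C ∘ y) (C ∘ x) = 0 := by
    refine eq_zero_of_dvd_of_natDegree_lt (hc.dvd_of_dvd_mul_left ⟨_, h1.symm⟩) ?_
    rw [hdeg, bz, add_comm, mul_comm]
    exact natDegree_linear_le.trans_lt one_lt_two
  have hDz : D (mapc C c) z (C ∘ x) = 0 := by
    rw [hB, mul_zero] at h1
    exact (mul_eq_zero.mp h1).resolve_left hQ0
  rw [bz] at hB
  rw [dz] at hDz
  have b0 := congrArg (coeff · 0) hB
  have b1 := congrArg (coeff · 1) hB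
  have d0 := congrArg (coeff · 0) hDz
  have d1 := congrArg (coeff · 1) hDz
  have d2 := congrArg (coeff · 2) hDz
  simp [coeff_C, coeff_X, coeff_X_pow] at b0 b1 d0 d1 d2
  exact ⟨hyx, b0, b1, d0, d2, d1⟩

end ConstantDirections

lemma eq_zero_of_constant_tangent {ι k : Type*} [Fintype ι] [Field k] {c : ι → ι → ι → k}
    {y z₁ z₂ : ι → k} (hy : F c y = 0) (h1 : D c y z₁ = 0) (h2 : D c y z₂ = 0)
    (hQ : D c z₂ y ≠ 0) (hcop : ∀ t : k, D c (z₁ + t • z₂) y = 0 → F c (z₁ + t • z₂) ≠ 0)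
    (hB : (2 : k) ≠ 0 ∨ B c z₁ y z₂ ≠ 0) {r₀ r₁ r₂ : k}
    (hF : F c (r₀ • y + (r₁ • z₁ + r₂ • z₂)) = 0)
    (hb₁ : B c z₁ y (r₀ • y + (r₁ • z₁ + r₂ • z₂)) = 0)
    (hb₂ : B c z₂ y (r₀ • y + (r₁ • z₁ + r₂ • z₂)) = 0)
    (hd : D c z₂ (r₀ • y + (r₁ • z₁ + r₂ • z₂)) = 0) : r₀ = 0 ∧ r₁ = 0 ∧ r₂ = 0 := by
  have hs : B c z₂ y z₁ = B c z₁ y z₂ := by rw [B_swap₁₂, B_swap₂₃, B_swap₁₂]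
  simp only [B_add₃, B_smul₃, B_diag₂₃, B_diag₁₃, h1, h2, hs] at hb₁ hb₂
  have key : r₁ = 0 ∧ r₂ = 0 := by
    by_cases h20 : (2 : k) = 0
    · have hB := hB.resolve_left (not_not.mpr h20)
      simp only [h20, zero_mul, mul_zero, zero_add, add_zero] at hb₁ hb₂
      exact ⟨(mul_eq_zero.mp hb₂).resolve_right hB, (mul_eq_zero.mp hb₁).resolve_right hB⟩
    · have hQ0 : D c (r₁ • z₁ + r₂ • z₂) y = 0 := by
        rw [D_add_left, D_smul_left, D_smul_left, B_smul₁, B_smul₂]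
        rw [← B_swap₂₃ c z₁ y z₂]
        refine (mul_eq_zero.mp ?_).resolve_left h20
        linear_combination r₁ * hb₁ + r₂ * hb₂
      have hF0 : F c (r₁ • z₁ + r₂ • z₂) = 0 := by
        rw [F_add, F_smul, hy, D_smul_right, D_smul_left, hQ0, D_add_right,
          D_smul_right, D_smul_right, h1, h2] at hF
        linear_combination hF
      have hr₁ : r₁ = 0 := by
        by_contra hr
        have hz : r₁ • z₁ + r₂ • z₂ = r₁ • (z₁ + (r₂ / r₁) • z₂) := by
          rw [smul_add, smul_smul, mul_div_cancel₀ _ hr]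
        rw [hz, D_smul_left] at hQ0
        rw [hz, F_smul] at hF0
        exact hcop _ ((mul_eq_zero.mp hQ0).resolve_left (pow_ne_zero 2 hr))
          ((mul_eq_zero.mp hF0).resolve_left (pow_ne_zero 3 hr))
      rw [hr₁, zero_smul, zero_add, D_smul_left] at hQ0
      exact ⟨hr₁, pow_eq_zero_iff two_ne_zero |>.mp ((mul_eq_zero.mp hQ0).resolve_right hQ)⟩
  rw [key.1, key.2, zero_smul, zero_smul, add_zero, add_zero, D_smul_right] at hd
  exact ⟨(mul_eq_zero.mp hd).resolve_right hQ, key⟩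

lemma mapRingHom_residual {ι K 𝕜 : Type*} [Fintype ι] [CommRing K] [CommRing 𝕜]
    (c : ι → ι → ι → K) (ψ : K →+* 𝕜) (y z₁ z₂ : ι → K) :
    mapRingHom ψ ∘ residual (mapc C c) (C ∘ y) (C ∘ z₁ + (X : K[X]) • C ∘ z₂) =
      residual (mapc C (mapc ψ c)) (C ∘ (ψ ∘ y)) (C ∘ (ψ ∘ z₁) + (X : 𝕜[X]) • C ∘ (ψ ∘ z₂)) := by
  have hC : ∀ u : ι → K, mapRingHom ψ ∘ (C ∘ u) = C ∘ (ψ ∘ u) := fun u => by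
    funext i; simp
  have hc : mapc (mapRingHom ψ) (mapc C c) = mapc C (mapc ψ c) := by
    funext i j k; simp [mapc_apply]
  rw [← residual_map, hc, comp_add, comp_smul, hC, hC, hC, coe_mapRingHom, map_X]

section Directions

variable {K 𝕜 : Type*} [Field K] [Field 𝕜] [Algebra K 𝕜] {c : Fin 5 → Fin 5 → Fin 5 → K}

/-- The field `K` contains all the roots in `𝕜` of quadratic polynomials over `K`. -/
def QuadraticallyClosedIn (K 𝕜 : Type*) [Field K] [Field 𝕜] [Algebra K 𝕜] : Prop :=
  ∀ (a b : K) (x : 𝕜), x ^ 2 + algebraMap K 𝕜 a * x + algebraMap K 𝕜 b = 0 →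
    ∃ x₀, algebraMap K 𝕜 x₀ = x

lemma F_pencil_ne_zero (hno : ∀ v w, ¬ IsLine c v w) (hquad : QuadraticallyClosedIn K 𝕜)
    {y z₁ z₂ : Fin 5 → K} (hy : F c y = 0) (h1 : D c y z₁ = 0) (h2 : D c y z₂ = 0)
    (hQ : D c z₂ y ≠ 0) (hi : ∀ t : K, Indep y (z₁ + t • z₂)) (t : 𝕜)
    (ht : D (mapc (algebraMap K 𝕜) c) (algebraMap K 𝕜 ∘ z₁ + t • algebraMap K 𝕜 ∘ z₂)
      (algebraMap K 𝕜 ∘ y) = 0) :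
    F (mapc (algebraMap K 𝕜) c) (algebraMap K 𝕜 ∘ z₁ + t • algebraMap K 𝕜 ∘ z₂) ≠ 0 := by
  have hQ' : algebraMap K 𝕜 (D c z₂ y) ≠ 0 := by simpa using hQ
  obtain ⟨t, rfl⟩ := hquad (B c z₁ z₂ y / D c z₂ y) (D c z₁ y / D c z₂ y) t (by
    rw [D_add_left, D_smul_left, B_smul₂, D_map, D_map, B_map] at ht
    rw [map_div₀, map_div₀]
    field_simp
    linear_combination ht)
  rw [← comp_smul, ← comp_add] at ht ⊢
  rw [D_map, map_eq_zero] at ht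
  rw [F_map, _root_.map_ne_zero]
  intro hF
  exact hno _ _ ⟨hi t, hy, by rw [D_add_right, D_smul_right, h1, h2]; simp, ht, hF⟩

variable [IsAlgClosed 𝕜]

lemma exists_tangentFrame_residual [Infinite K] (p : ℕ) [Fact p.Prime] [CharP 𝕜 p]
    (hs : Smooth (mapc (algebraMap K 𝕜) c)) (hno : ∀ v w, ¬ IsLine c v w)
    (hlow : HasLowFactors K 𝕜) {y z₁ z₂ : Fin 5 → K} (hy : F c y = 0) (h1 : D c y z₁ = 0)
    (h2 : D c y z₂ = 0) (hi : Indep y z₁) : ∃ e₁ e₂ e₃ m, TangentFrame (mapc C c)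
      (residual (mapc C c) (C ∘ y) (C ∘ z₁ + (X : K[X]) • C ∘ z₂)) e₁ e₂ e₃ m := by
  refine exists_tangentFrame p hs hno hlow (F_residual (by rw [F_map, hy, map_zero]) (by
    rw [D_add_right, D_smul_right, D_map, D_map, h1, h2, map_zero, mul_zero, add_zero])) ?_
  have hz0 : evalRingHom 0 ∘ (C ∘ z₁ + (X : K[X]) • C ∘ z₂) = z₁ := by
    rw [comp_add, comp_smul, evalRingHom_comp_C, evalRingHom_comp_C]; simp
  rw [← residual_map, mapc_eval, evalRingHom_comp_C, hz0]
  exact residual_ne_zero hno hy h1 hi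

lemma false_of_directions [Infinite K] (p : ℕ) [Fact p.Prime] [CharP 𝕜 p]
    (hs : Smooth (mapc (algebraMap K 𝕜) c)) (hno : ∀ v w, ¬ IsLine c v w)
    (hlow : HasLowFactors K 𝕜) (hquad : QuadraticallyClosedIn K 𝕜)
    {y z₁ z₂ : Fin 5 → K} (hy : F c y = 0) (h1 : D c y z₁ = 0) (h2 : D c y z₂ = 0)
    (hQ : D c z₂ y ≠ 0) (hi : ∀ t : K, Indep y (z₁ + t • z₂))
    (hB : (2 : K) ≠ 0 ∨ B c z₁ y z₂ ≠ 0) : False := by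
  set ψ := algebraMap K 𝕜 with hψ
  obtain ⟨e₁, e₂, e₃, m, hframe⟩ := exists_tangentFrame_residual p hs hno hlow hy h1 h2
    (by simpa using hi 0)
  obtain ⟨v, w, hvw, hv, hw⟩ := hframe.exists_constant_line p hs hno hlow
  have hcop := F_pencil_ne_zero hno hquad hy h1 h2 hQ hi
  have hQ' : D (mapc ψ c) (ψ ∘ z₂) (ψ ∘ y) ≠ 0 := by rw [D_map]; simpa using hQ
  rw [mapRingHom_residual] at hv hw
  obtain ⟨v1, v2, v3, -, v4, -⟩ := constant_tangent_spec hQ' hcop hv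
  obtain ⟨w1, w2, w3, -, w4, -⟩ := constant_tangent_spec hQ' hcop hw
  have hyy : D c y y = 0 := by rw [D_self, hy, mul_zero]
  have hy0 : ψ ∘ y ≠ 0 := by
    intro h0
    rw [h0] at hQ'
    exact hQ' (D_zero_right _ _)
  have hl : (fun i => D (mapc ψ c) (ψ ∘ y) (Pi.single i 1)) ≠ 0 := fun h0 => hy0 <| by
    refine hs _ (by rw [F_map, hy, map_zero]) fun u => ?_
    rw [D_eq_dotProduct, h0, zero_dotProduct]
  have hdot : ∀ u, D (mapc ψ c) (ψ ∘ y) u = 0 →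
      u ⬝ᵥ (fun i => D (mapc ψ c) (ψ ∘ y) (Pi.single i 1)) = 0 := fun u hu => by
    rw [dotProduct_comm, ← D_eq_dotProduct, hu]
  obtain ⟨r₀, r₁, r₂, r₃, r₄, hr, hne⟩ := exists_relation_of_dotProduct_eq_zero hl
    (hdot (ψ ∘ y) (by rw [D_map, hyy, map_zero])) (hdot (ψ ∘ z₁) (by rw [D_map, h1, map_zero]))
    (hdot (ψ ∘ z₂) (by rw [D_map, h2, map_zero])) (hdot v v1) (hdot w w1)
  have hx : r₀ • (ψ ∘ y) + (r₁ • (ψ ∘ z₁) + r₂ • (ψ ∘ z₂)) = (-r₃) • v + (-r₄) • w := by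
    rw [neg_smul, neg_smul, ← sub_eq_zero, ← hr]; abel
  obtain ⟨e0, e1, e2⟩ := eq_zero_of_constant_tangent (c := mapc ψ c) (r₀ := r₀) (r₁ := r₁)
    (r₂ := r₂) (by rw [F_map, hy, map_zero]) (by rw [D_map, h1, map_zero])
    (by rw [D_map, h2, map_zero]) hQ' hcop
    (by
      rw [B_map, _root_.map_ne_zero]
      refine hB.imp_left fun h => ?_
      rw [← map_ofNat ψ 2]
      exact (_root_.map_ne_zero ψ).mpr h)
    (by rw [hx, hvw.F_eq_zero]) (by rw [hx, B_add₃, B_smul₃, B_smul₃, v2, w2]; simp)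
    (by rw [hx, B_add₃, B_smul₃, B_smul₃, v3, w3]; simp)
    (by rw [hx, D_add_right, D_smul_right, D_smul_right, v4, w4]; simp)
  simp only [e0, e1, e2, zero_smul, add_zero] at hx
  obtain ⟨e3, e4⟩ := hvw.1 _ _ hx.symm
  exact hne ⟨e0, e1, e2, neg_eq_zero.mp e3, neg_eq_zero.mp e4⟩

end Directions

lemma InSpan.exchange {ι A : Type*} [CommRing A] [IsDomain A] {v w u u' : ι → A}
    (hu : InSpan v w u) (hu' : InSpan v w u') (hi : Indep u u') : InSpan u u' v := by
  obtain ⟨d₁, a₁, b₁, hd₁, h₁⟩ := hu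
  obtain ⟨d₂, a₂, b₂, hd₂, h₂⟩ := hu'
  have hv : (a₁ * b₂ - a₂ * b₁) • v = (b₂ * d₁) • u + (-(b₁ * d₂)) • u' := by
    calc _ = b₂ • (a₁ • v + b₁ • w) - b₁ • (a₂ • v + b₂ • w) := by module
      _ = b₂ • d₁ • u - b₁ • d₂ • u' := by rw [h₁, h₂]
      _ = _ := by module
  have hw : (a₁ * b₂ - a₂ * b₁) • w = (-(a₂ * d₁)) • u + (a₁ * d₂) • u' := by
    calc _ = a₁ • (a₂ • v + b₂ • w) - a₂ • (a₁ • v + b₁ • w) := by module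
      _ = a₁ • d₂ • u' - a₂ • d₁ • u := by rw [h₁, h₂]
      _ = _ := by module
  refine ⟨a₁ * b₂ - a₂ * b₁, _, _, fun h0 => hd₁ ?_, hv⟩
  rw [h0, zero_smul] at hv hw
  obtain ⟨-, hb₁⟩ := hi _ _ hv.symm
  obtain ⟨-, ha₁⟩ := hi _ _ hw.symm
  rw [(mul_eq_zero.mp ha₁).resolve_right hd₂,
    (mul_eq_zero.mp (neg_eq_zero.mp hb₁)).resolve_right hd₂, zero_smul, zero_smul, add_zero] at h₁
  exact (hi d₁ 0 (by rw [h₁, zero_smul, add_zero])).1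

lemma exists_dotProduct_ne_zero {ι k : Type*} [Fintype ι] [Field k] {v w y : ι → k}
    (h : ∀ a b : k, a • v + b • w ≠ y) :
    ∃ l : ι → k, l ⬝ᵥ v = 0 ∧ l ⬝ᵥ w = 0 ∧ l ⬝ᵥ y ≠ 0 := by
  classical
  obtain ⟨f, hf, hle⟩ := Submodule.exists_le_ker_of_notMem (p := Submodule.span k {v, w}) (v := y)
    (fun hy => by
      obtain ⟨a, b, hab⟩ := Submodule.mem_span_pair.mp hy
      exact h a b hab)
  have hdot : ∀ u, (fun i => f (Pi.single i 1)) ⬝ᵥ u = f u := fun u => by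
    rw [f.pi_apply_eq_sum_univ u, dotProduct]
    exact Finset.sum_congr rfl fun i _ => by
      rw [smul_eq_mul, mul_comm]
      exact congrArg (u i * f ·) (funext fun j => by simp [Pi.single_apply, eq_comm])
  refine ⟨fun i => f (Pi.single i 1), ?_, ?_, ?_⟩
  · rw [hdot]; exact hle (Submodule.subset_span (by simp))
  · rw [hdot]; exact hle (Submodule.subset_span (by simp))
  · rwa [hdot]

lemma constant_functional_spec {ι 𝕜 : Type*} [Fintype ι] [Field 𝕜] [IsAlgClosed 𝕜]
    {c : ι → ι → ι → 𝕜} {y z₁ z₂ l : ι → 𝕜} (hQ : D c z₂ y ≠ 0)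
    (hcop : ∀ t : 𝕜, D c (z₁ + t • z₂) y = 0 → F c (z₁ + t • z₂) ≠ 0)
    (h : (C ∘ l) ⬝ᵥ residual (mapc C c) (C ∘ y) (C ∘ z₁ + (X : 𝕜[X]) • C ∘ z₂) = 0) :
    l ⬝ᵥ y = 0 ∧ l ⬝ᵥ z₂ = 0 := by
  set z : ι → 𝕜[X] := C ∘ z₁ + (X : 𝕜[X]) • C ∘ z₂ with hz
  have ez : ∀ t, evalRingHom t ∘ z = z₁ + t • z₂ := fun t => by
    rw [hz, comp_add, comp_smul, evalRingHom_comp_C, evalRingHom_comp_C]; simp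
  have hdot : ∀ u : ι → 𝕜, (C ∘ l : ι → 𝕜[X]) ⬝ᵥ (C ∘ u) = C (l ⬝ᵥ u) := fun u =>
    (RingHom.map_dotProduct C l u).symm
  set Q := D (mapc C c) z (C ∘ y) with hQdef
  have eQ : ∀ t, Q.eval t = D c (z₁ + t • z₂) y := fun t => by
    rw [hQdef, ← coe_evalRingHom, ← D_map, mapc_eval, evalRingHom_comp_C, ez]
  have eF : ∀ t, (F (mapc C c) z).eval t = F c (z₁ + t • z₂) := fun t => by
    rw [← coe_evalRingHom, ← F_map, mapc_eval, ez]
  have hdeg : Q.natDegree = 2 := by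
    have : Q = C (D c z₂ y) * X ^ 2 + C (B c z₁ z₂ y) * X + C (D c z₁ y) := by
      rw [hQdef, hz, D_add_left, D_smul_left, B_smul₂, D_map, D_map, B_map]; ring
    rw [this, natDegree_quadratic hQ]
  obtain ⟨t, ht⟩ := IsAlgClosed.exists_root Q (by
    rw [degree_eq_natDegree (by rintro h0; simp [h0] at hdeg), hdeg]; norm_num)
  rw [residual, dotProduct_add, dotProduct_smul, dotProduct_smul, hdot, smul_eq_mul, smul_eq_mul,
    ← hQdef] at h
  have hly : l ⬝ᵥ y = 0 := by
    have h1 := congrArg (eval t) h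
    rw [eval_add, eval_mul, ht.eq_zero, zero_mul, zero_add, eval_mul, eval_neg, eval_C,
      eval_zero, eF] at h1
    exact (mul_eq_zero.mp h1).resolve_left (neg_ne_zero.mpr
      (hcop t ((eQ t).symm.trans ht.eq_zero)))
  rw [hly, map_zero, mul_zero, add_zero] at h
  have hlz := (mul_eq_zero.mp h).resolve_left (by rintro h0; simp [h0] at hdeg)
  rw [hz, dotProduct_add, dotProduct_smul, hdot, hdot, smul_eq_mul] at hlz
  have h1 := congrArg (coeff · 1) hlz
  simp only [coeff_add, coeff_C_succ, coeff_X_mul, zero_add, coeff_C_zero, coeff_zero] at h1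
  exact ⟨hly, h1⟩

lemma expand_two_eq_sq {k : Type*} [Field k] (h2 : (2 : k) = 0) (hsq : ∀ x : k, ∃ r, r ^ 2 = x)
    (f : k[X]) : ∃ g : k[X], expand k 2 f = g ^ 2 := by
  induction f using Polynomial.induction_on' with
  | add f g hf hg =>
    obtain ⟨a, ha⟩ := hf
    obtain ⟨b, hb⟩ := hg
    have h2' : (2 : k[X]) = 0 := by rw [← map_ofNat C 2, h2, map_zero]
    exact ⟨a + b, by rw [map_add, ha, hb]; linear_combination (-a * b) * h2'⟩
  | monomial n a =>
    obtain ⟨r, hr⟩ := hsq a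
    exact ⟨monomial n r, by rw [expand_monomial, monomial_pow, hr]⟩

lemma TangentFrame.exists_coneFrame {A : Type*} [CommRing A] [IsDomain A]
    {c : Fin 5 → Fin 5 → Fin 5 → A} {y e₁ e₂ e₃ m : Fin 5 → A} (h : TangentFrame c y e₁ e₂ e₃ m)
    (h2 : (2 : A) = 0) {k g₂ g₃ : A} (hk : D c e₁ y = k ^ 2)
    (hg₂ : D c e₂ y = g₂ ^ 2) (hg₃ : D c e₃ y = g₃ ^ 2) (h₁₂ : B c e₁ e₂ y = 0)
    (h₁₃ : B c e₁ e₃ y = 0) (h₂₃ : B c e₂ e₃ y = 0) : ∃ f₂ f₃, ConeFrame c y f₂ f₃ e₁ m := by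
  have hk0 : k ≠ 0 := by
    rintro rfl
    exact h.quadratic_ne_zero (by rw [hk, zero_pow two_ne_zero])
  have h₂₁ : B c e₂ e₁ y = 0 := by rw [B_swap₁₂, h₁₂]
  have h₁₁ : B c e₁ e₁ y = 0 := by rw [B_diag₁₂, h2, zero_mul]
  refine ⟨k • e₂ + g₂ • e₁, k • e₃ + g₃ • e₁, ?_, h.F_eq_zero, ?_, ?_, ?_, ?_, ?_⟩
  · refine det_ne_zero_of_forall fun r₀ r₁ r₂ r₃ r₄ hr => ?_
    obtain ⟨h0, h1, h2, h3, h4⟩ := eq_zero_of_det_ne_zero h.det_ne_zero (r₀ := r₀)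
      (r₁ := r₁ * g₂ + r₂ * g₃ + r₃) (r₂ := r₁ * k) (r₃ := r₂ * k) (r₄ := r₄)
      (by rw [← hr]; module)
    have h2 := (mul_eq_zero.mp h2).resolve_right hk0
    have h3 := (mul_eq_zero.mp h3).resolve_right hk0
    rw [h2, h3, zero_mul, zero_mul, zero_add, zero_add] at h1
    exact ⟨h0, h2, h3, h1, h4⟩
  · rw [D_add_right, D_smul_right, D_smul_right, h.tangent₁, h.tangent₂]; ring
  · rw [D_add_right, D_smul_right, D_smul_right, h.tangent₁, h.tangent₃]; ring
  · rw [D_add_left, D_smul_left, D_smul_left, B_smul₁, B_smul₂, B_swap₁₂, h₁₂, hk, hg₂]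
    linear_combination k ^ 2 * g₂ ^ 2 * h2
  · rw [D_add_left, D_smul_left, D_smul_left, B_smul₁, B_smul₂, B_swap₁₂, h₁₃, hk, hg₃]
    linear_combination k ^ 2 * g₃ ^ 2 * h2
  · simp only [B_add₁, B_add₂, B_smul₁, B_smul₂, h₁₁, h₂₁, h₁₃, h₂₃]; ring

section Main

variable {K 𝕜 : Type*} [Field K] [Field 𝕜] [Algebra K 𝕜] [Infinite K]
  {c : Fin 5 → Fin 5 → Fin 5 → K}

lemma B_eq_zero_of_forall_eval
    (hB : ∀ y z z', F c y = 0 → D c y z = 0 → D c y z' = 0 → B c z z' y = 0)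
    {y z z' : Fin 5 → K[X]} (hy : F (mapc C c) y = 0) (hz : D (mapc C c) y z = 0)
    (hz' : D (mapc C c) y z' = 0) : B (mapc C c) z z' y = 0 := by
  refine Polynomial.funext fun t => ?_
  rw [eval_zero, ← coe_evalRingHom, ← B_map, mapc_eval]
  have h : ∀ {a : K[X]}, a = 0 → evalRingHom t a = 0 := fun ha => by rw [ha, map_zero]
  refine hB _ _ _ ?_ ?_ ?_
  · rw [← h hy, ← F_map, mapc_eval]
  · rw [← h hz, ← D_map, mapc_eval]
  · rw [← h hz', ← D_map, mapc_eval]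

variable [IsAlgClosed 𝕜]

lemma false_of_forall_B_eq_zero (p : ℕ) [Fact p.Prime] [CharP 𝕜 p]
    (hs : Smooth (mapc (algebraMap K 𝕜) c)) (hno : ∀ v w, ¬ IsLine c v w)
    (hlow : HasLowFactors K 𝕜) (hquad : QuadraticallyClosedIn K 𝕜)
    (h2 : (2 : K) = 0) (hsq : ∀ x : K, ∃ r, r ^ 2 = x)
    (hB : ∀ y z z', F c y = 0 → D c y z = 0 → D c y z' = 0 → B c z z' y = 0)
    {y z₁ z₂ : Fin 5 → K} (hy : F c y = 0) (h1 : D c y z₁ = 0) (h2' : D c y z₂ = 0)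
    (hQ : D c z₂ y ≠ 0) (hi : ∀ t : K, Indep y (z₁ + t • z₂)) : False := by
  obtain ⟨e₁, e₂, e₃, m, hframe⟩ := exists_tangentFrame_residual p hs hno hlow hy h1 h2'
    (by simpa using hi 0)
  set R := residual (mapc C c) (C ∘ y) (C ∘ z₁ + (X : K[X]) • C ∘ z₂) with hR
  have hF := hframe.F_eq_zero
  let φ : K[X] →+* K[X] := (expand K 2 : K[X] →ₐ[K] K[X])
  have hφ : Function.Injective φ := expand_injective two_pos
  have hφc : mapc φ (mapc C c) = mapc C c := by
    funext i j k
    exact expand_C 2 _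
  have hBR : ∀ u u', D (mapc C c) R u = 0 → D (mapc C c) R u' = 0 →
      B (mapc C c) (φ ∘ u) (φ ∘ u') (φ ∘ R) = 0 := fun u u' hu hu' => by
    rw [← hφc, B_map, B_eq_zero_of_forall_eval hB hF hu hu', map_zero]
  have hframe' := hframe.map φ ((map_ne_zero_iff φ hφ).mpr hframe.det_ne_zero)
    ((map_ne_zero_iff φ hφ).mpr hframe.quadratic_ne_zero)
  rw [hφc] at hframe'
  have hDsq : ∀ u, ∃ r, D (mapc C c) (φ ∘ u) (φ ∘ R) = r ^ 2 := fun u => by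
    rw [← hφc, D_map]
    exact expand_two_eq_sq h2 hsq _
  obtain ⟨k, hk⟩ := hDsq e₁
  obtain ⟨g₂, hg₂⟩ := hDsq e₂
  obtain ⟨g₃, hg₃⟩ := hDsq e₃
  obtain ⟨f₂, f₃, hcone⟩ := hframe'.exists_coneFrame (by rw [← map_ofNat C 2, h2, map_zero])
    hk hg₂ hg₃ (hBR _ _ hframe.tangent₁ hframe.tangent₂) (hBR _ _ hframe.tangent₁ hframe.tangent₃)
    (hBR _ _ hframe.tangent₂ hframe.tangent₃)
  obtain ⟨v, w, a, b, hvw, -, hv, hw⟩ := hcone.exists_constant_line p hs hno hlow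
  obtain ⟨d, α, β, hd, hR'⟩ := hv.exchange hw (indep_C hvw.1)
  set ψ := algebraMap K 𝕜 with hψ
  have hmem : ∀ l : Fin 5 → 𝕜, l ⬝ᵥ v = 0 → l ⬝ᵥ w = 0 →
      l ⬝ᵥ (ψ ∘ y) = 0 ∧ l ⬝ᵥ (ψ ∘ z₂) = 0 := by
    intro l hlv hlw
    refine constant_functional_spec (c := mapc ψ c) (z₁ := ψ ∘ z₁) ?_
      (F_pencil_ne_zero hno hquad hy h1 h2' hQ hi) ?_
    · rw [D_map]; exact (_root_.map_ne_zero ψ).mpr hQ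
    · rw [← mapRingHom_residual, ← hR]
      have hcomm : mapRingHom ψ ∘ (φ ∘ R) =
          (expand 𝕜 2 : 𝕜[X] →+* 𝕜[X]) ∘ (mapRingHom ψ ∘ R) := by
        funext i
        exact map_expand
      have h0 := congrArg (fun u => (C ∘ l : Fin 5 → 𝕜[X]) ⬝ᵥ u) hR'
      simp only [dotProduct_smul, dotProduct_add, ← RingHom.map_dotProduct, hlv, hlw, map_zero,
        smul_zero, add_zero] at h0
      have h3 := (smul_eq_zero.mp h0).resolve_left hd
      refine expand_injective (R := 𝕜) two_pos ?_
      rw [map_zero, ← h3, hcomm]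
      have hl : (C ∘ l : Fin 5 → 𝕜[X]) = (expand 𝕜 2 : 𝕜[X] →+* 𝕜[X]) ∘ (C ∘ l) := by
        funext i
        exact (expand_C 2 _).symm
      nth_rw 2 [hl]
      exact RingHom.map_dotProduct (expand 𝕜 2 : 𝕜[X] →+* 𝕜[X]) _ _
  have hspan : ∀ u, (∀ l : Fin 5 → 𝕜, l ⬝ᵥ v = 0 → l ⬝ᵥ w = 0 → l ⬝ᵥ u = 0) →
      ∃ a b : 𝕜, a • v + b • w = u := fun u hu => by
    by_contra! h
    obtain ⟨l, hlv, hlw, hlu⟩ := exists_dotProduct_ne_zero h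
    exact hlu (hu l hlv hlw)
  obtain ⟨a₁, b₁, hy'⟩ := hspan (ψ ∘ y) fun l hlv hlw => (hmem l hlv hlw).1
  obtain ⟨a₂, b₂, hz'⟩ := hspan (ψ ∘ z₂) fun l hlv hlw => (hmem l hlv hlw).2
  have h0 := hvw.D_eq_zero a₂ b₂ a₁ b₁
  rw [hy', hz', D_map] at h0
  exact hQ ((map_eq_zero ψ).mp h0)

theorem exists_isLine_of_smooth (p : ℕ) [Fact p.Prime] [CharP 𝕜 p]
    (hs : Smooth (mapc (algebraMap K 𝕜) c)) (hlow : HasLowFactors K 𝕜)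
    (hquad : QuadraticallyClosedIn K 𝕜) (hsq : (2 : K) = 0 → ∀ x : K, ∃ r, r ^ 2 = x)
    {y : Fin 5 → K} (hy : F c y = 0) (hy0 : y ≠ 0) : ∃ v w, IsLine c v w := by
  by_contra! hno
  have hφ := (hs.of_mapc (algebraMap K 𝕜).injective).tangentForm_ne_zero hy hy0
  have hyy : D c y y = 0 := by rw [D_self, hy, mul_zero]
  obtain ⟨z₂, h2, hQ⟩ := exists_quadratic_ne_zero p hs hno hlow hy hy0
  obtain ⟨z₁, e, m, h1, -, -, hdet⟩ :=
    exists_basis_of_ker hφ hyy h2 (indep_of_quadratic_ne_zero hy hQ)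
  rw [tangentForm_apply] at h1
  have hi : ∀ t : K, Indep y (z₁ + t • z₂) := fun t a b hab => by
    obtain ⟨h0, -, hb, -, -⟩ := eq_zero_of_det_ne_zero hdet (r₀ := a) (r₁ := b * t) (r₂ := b)
      (r₃ := 0) (r₄ := 0) (by rw [← hab]; module)
    exact ⟨h0, hb⟩
  by_cases hchar : (2 : K) = 0
  · refine false_of_forall_B_eq_zero p hs hno hlow hquad hchar (hsq hchar) ?_ hy h1 h2 hQ hi
    by_contra! hB
    obtain ⟨y, z, z', hy, hz, hz', hB⟩ := hB
    have key : ∀ u u', D c y u = 0 → D c y u' = 0 → B c u u' y ≠ 0 → D c u' y ≠ 0 → False := by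
      intro u u' hu hu' hB hQ
      rw [B_swap₂₃] at hB
      refine false_of_directions p hs hno hlow hquad hy hu hu' hQ (fun t a b hab => ?_) (.inr hB)
      have hb := congrArg (B c · y u') hab
      have h0 : B c 0 y u' = 0 := by simpa using B_smul₁ c 0 0 y u'
      simp only [B_add₁, B_smul₁, B_diag₁₂, B_diag₁₃, hchar, zero_mul, mul_zero, add_zero, zero_add,
        h0] at hb
      have hb := (mul_eq_zero.mp hb).resolve_right hB
      rw [hb, zero_smul, add_zero] at hab
      refine ⟨(smul_eq_zero.mp hab).resolve_right ?_, hb⟩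
      rintro rfl
      exact hQ (D_zero_right _ _)
    have hB' : B c z' z y ≠ 0 := by rwa [B_swap₁₂]
    by_cases h : D c z' y = 0
    · by_cases h' : D c z y = 0
      · refine key z (z + z') hz (by rw [D_add_right, hz, hz', add_zero]) ?_ ?_
        · rwa [B_add₂, B_diag₁₂, hchar, zero_mul, zero_add]
        · rwa [D_add_left, h, h', add_zero, zero_add]
      · exact key z' z hz' hz hB' h'
    · exact key z z' hz hz' hB h
  · exact false_of_directions p hs hno hlow hquad hy h1 h2 hQ hi (.inl hchar)

end Main

end CubicLines

namespace CubicLines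

lemma exists_dvd_aeval {σ K : Type*} [Finite σ] [Field K] {f : MvPolynomial σ K} (hf : f ≠ 0)
    (g : σ → MvPolynomial σ K) : ∃ δ : MvPolynomial σ K, δ ≠ 0 ∧ f ∣ MvPolynomial.aeval g δ := by
  classical
  have := Fintype.ofFinite σ
  have hdep : ¬ AlgebraicIndependent K (fun o : Option σ => o.elim f g) := fun h => by
    have h1 := h.lift_cardinalMk_le_trdeg
    rw [MvPolynomial.trdeg_of_isDomain] at h1
    simp only [Cardinal.mk_fintype, Cardinal.lift_natCast, Nat.cast_le, Fintype.card_option] at h1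
    omega
  rw [algebraicIndependent_iff] at hdep
  push Not at hdep
  obtain ⟨P, hP, hP0⟩ := hdep
  have hev : ∀ P : MvPolynomial (Option σ) K, MvPolynomial.aeval (fun o => o.elim f g) P =
      Polynomial.eval₂ (MvPolynomial.aeval g : MvPolynomial σ K →ₐ[K] _).toRingHom f
        (MvPolynomial.optionEquivLeft K σ P) := fun P => by
    induction P using MvPolynomial.induction_on with
    | C a => simp [MvPolynomial.optionEquivLeft_C]
    | add p q hp hq => rw [map_add, map_add, Polynomial.eval₂_add, hp, hq]
    | mul_X p i hp =>
      rw [map_mul, map_mul, Polynomial.eval₂_mul, hp, MvPolynomial.aeval_X]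
      cases i <;> simp [MvPolynomial.optionEquivLeft_X_none, MvPolynomial.optionEquivLeft_X_some]
  obtain ⟨Q, hQ, hdvd⟩ := Polynomial.exists_eq_pow_rootMultiplicity_mul_and_not_dvd
    (MvPolynomial.optionEquivLeft K σ P) (by simpa using hP0) 0
  rw [hev, hQ, Polynomial.eval₂_mul] at hP
  simp only [map_zero, sub_zero, Polynomial.eval₂_pow, Polynomial.eval₂_X, mul_eq_zero] at hP
  have hQ0 := hP.resolve_left (pow_ne_zero _ hf)
  rw [map_zero, sub_zero, Polynomial.X_dvd_iff] at hdvd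
  refine ⟨Q.coeff 0, hdvd, ?_⟩
  rw [← Polynomial.divX_mul_X_add Q, Polynomial.eval₂_add, Polynomial.eval₂_mul,
    Polynomial.eval₂_X, Polynomial.eval₂_C] at hQ0
  exact ⟨-_, by rw [mul_neg, mul_comm]; exact eq_neg_of_add_eq_zero_right hQ0⟩

/-- The linear combination of the vectors `e` with coefficients `x`. -/
def linComb {ι κ A : Type*} [CommRing A] [Fintype κ] (e : κ → ι → A) (x : κ → A) : ι → A :=
  ∑ i, x i • e i

section Pullback

variable {ι κ A R : Type*} [Fintype ι] [CommRing A] [CommRing R]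

lemma T_sum₁ {κ : Type*} (c : ι → ι → ι → A) (s : Finset κ) (x : κ → A) (e : κ → ι → A)
    (v w : ι → A) :
    T c (∑ i ∈ s, x i • e i) v w = ∑ i ∈ s, x i * T c (e i) v w :=
  (map_sum (AddMonoidHom.mk' (fun u => T c u v w) (fun a b => T_add₁ c a b v w)) _ s).trans
    (Finset.sum_congr rfl fun _ _ => T_smul₁ c _ _ _ _)

lemma T_sum₂ {κ : Type*} (c : ι → ι → ι → A) (s : Finset κ) (x : κ → A) (e : κ → ι → A)
    (v w : ι → A) :
    T c v (∑ i ∈ s, x i • e i) w = ∑ i ∈ s, x i * T c v (e i) w :=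
  (map_sum (AddMonoidHom.mk' (fun u => T c v u w) (fun a b => T_add₂ c v a b w)) _ s).trans
    (Finset.sum_congr rfl fun _ _ => T_smul₂ c _ _ _ _)

lemma T_sum₃ {κ : Type*} (c : ι → ι → ι → A) (s : Finset κ) (x : κ → A) (e : κ → ι → A)
    (v w : ι → A) :
    T c v w (∑ i ∈ s, x i • e i) = ∑ i ∈ s, x i * T c v w (e i) :=
  (map_sum (AddMonoidHom.mk' (fun u => T c v w u) (fun a b => T_add₃ c v w a b)) _ s).trans
    (Finset.sum_congr rfl fun _ _ => T_smul₃ c _ _ _ _)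

/-- The trilinear form `c` evaluated at the vectors `e`. -/
def pullback (c : ι → ι → ι → A) (e : κ → ι → A) : κ → κ → κ → A :=
  fun i j k => T c (e i) (e j) (e k)

lemma mapc_pullback (c : ι → ι → ι → A) (e : κ → ι → A) (φ : A →+* R) :
    mapc φ (pullback c e) = pullback (mapc φ c) (fun i => φ ∘ e i) := by
  funext i j k
  exact (T_map c φ _ _ _).symm

end Pullback

section LinComb

variable {ι κ A : Type*} [CommRing A] [Fintype κ] (e : κ → ι → A)

lemma linComb_smul_add_smul (a b : A) (x y : κ → A) :
    linComb e (a • x + b • y) = a • linComb e x + b • linComb e y := by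
  simp only [linComb, Pi.add_apply, Pi.smul_apply, smul_eq_mul, add_smul, mul_smul,
    Finset.sum_add_distrib, Finset.smul_sum]

lemma linComb_single [DecidableEq κ] (i : κ) : linComb e (Pi.single i 1) = e i := by
  simp [linComb, Pi.single_apply]

end LinComb

section Pullback

variable {ι κ A : Type*} [Fintype ι] [CommRing A] [Fintype κ] (c : ι → ι → ι → A) (e : κ → ι → A)

lemma T_pullback (x y z : κ → A) :
    T (pullback c e) x y z = T c (linComb e x) (linComb e y) (linComb e z) := by
  simp only [linComb]
  rw [T_sum₁]
  simp only [T_sum₂]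
  simp only [T_sum₃, Finset.mul_sum]
  rw [T]
  refine Finset.sum_congr rfl fun i _ => Finset.sum_congr rfl fun j _ =>
    Finset.sum_congr rfl fun k _ => ?_
  rw [pullback]
  ring

lemma F_pullback (x : κ → A) : F (pullback c e) x = F c (linComb e x) := T_pullback c e x x x

lemma D_pullback (x y : κ → A) : D (pullback c e) x y = D c (linComb e x) (linComb e y) := by
  simp only [D, T_pullback]

variable {c e}

lemma IsLine.of_pullback (he : ∀ x : κ → A, linComb e x = 0 → x = 0) {v w : κ → A}
    (h : IsLine (pullback c e) v w) : IsLine c (linComb e v) (linComb e w) := by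
  obtain ⟨hi, h1, h2, h3, h4⟩ := h
  rw [F_pullback] at h1 h4
  rw [D_pullback] at h2 h3
  refine ⟨fun a b hab => hi a b (he _ ?_), h1, h2, h3, h4⟩
  rw [linComb_smul_add_smul, hab]

end Pullback

section Hyperplane

variable {K 𝕜 : Type*} [Field K] [Field 𝕜] [Algebra K 𝕜]

/-- A polynomial over `K` not vanishing on the dual variety of a smooth cubic. -/
lemma exists_polynomial_of_smooth {ι : Type*} [Fintype ι] [DecidableEq ι]
    {c : ι → ι → ι → K} (hF : ∃ x : ι → K, F c x ≠ 0) :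
    ∃ δ : MvPolynomial ι K, δ ≠ 0 ∧ ∀ x : ι → 𝕜, F (mapc (algebraMap K 𝕜) c) x = 0 →
      MvPolynomial.aeval (fun i => D (mapc (algebraMap K 𝕜) c) x (Pi.single i 1)) δ = 0 := by
  have hev : ∀ x : ι → 𝕜, mapc (algebraMap K 𝕜) c =
      mapc (MvPolynomial.aeval x : MvPolynomial ι K →ₐ[K] 𝕜).toRingHom (mapc MvPolynomial.C c) :=
    fun x => by
      funext i j k
      exact (MvPolynomial.aeval_C x _).symm
  have hX : ∀ x : ι → 𝕜, x =
      (MvPolynomial.aeval x : MvPolynomial ι K →ₐ[K] 𝕜).toRingHom ∘ MvPolynomial.X := fun x => by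
    funext i
    exact (MvPolynomial.aeval_X x i).symm
  obtain ⟨δ, hδ, hdvd⟩ := exists_dvd_aeval
    (f := F (mapc MvPolynomial.C c) (MvPolynomial.X : ι → MvPolynomial ι K)) (fun h0 => by
      obtain ⟨x, hx⟩ := hF
      refine hx ?_
      have h := congrArg (MvPolynomial.eval x) h0
      rw [← F_map, map_zero] at h
      rw [← h]
      congr 1
      · funext i j k
        exact (MvPolynomial.eval_C _).symm
      · funext i
        exact (MvPolynomial.eval_X i).symm)
    (fun i => D (mapc MvPolynomial.C c) MvPolynomial.X (Pi.single i 1))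
  refine ⟨δ, hδ, fun x hx => ?_⟩
  have hd := _root_.map_dvd (MvPolynomial.aeval x : MvPolynomial ι K →ₐ[K] 𝕜).toRingHom hdvd
  rw [← F_map, ← hev, ← hX, hx, zero_dvd_iff] at hd
  rw [← hd]
  change _ = MvPolynomial.aeval x (MvPolynomial.aeval _ δ)
  rw [MvPolynomial.comp_aeval_apply]
  congr 2
  funext i
  have : (Pi.single i 1 : ι → 𝕜) = (MvPolynomial.aeval x : MvPolynomial ι K →ₐ[K] 𝕜).toRingHom ∘
      (Pi.single i 1 : ι → MvPolynomial ι K) := by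
    funext j
    by_cases h : j = i
    · subst h; simp
    · simp [h]
  conv_lhs => rw [this, hev x]
  conv_lhs => enter [2]; rw [hX x]
  rw [D_map]
  rfl

end Hyperplane

section Hyperplane

variable {K : Type*} [Field K] [Infinite K]

lemma exists_F_ne_zero_of_smooth {ι : Type*} [Fintype ι] [Nonempty ι] {c : ι → ι → ι → K}
    (hs : Smooth c) : ∃ x : ι → K, F c x ≠ 0 := by
  classical
  by_contra! h
  obtain ⟨i⟩ := ‹Nonempty ι›
  have h0 : (Pi.single i 1 : ι → K) = 0 := hs _ (h _) fun y => by
    obtain ⟨t, ht⟩ := Infinite.exists_notMem_finset ({0, 1} : Finset K)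
    simp only [Finset.mem_insert, Finset.mem_singleton, not_or] at ht
    have h1 := h (Pi.single i 1 + y)
    have h2 := h (Pi.single i 1 + t • y)
    rw [F_add, h, h] at h1 h2
    rw [D_smul_left, D_smul_right] at h2
    have : t * (t - 1) * D c (Pi.single i 1) y = 0 := by linear_combination t ^ 2 * h1 - h2
    exact (mul_eq_zero.mp this).resolve_left (mul_ne_zero ht.1 (sub_ne_zero.mpr ht.2))
  simpa using congrFun h0 i

variable {𝕜 : Type*} [Field 𝕜] [IsAlgClosed 𝕜] [Algebra K 𝕜]

/-- The hyperplane with coefficients `ℓ`, parametrized by its first coordinates. -/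
def hyperplane {A : Type*} [CommRing A] {N : ℕ} (ℓ : Fin (N + 1) → A) (i : Fin N) :
    Fin (N + 1) → A :=
  Pi.single i.castSucc (ℓ (Fin.last N)) - Pi.single (Fin.last N) (ℓ i.castSucc)

lemma hyperplane_map {A R : Type*} [CommRing A] [CommRing R] {N : ℕ} (φ : A →+* R)
    (ℓ : Fin (N + 1) → A) (i : Fin N) : φ ∘ hyperplane ℓ i = hyperplane (φ ∘ ℓ) i := by
  funext j
  simp only [hyperplane, Function.comp_apply, Pi.sub_apply, map_sub, Pi.single_apply]
  split_ifs <;> simp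

lemma eq_zero_of_linComb_hyperplane {A : Type*} [CommRing A] [IsDomain A] {N : ℕ}
    {ℓ : Fin (N + 1) → A} (hℓ : ℓ (Fin.last N) ≠ 0) {x : Fin N → A}
    (hx : linComb (hyperplane ℓ) x = 0) : x = 0 := by
  funext i
  have h := congrFun hx i.castSucc
  simp only [linComb, hyperplane, Finset.sum_apply, Pi.smul_apply, Pi.sub_apply, Pi.single_apply,
    Fin.castSucc_inj, smul_eq_mul, Fin.castSucc_ne_last, if_false, sub_zero, mul_ite, mul_zero,
    Finset.sum_ite_eq, Finset.mem_univ, if_true, Pi.zero_apply] at h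
  exact (mul_eq_zero.mp h).resolve_right hℓ

/-- A smooth cubic over an infinite field has a smooth hyperplane section. -/
lemma exists_smooth_pullback {N : ℕ} {c : Fin (N + 1) → Fin (N + 1) → Fin (N + 1) → K}
    (hs : Smooth (mapc (algebraMap K 𝕜) c)) :
    ∃ e : Fin N → Fin (N + 1) → K, (∀ x : Fin N → K, linComb e x = 0 → x = 0) ∧
      Smooth (mapc (algebraMap K 𝕜) (pullback c e)) := by
  obtain ⟨δ, hδ, hdual⟩ := exists_polynomial_of_smooth (𝕜 := 𝕜)
    (exists_F_ne_zero_of_smooth (hs.of_mapc (algebraMap K 𝕜).injective))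
  obtain ⟨ℓ, hℓ⟩ : ∃ ℓ, MvPolynomial.eval ℓ (δ * MvPolynomial.X (Fin.last N)) ≠ 0 := by
    by_contra! h
    exact mul_ne_zero hδ (MvPolynomial.X_ne_zero _) (MvPolynomial.funext (by simpa using h))
  rw [map_mul, MvPolynomial.eval_X, mul_ne_zero_iff] at hℓ
  refine ⟨hyperplane ℓ, fun x => eq_zero_of_linComb_hyperplane hℓ.2, fun x hx hD => ?_⟩
  have hlast : (algebraMap K 𝕜 ∘ ℓ) (Fin.last N) ≠ 0 := by simpa using hℓ.2
  rw [mapc_pullback] at hx hD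
  simp only [hyperplane_map] at hx hD
  rw [F_pullback] at hx
  simp only [D_pullback] at hD
  set u := linComb (hyperplane (algebraMap K 𝕜 ∘ ℓ)) x with hu
  by_contra hx0
  have hu0 : u ≠ 0 := fun h => hx0 (eq_zero_of_linComb_hyperplane hlast h)
  set g : Fin (N + 1) → 𝕜 := fun i => D (mapc (algebraMap K 𝕜) c) u (Pi.single i 1) with hg
  have hDg : ∀ y, D (mapc (algebraMap K 𝕜) c) u y = g ⬝ᵥ y := fun y => D_eq_dotProduct _ u y
  set r := g (Fin.last N) / (algebraMap K 𝕜 ∘ ℓ) (Fin.last N) with hr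
  have hgr : g = r • (algebraMap K 𝕜 ∘ ℓ) := by
    funext i
    rw [Pi.smul_apply, smul_eq_mul, hr, div_mul_eq_mul_div, eq_div_iff hlast]
    refine Fin.lastCases (by ring) (fun i => ?_) i
    have h := hD (Pi.single i 1)
    rw [linComb_single, hDg, hyperplane, dotProduct_sub, dotProduct_single,
      dotProduct_single] at h
    exact sub_eq_zero.mp h
  have hr0 : r ≠ 0 := fun h => hu0 (hs u hx fun y => by rw [hDg, hgr, h]; simp)
  obtain ⟨μ, hμ⟩ := IsAlgClosed.exists_pow_nat_eq r⁻¹ (n := 2) two_pos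
  refine hℓ.1 ((algebraMap K 𝕜).injective ?_)
  have h := hdual (μ • u) (by rw [F_smul, hx, mul_zero])
  rw [map_zero, ← h, ← MvPolynomial.coe_aeval_eq_eval]
  change algebraMap K 𝕜 (MvPolynomial.aeval ℓ δ) = _
  rw [← MvPolynomial.aeval_algebraMap_apply]
  congr 2
  funext i
  rw [D_smul_left]
  change algebraMap K 𝕜 (ℓ i) = μ ^ 2 * g i
  rw [hgr, hμ, Pi.smul_apply, smul_eq_mul, inv_mul_cancel_left₀ hr0]
  rfl

/-- If smooth cubics in `N` variables over an infinite field contain a line, so do smooth cubics in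
more variables. -/
lemma exists_isLine_of_le {N : ℕ}
    (h : ∀ c : Fin N → Fin N → Fin N → K, Smooth (mapc (algebraMap K 𝕜) c) →
      ∃ v w, IsLine c v w) {n : ℕ} (hn : N ≤ n) (c : Fin n → Fin n → Fin n → K)
    (hs : Smooth (mapc (algebraMap K 𝕜) c)) : ∃ v w, IsLine c v w := by
  induction n, hn using Nat.le_induction with
  | base => exact h c hs
  | succ n _ ih =>
    obtain ⟨e, he, hse⟩ := exists_smooth_pullback hs
    obtain ⟨v, w, hvw⟩ := ih _ hse
    exact ⟨_, _, hvw.of_pullback he⟩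

end Hyperplane

section Dictionary

open MvPolynomial

variable {σ R A : Type*} [Fintype σ] [CommRing R] [CommRing A] [Algebra R A]

lemma exists_eq_F {f : MvPolynomial σ R} (hf : f.IsHomogeneous 3) :
    ∃ c : σ → σ → σ → R, f = F (mapc C c) X := by
  classical
  rw [← support_sum_monomial_coeff f]
  refine Finset.sum_induction _ (fun g => ∃ c : σ → σ → σ → R, g = F (mapc C c) X) ?_ ?_ ?_
  · rintro _ _ ⟨c, rfl⟩ ⟨c', rfl⟩
    refine ⟨c + c', ?_⟩
    simp only [F, T, mapc, ← Finset.sum_add_distrib, Pi.add_apply, map_add, add_mul]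
  · exact ⟨0, by simp [F, T, mapc]⟩
  · intro d hd
    have hdeg : Multiset.card (Finsupp.toMultiset d) = 3 := by
      rw [Finsupp.card_toMultiset]
      exact (congrArg (fun φ => φ d) Finsupp.degree_eq_weight_one).trans
        (hf (mem_support_iff.mp hd))
    obtain ⟨x, y, z, h⟩ := Multiset.card_eq_three.mp hdeg
    have hd' : d = Finsupp.single x 1 + Finsupp.single y 1 + Finsupp.single z 1 := by
      apply (Finsupp.orderIsoMultiset (ι := σ)).injective
      rw [Finsupp.coe_orderIsoMultiset, h]
      simp only [map_add, Finsupp.toMultiset_single, one_smul]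
      rfl
    refine ⟨Pi.single x (Pi.single y (Pi.single z (coeff d f))), ?_⟩
    have hmon : ∀ a : R, monomial d a = C a * X x * X y * X z := fun a => by
      rw [hd', C_mul_X_eq_monomial, X, monomial_mul, X, monomial_mul, mul_one, mul_one]
    rw [hmon, F, T, Finset.sum_eq_single x, Finset.sum_eq_single y, Finset.sum_eq_single z]
    · simp [mapc]
    all_goals simp +contextual [mapc, Pi.single_apply]

lemma aeval_F (c : σ → σ → σ → R) (x : σ → A) :
    aeval x (F (mapc C c) X) = F (mapc (algebraMap R A) c) x := by
  refine (F_map (mapc C c) (aeval x : MvPolynomial σ R →ₐ[R] A).toRingHom X).symm.trans ?_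
  congr 1
  · funext i j k
    exact aeval_C x _
  · funext i
    exact aeval_X x i

lemma pderiv_F [DecidableEq σ] (c : σ → σ → σ → R) (i : σ) :
    pderiv i (F (mapc C c) X) = D (mapc C c) X (Pi.single i 1) := by
  simp only [F, D, T, map_sum, ← Finset.sum_add_distrib]
  refine Finset.sum_congr rfl fun j _ => Finset.sum_congr rfl fun k _ =>
    Finset.sum_congr rfl fun l _ => ?_
  simp only [mapc, pderiv_mul, pderiv_C, pderiv_X]
  ring

lemma aeval_pderiv_F [DecidableEq σ] (c : σ → σ → σ → R) (i : σ) (x : σ → A) :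
    aeval x (pderiv i (F (mapc C c) X)) = D (mapc (algebraMap R A) c) x (Pi.single i 1) := by
  rw [pderiv_F]
  refine (D_map (mapc C c) (aeval x : MvPolynomial σ R →ₐ[R] A).toRingHom X _).symm.trans ?_
  congr 1
  · funext i j k
    exact aeval_C x _
  · funext i
    exact aeval_X x i
  · funext j
    by_cases h : j = i
    · subst h; simp
    · simp [h]

lemma smooth_of_aeval {c : σ → σ → σ → R}
    (h : ¬ ∃ x : σ → A, x ≠ 0 ∧ aeval x (F (mapc C c) X) = 0 ∧
      ∀ i, aeval x (pderiv i (F (mapc C c) X)) = 0) : Smooth (mapc (algebraMap R A) c) := by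
  classical
  intro x hx hD
  by_contra hx0
  exact h ⟨x, hx0, by rw [aeval_F, hx], fun i => by rw [aeval_pderiv_F, hD]⟩

end Dictionary

lemma IsLine.aeval_eq_zero {σ K L : Type*} [Fintype σ] [Field K] [Field L] [Algebra K L]
    {c : σ → σ → σ → K} {v w : σ → L} (h : IsLine (mapc (algebraMap K L) c) v w) :
    LinearIndependent L ![v, w] ∧ ∀ s t : L,
      MvPolynomial.aeval (fun i => s * v i + t * w i) (F (mapc MvPolynomial.C c) MvPolynomial.X)
        = 0 :=
  ⟨LinearIndependent.pair_iff.mpr h.1, fun s t => by rw [aeval_F]; exact h.F_eq_zero s t⟩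

end CubicLines

namespace CubicLines

open Polynomial

lemma exists_zero_of_finite {E ι : Type*} [Field E] [Finite E] [Fintype ι]
    (c : ι → ι → ι → E) (hι : 3 < Fintype.card ι) : ∃ y : ι → E, F c y = 0 ∧ y ≠ 0 := by
  classical
  have := Fintype.ofFinite E
  obtain ⟨p, hp⟩ := CharP.exists E
  have hp' : Fact p.Prime := ⟨CharP.char_is_prime E p⟩
  have hdeg : (F (mapc MvPolynomial.C c) MvPolynomial.X : MvPolynomial ι E).IsHomogeneous 3 :=
    MvPolynomial.IsHomogeneous.sum _ _ _ fun i _ => MvPolynomial.IsHomogeneous.sum _ _ _ fun j _ =>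
      MvPolynomial.IsHomogeneous.sum _ _ _ fun k _ =>
        (((MvPolynomial.isHomogeneous_C _ _).mul (MvPolynomial.isHomogeneous_X _ _)).mul
          (MvPolynomial.isHomogeneous_X _ _)).mul (MvPolynomial.isHomogeneous_X _ _)
  have hdvd := char_dvd_card_solutions p (hdeg.totalDegree_le.trans_lt hι)
  have hev : ∀ y : ι → E, MvPolynomial.eval y (F (mapc MvPolynomial.C c) MvPolynomial.X) = F c y :=
    fun y => by
      rw [← MvPolynomial.coe_aeval_eq_eval]
      exact aeval_F c y
  simp only [hev] at hdvd
  have h0 : 0 < Fintype.card {y : ι → E // F c y = 0} := Fintype.card_pos_iff.mpr ⟨0, F_zero c⟩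
  have h1 := hp'.out.two_le.trans (Nat.le_of_dvd h0 hdvd)
  obtain ⟨y, hy⟩ := Fintype.exists_ne_of_one_lt_card h1 ⟨0, F_zero c⟩
  exact ⟨y, y.2, fun h => hy (Subtype.ext h)⟩

section FixedField

variable (𝔽 𝕜 : Type*) [Field 𝔽] [Fintype 𝔽] [Field 𝕜] [Algebra 𝔽 𝕜]

/-- The subfield of `𝕜` fixed by the `m`-th power of the Frobenius over `𝔽`. -/
def frobeniusFixed (m : ℕ) : IntermediateField 𝔽 𝕜 :=
  (AlgHom.equalizer (FiniteField.frobeniusAlgHom 𝔽 𝕜 ^ m) (AlgHom.id 𝔽 𝕜)).toIntermediateField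
    fun x hx => by
      rw [AlgHom.mem_equalizer] at hx ⊢
      rw [map_inv₀, hx]
      rfl

variable {𝔽 𝕜}

lemma mem_frobeniusFixed {m : ℕ} {x : 𝕜} :
    x ∈ frobeniusFixed 𝔽 𝕜 m ↔ x ^ Fintype.card 𝔽 ^ m = x := by
  change (FiniteField.frobeniusAlgHom 𝔽 𝕜 ^ m) x = x ↔ _
  rw [AlgHom.coe_pow, FiniteField.coe_frobeniusAlgHom, pow_iterate]

variable [IsAlgClosed 𝕜] {m : ℕ}

lemma card_frobeniusFixed (hm : m ≠ 0) : Nat.card (frobeniusFixed 𝔽 𝕜 m) = Fintype.card 𝔽 ^ m := by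
  classical
  obtain ⟨p, hp⟩ := CharP.exists 𝔽
  have := charP_of_injective_algebraMap (algebraMap 𝔽 𝕜).injective p
  have hdvd : p ∣ Fintype.card 𝔽 ^ m := dvd_pow ((CharP.cast_eq_zero_iff 𝔽 p _).mp (by simp)) hm
  have hdeg : (X ^ Fintype.card 𝔽 ^ m - X : 𝕜[X]).natDegree = Fintype.card 𝔽 ^ m :=
    FiniteField.X_pow_card_pow_sub_X_natDegree_eq 𝕜 hm Fintype.one_lt_card
  have h := card_rootSet_eq_natDegree (K := 𝕜) (galois_poly_separable (K := 𝕜) p _ hdvd)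
    (IsAlgClosed.splits _)
  rw [hdeg, ← Nat.card_eq_fintype_card] at h
  rw [← h]
  refine Nat.card_congr (Equiv.setCongr ?_)
  ext x
  have h0 : (X ^ Fintype.card 𝔽 ^ m - X : 𝕜[X]) ≠ 0 := fun h0 => by
    rw [h0, natDegree_zero] at hdeg
    exact (pow_pos Fintype.card_pos m).ne hdeg
  rw [SetLike.mem_coe, mem_frobeniusFixed, mem_rootSet]
  simp [h0, sub_eq_zero]

lemma finite_frobeniusFixed (hm : m ≠ 0) : Finite (frobeniusFixed 𝔽 𝕜 m) :=
  Nat.finite_of_card_ne_zero (by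
    rw [card_frobeniusFixed hm]
    exact pow_ne_zero m Fintype.card_ne_zero)

lemma finrank_frobeniusFixed (hm : m ≠ 0) : Module.finrank 𝔽 (frobeniusFixed 𝔽 𝕜 m) = m := by
  have := finite_frobeniusFixed (𝔽 := 𝔽) (𝕜 := 𝕜) hm
  have h := Module.natCard_eq_pow_finrank (K := 𝔽) (V := frobeniusFixed 𝔽 𝕜 m)
  rw [card_frobeniusFixed hm, Nat.card_eq_fintype_card] at h
  exact (Nat.pow_right_injective Fintype.one_lt_card h).symm

end FixedField

variable {𝔽 𝕜 : Type*} [Field 𝔽] [Fintype 𝔽] [Field 𝕜] [Algebra 𝔽 𝕜]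

/-- A point fixed by the sixth power of Frobenius is quadratic over the field fixed by the third
power. -/
lemma exists_quadratic_of_fixed {θ : 𝕜} (hθ : θ ^ Fintype.card 𝔽 ^ 6 = θ) :
    ∃ m₁ m₀ : frobeniusFixed 𝔽 𝕜 3,
      θ ^ 2 + algebraMap _ 𝕜 m₁ * θ + algebraMap _ 𝕜 m₀ = 0 := by
  set σ := FiniteField.frobeniusAlgHom 𝔽 𝕜 ^ 3 with hσ
  have h2 : σ (σ θ) = θ := by
    rw [hσ, ← AlgHom.mul_apply, ← pow_add]
    rw [← mem_frobeniusFixed] at hθ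
    exact hθ
  have hmem : ∀ x, σ x = x → x ∈ frobeniusFixed 𝔽 𝕜 3 := fun x hx => hx
  refine ⟨⟨-(θ + σ θ), hmem _ ?_⟩, ⟨θ * σ θ, hmem _ ?_⟩, ?_⟩
  · rw [map_neg, map_add, h2, add_comm]
  · rw [_root_.map_mul, h2, mul_comm]
  · change θ ^ 2 + -(θ + σ θ) * θ + θ * σ θ = 0
    ring

variable {c : Fin 5 → Fin 5 → Fin 5 → 𝔽}

lemma exists_tangentLine_of_root {y z₁ z₂ : Fin 5 → 𝔽} (hy : F c y = 0)
    (hD : ∀ a b : 𝔽, D c y (a • z₁ + b • z₂) = 0) (hQ : ∀ a b : 𝔽, D c (a • z₁ + b • z₂) y = 0)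
    {z₃ m : Fin 5 → 𝔽} (hdet : (Matrix.of ![y, z₁, z₂, z₃, m]).det ≠ 0)
    {θ : 𝕜} (hθ : θ ^ Fintype.card 𝔽 ^ 6 = θ) (hF : F (mapc (algebraMap 𝔽 𝕜) c)
      (algebraMap 𝔽 𝕜 ∘ z₁ + θ • algebraMap 𝔽 𝕜 ∘ z₂) = 0) :
    ∃ v w, IsLine (mapc (algebraMap 𝔽 (frobeniusFixed 𝔽 𝕜 3)) c) v w := by
  obtain ⟨m₁, m₀, hm⟩ := exists_quadratic_of_fixed hθ
  set ψ := algebraMap 𝔽 𝕜 with hψ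
  have hD₁ : D c y z₁ = 0 := by simpa using hD 1 0
  have hD₂ : D c y z₂ = 0 := by simpa using hD 0 1
  have hQ₁ : D c z₁ y = 0 := by simpa using hQ 1 0
  have hQ₂ : D c z₂ y = 0 := by simpa using hQ 0 1
  have hB : B c z₁ z₂ y = 0 := by
    have h := hQ 1 1
    rwa [one_smul, one_smul, D_add_left, hQ₁, hQ₂, zero_add, add_zero] at h
  suffices h : TangentLine (mapc (algebraMap 𝔽 (frobeniusFixed 𝔽 𝕜 3)) c) (algebraMap 𝔽 _ ∘ y) by
    obtain ⟨v, w, hl, -⟩ := h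
    exact ⟨v, w, hl⟩
  refine tangentLine_of_quadratic_direction (L := 𝕜) (z₁ := algebraMap 𝔽 _ ∘ z₁)
    (z₂ := algebraMap 𝔽 _ ∘ z₂) hm rfl ?_ (by rw [F_map, hy, map_zero]) ?_ ?_ hF
  · intro a b hab
    change a • ψ ∘ y + b • (ψ ∘ z₁ + θ • ψ ∘ z₂) = 0 at hab
    obtain ⟨h1, h2, -⟩ := eq_zero_of_det_ne_zero (det_comp_ne_zero ψ.injective hdet)
      (r₀ := a) (r₁ := b) (r₂ := b * θ) (r₃ := 0) (r₄ := 0) (by rw [← hab]; module)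
    exact ⟨h1, h2⟩
  · change D (mapc ψ c) (ψ ∘ y) (ψ ∘ z₁ + θ • ψ ∘ z₂) = 0
    rw [D_add_right, D_smul_right, D_map, D_map, hD₁, hD₂, map_zero, mul_zero, add_zero]
  · change D (mapc ψ c) (ψ ∘ z₁ + θ • ψ ∘ z₂) (ψ ∘ y) = 0
    rw [D_add_left, D_smul_left, B_smul₂, B_map, D_map, D_map, hQ₁, hQ₂, hB]
    simp

variable [IsAlgClosed 𝕜]

lemma exists_fixed_root_of_dvd {g h : 𝔽[X]} (hh : Irreducible h) (hd : h.natDegree ∣ 6)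
    (hg : h ∣ g) : ∃ θ : 𝕜, θ ^ Fintype.card 𝔽 ^ 6 = θ ∧ aeval θ g = 0 := by
  have hroot := hh.natDegree_dvd_iff_dvd_X_pow_card_pow_sub_X.mp hd
  obtain ⟨θ, hθ⟩ := IsAlgClosed.exists_aeval_eq_zero 𝕜 h hh.degree_pos.ne'
  refine ⟨θ, ?_, aeval_eq_zero_of_dvd_aeval_eq_zero hg hθ⟩
  have := aeval_eq_zero_of_dvd_aeval_eq_zero hroot hθ
  rw [Nat.card_eq_fintype_card] at this
  simpa [sub_eq_zero] using this

/-- A polynomial of degree 3 or 6 over a finite field has a root of degree dividing 6. -/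
lemma exists_fixed_root {g : 𝔽[X]} (hg : g.natDegree = 3 ∨ g.natDegree = 6) :
    ∃ θ : 𝕜, θ ^ Fintype.card 𝔽 ^ 6 = θ ∧ aeval θ g = 0 := by
  have key : ∀ k : 𝔽[X], k.natDegree ≠ 0 → ∃ h, Irreducible h ∧ h ∣ k := fun k hk =>
    WfDvdMonoid.exists_irreducible_factor (fun hu => hk (natDegree_eq_zero_of_isUnit hu))
      (fun h0 => hk (by rw [h0, natDegree_zero]))
  obtain ⟨h, hh, k, rfl⟩ := key g (by omega)
  have hk0 : k ≠ 0 := by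
    rintro rfl
    rw [mul_zero, natDegree_zero] at hg
    omega
  rw [natDegree_mul hh.ne_zero hk0] at hg
  have hpos := hh.natDegree_pos
  by_cases hd : h.natDegree ∣ 6
  · exact exists_fixed_root_of_dvd hh hd (dvd_mul_right h k)
  · have hk : k.natDegree = 1 ∨ k.natDegree = 2 := by
      have : h.natDegree ≤ 6 := by omega
      interval_cases h.natDegree <;> omega
    obtain ⟨h', hh', hdvd⟩ := key k (by omega)
    have h1 := natDegree_le_of_dvd hdvd hk0
    have h2 := hh'.natDegree_pos
    refine exists_fixed_root_of_dvd hh' ?_ (hdvd.trans (dvd_mul_left k h))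
    have h3 : h'.natDegree = 1 ∨ h'.natDegree = 2 := by omega
    rcases h3 with h3 | h3 <;> rw [h3] <;> norm_num

lemma exists_isLine_of_eckardt {y z₁ z₂ z₃ m : Fin 5 → 𝔽} (hy : F c y = 0)
    (hD : ∀ a b : 𝔽, D c y (a • z₁ + b • z₂) = 0) (hQ : ∀ a b : 𝔽, D c (a • z₁ + b • z₂) y = 0)
    (hdet : (Matrix.of ![y, z₁, z₂, z₃, m]).det ≠ 0) :
    ∃ v w, IsLine (mapc (algebraMap 𝔽 (frobeniusFixed 𝔽 𝕜 3)) c) v w := by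
  obtain ⟨hle, hcoeff⟩ := F_pencil_natDegree_le_and_coeff c z₁ z₂
  by_cases hF : F c z₂ = 0
  · have hdet' : (Matrix.of ![y, z₂, z₁, z₃, m]).det ≠ 0 := det_ne_zero_of_forall
      fun r₀ r₁ r₂ r₃ r₄ hr => by
        obtain ⟨h0, h1, h2, h3, h4⟩ := eq_zero_of_det_ne_zero hdet (r₀ := r₀) (r₁ := r₂)
          (r₂ := r₁) (r₃ := r₃) (r₄ := r₄) (by rw [← hr]; module)
        exact ⟨h0, h2, h1, h3, h4⟩
    refine exists_tangentLine_of_root hy (fun a b => by rw [add_comm]; exact hD b a)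
      (fun a b => by rw [add_comm]; exact hQ b a) hdet' (θ := (0 : 𝕜)) (by simp) ?_
    rw [zero_smul, add_zero, F_map, hF, map_zero]
  · obtain ⟨θ, hθ, h0⟩ := exists_fixed_root (𝕜 := 𝕜)
      (Or.inl (le_antisymm hle (le_natDegree_of_ne_zero (by rwa [hcoeff]))))
    refine exists_tangentLine_of_root hy hD hQ hdet hθ ?_
    exact (map_F_pencil (Φ := (aeval θ : 𝔽[X] →ₐ[𝔽] 𝕜).toRingHom) (fun a => aeval_C θ a)
      (aeval_X θ) z₁ z₂).symm.trans h0

lemma TangentFrame.exists_isLine {y e₁ e₂ e₃ m : Fin 5 → 𝔽} (h : TangentFrame c y e₁ e₂ e₃ m) :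
    ∃ v w, IsLine (mapc (algebraMap 𝔽 (frobeniusFixed 𝔽 𝕜 3)) c) v w := by
  have key : ∀ {e₂ e₃ : Fin 5 → 𝔽}, TangentFrame c y e₁ e₂ e₃ m → ∀ θ : 𝕜,
      θ ^ Fintype.card 𝔽 ^ 6 = θ →
      res (mapc (algebraMap 𝔽 𝕜) c) (algebraMap 𝔽 𝕜 ∘ y) (algebraMap 𝔽 𝕜 ∘ e₁)
        (algebraMap 𝔽 𝕜 ∘ e₂ + θ • algebraMap 𝔽 𝕜 ∘ e₃) = 0 →
      ∃ v w, IsLine (mapc (algebraMap 𝔽 (frobeniusFixed 𝔽 𝕜 3)) c) v w := by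
    intro e₂ e₃ h θ hθ hres
    obtain ⟨m₁, m₀, hm⟩ := exists_quadratic_of_fixed hθ
    have hinj := (algebraMap 𝔽 (frobeniusFixed 𝔽 𝕜 3)).injective
    obtain ⟨v, w, hl, -⟩ := (h.map (algebraMap 𝔽 (frobeniusFixed 𝔽 𝕜 3))
      ((map_ne_zero_iff _ hinj).mpr h.det_ne_zero)
      ((map_ne_zero_iff _ hinj).mpr h.quadratic_ne_zero)).tangentLine hm hres
    exact ⟨v, w, hl⟩
  obtain ⟨hle, hcoeff⟩ := res_natDegree_le_and_coeff c y e₁ e₂ e₃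
  by_cases h6 : res c y e₁ e₃ = 0
  · refine key h.swap 0 (by simp) ?_
    rw [zero_smul, add_zero, res_map, h6, map_zero]
  · obtain ⟨θ, hθ, h0⟩ := exists_fixed_root (𝕜 := 𝕜)
      (Or.inr (le_antisymm hle (le_natDegree_of_ne_zero (by rwa [hcoeff]))))
    refine key h θ hθ ?_
    exact (map_res_pencil (Φ := (aeval θ : 𝔽[X] →ₐ[𝔽] 𝕜).toRingHom) (fun a => aeval_C θ a)
      (aeval_X θ) y e₁ e₂ e₃).symm.trans h0

lemma exists_basis_mem_ker {φ : (Fin 5 → 𝔽) →ₗ[𝔽] 𝔽} {v w : Fin 5 → 𝔽} (hv : φ v = 0)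
    (hw : φ w = 0) (h : Indep v w) :
    ∃ e₂ e₃ m, φ e₂ = 0 ∧ φ e₃ = 0 ∧ (Matrix.of ![v, w, e₂, e₃, m]).det ≠ 0 := by
  by_cases hφ : φ = 0
  · obtain ⟨M, rfl, rfl, hM⟩ := exists_det_ne_zero_of_indep h
    refine ⟨M 2, M 3, M 4, by rw [hφ, LinearMap.zero_apply], by rw [hφ, LinearMap.zero_apply], ?_⟩
    convert hM
    ext i j
    fin_cases i <;> rfl
  · obtain ⟨e₂, e₃, m, h2, h3, -, hdet⟩ := exists_basis_of_ker hφ hv hw h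
    exact ⟨e₂, e₃, m, h2, h3, hdet⟩

variable (𝕜 c)

/-- A cubic threefold over a finite field contains a line over the cubic extension. -/
theorem exists_isLine_frobeniusFixed_three :
    ∃ v w, IsLine (mapc (algebraMap 𝔽 (frobeniusFixed 𝔽 𝕜 3)) c) v w := by
  obtain ⟨y, hy, hy0⟩ := exists_zero_of_finite c (by simp)
  have hyy : tangentForm c y y = 0 := by rw [tangentForm_apply, D_self, hy, mul_zero]
  by_cases hE : ∃ z, D c y z = 0 ∧ D c z y ≠ 0
  · obtain ⟨e₁, h1, hκ⟩ := hE
    obtain ⟨e₂, e₃, m, h2, h3, hdet⟩ := exists_basis_mem_ker (φ := tangentForm c y) hyy h1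
      (indep_of_quadratic_ne_zero hy hκ)
    exact TangentFrame.exists_isLine ⟨hdet, hy, h1, h2, h3, hκ⟩
  · push Not at hE
    obtain ⟨z₁, h1, hi⟩ := exists_indep_mem_ker (φ := tangentForm c y) hyy hy0
    obtain ⟨z₂, z₃, m, h2, -, hdet⟩ := exists_basis_mem_ker (φ := tangentForm c y) hyy h1 hi
    rw [tangentForm_apply] at h1 h2
    have hD : ∀ a b : 𝔽, D c y (a • z₁ + b • z₂) = 0 := fun a b => by
      rw [D_add_right, D_smul_right, D_smul_right, h1, h2, mul_zero, mul_zero, add_zero]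
    exact exists_isLine_of_eckardt hy hD (fun a b => hE _ (hD a b)) hdet

end CubicLines

namespace CubicLines

lemma IsLine.of_comp {ι A R : Type*} [Fintype ι] [CommRing A] [CommRing R] {φ : A →+* R}
    (hφ : Function.Injective φ) {c : ι → ι → ι → A} {v w : ι → A}
    (h : IsLine (mapc φ c) (φ ∘ v) (φ ∘ w)) : IsLine c v w := by
  obtain ⟨hi, h1, h2, h3, h4⟩ := h
  rw [F_map, map_eq_zero_iff φ hφ] at h1 h4
  rw [D_map, map_eq_zero_iff φ hφ] at h2 h3
  refine ⟨fun a b hab => ?_, h1, h2, h3, h4⟩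
  obtain ⟨ha, hb⟩ := hi (φ a) (φ b) (by rw [← comp_smul, ← comp_smul, ← comp_add, hab, comp_zero])
  exact ⟨(map_eq_zero_iff φ hφ).mp ha, (map_eq_zero_iff φ hφ).mp hb⟩

section Quadratic

variable {𝕜 : Type*} [Field 𝕜] {p : ℕ} [Fact p.Prime] [CharP 𝕜 p] {a : ℕ}

lemma quadraticallyClosedIn_coprimeField : QuadraticallyClosedIn (coprimeField 𝕜 p a) 𝕜 := by
  intro b₁ b₀ x hx
  obtain ⟨m, hm, hb⟩ := exists_common_exponent (p := p) (a := a) Finset.univ ![(b₁ : 𝕜), b₀]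
    (by simp [Fin.forall_fin_two])
  simp only [Finset.mem_univ, forall_true_left, Fin.forall_fin_two, Matrix.cons_val_zero,
    Matrix.cons_val_one] at hb
  refine ⟨⟨x, m * 2, fun h => (Nat.prime_three.dvd_mul.mp h).elim hm (by norm_num), ?_⟩, rfl⟩
  set σ := iterateFrobenius 𝕜 p (a * m) with hσ
  have hσx (x : 𝕜) : σ x = x ^ p ^ (a * m) := iterateFrobenius_def p (a * m) x
  simp only [← hσx] at hb
  change x ^ 2 + b₁ * x + b₀ = 0 at hx
  have hx' := congrArg σ hx
  simp only [map_add, map_mul, map_pow, hb, map_zero] at hx'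
  have h0 : (σ x - x) * (σ x + x + b₁) = 0 := by linear_combination hx' - hx
  have h1 : σ (σ x) = x := by
    rcases mul_eq_zero.mp h0 with h | h
    · rw [sub_eq_zero.mp h, sub_eq_zero.mp h]
    · have h2 := congrArg σ h
      simp only [map_add, hb, map_zero] at h2
      linear_combination h2 - h
  rwa [← mul_assoc, mul_two, pow_add, pow_mul, ← iterateFrobenius_def, ← iterateFrobenius_def]

lemma exists_sq_eq_coprimeField [IsAlgClosed 𝕜] (x : coprimeField 𝕜 p a) :
    ∃ r, r ^ 2 = x := by
  obtain ⟨r, hr⟩ := IsAlgClosed.exists_pow_nat_eq (x : 𝕜) (n := 2) two_pos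
  obtain ⟨r, rfl⟩ := quadraticallyClosedIn_coprimeField (0 : coprimeField 𝕜 p a) (-x) r (by
    rw [map_zero, map_neg, hr]
    change (x : 𝕜) + 0 * r + -x = 0
    ring)
  exact ⟨r, Subtype.ext hr⟩

end Quadratic

section FiniteField

variable {𝔽 𝕜 : Type*} [Field 𝔽] [Fintype 𝔽] [Field 𝕜] [Algebra 𝔽 𝕜] {p : ℕ}
  [Fact p.Prime] [CharP 𝕜 p] {a m : ℕ}

/-- The inclusion of the field fixed by the `m`-th power of Frobenius, for `m` prime to 3. -/
def toCoprimeField (hq : Fintype.card 𝔽 = p ^ a) (hm : ¬ 3 ∣ m) :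
    frobeniusFixed 𝔽 𝕜 m →+* coprimeField 𝕜 p a :=
  (algebraMap (frobeniusFixed 𝔽 𝕜 m) 𝕜).codRestrict (coprimeField 𝕜 p a) fun x =>
    ⟨m, hm, by
      rw [pow_mul, ← hq]
      exact mem_frobeniusFixed.mp x.2⟩

lemma exists_toCoprimeField_comp_eq {ι : Type*} [Fintype ι] (hq : Fintype.card 𝔽 = p ^ a)
    (v : ι → coprimeField 𝕜 p a) :
    ∃ (m : ℕ) (hm : ¬ 3 ∣ m) (v' : ι → frobeniusFixed 𝔽 𝕜 m), toCoprimeField hq hm ∘ v' = v := by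
  obtain ⟨m, hm, h⟩ := exists_common_exponent Finset.univ (fun i => (v i : 𝕜)) (fun i _ => (v i).2)
  refine ⟨m, hm, fun i => ⟨v i, mem_frobeniusFixed.mpr ?_⟩, rfl⟩
  rw [hq, ← pow_mul]
  exact h i (Finset.mem_univ i)

variable [IsAlgClosed 𝕜]

lemma infinite_coprimeField (hq : Fintype.card 𝔽 = p ^ a) : Infinite (coprimeField 𝕜 p a) := by
  by_contra hfin
  rw [not_infinite_iff_finite] at hfin
  set N := Nat.card (coprimeField 𝕜 p a)
  have hN : ¬ 3 ∣ 3 * N + 1 := by omega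
  have h := Nat.card_le_card_of_injective _ (toCoprimeField (𝕜 := 𝕜) hq hN).injective
  rw [card_frobeniusFixed (Nat.succ_ne_zero _)] at h
  have := Nat.lt_pow_self (n := 3 * N + 1) (Fintype.one_lt_card (α := 𝔽))
  have h' : Fintype.card 𝔽 ^ (3 * N + 1) ≤ N := by simpa only [Nat.card_eq_fintype_card] using h
  omega

lemma exists_zero_coprimeField (hq : Fintype.card 𝔽 = p ^ a)
    (c : Fin 5 → Fin 5 → Fin 5 → coprimeField 𝕜 p a) : ∃ y, F c y = 0 ∧ y ≠ 0 := by
  obtain ⟨m, hm, c', hc⟩ := exists_toCoprimeField_comp_eq hq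
    (fun i : Fin 5 × Fin 5 × Fin 5 => c i.1 i.2.1 i.2.2)
  obtain rfl : mapc (toCoprimeField hq hm) (fun i j k => c' (i, j, k)) = c := by
    funext i j k
    exact congrFun hc (i, j, k)
  have := finite_frobeniusFixed (𝔽 := 𝔽) (𝕜 := 𝕜) (m := m) (by rintro rfl; exact hm (by simp))
  obtain ⟨y, hy, hy0⟩ := exists_zero_of_finite (fun i j k => c' (i, j, k)) (by simp)
  refine ⟨toCoprimeField hq hm ∘ y, by rw [F_map, hy, map_zero], fun h => hy0 ?_⟩
  funext i
  exact (map_eq_zero_iff _ (toCoprimeField hq hm).injective).mp (congrFun h i)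

/-- A smooth cubic over a finite field contains a line over an extension of degree prime to 3. -/
theorem exists_isLine_of_not_three_dvd {n : ℕ} (hn : 5 ≤ n) {c : Fin n → Fin n → Fin n → 𝔽}
    (hs : Smooth (mapc (algebraMap 𝔽 𝕜) c)) :
    ∃ m, ¬ 3 ∣ m ∧ ∃ v w, IsLine (mapc (algebraMap 𝔽 (frobeniusFixed 𝔽 𝕜 m)) c) v w := by
  obtain ⟨p, hp⟩ := CharP.exists 𝔽
  have := charP_of_injective_algebraMap (algebraMap 𝔽 𝕜).injective p
  obtain ⟨a, ha, hp', hq⟩ : ∃ a : ℕ, a ≠ 0 ∧ p.Prime ∧ Fintype.card 𝔽 = p ^ a :=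
    let ⟨a, h⟩ := FiniteField.card 𝔽 p
    ⟨a, a.ne_zero, h⟩
  have : Fact p.Prime := ⟨hp'⟩
  have := infinite_coprimeField (𝕜 := 𝕜) hq
  let κ : 𝔽 →+* coprimeField 𝕜 p a :=
    (toCoprimeField hq (m := 1) (by norm_num)).comp (algebraMap 𝔽 (frobeniusFixed 𝔽 𝕜 1))
  obtain ⟨v, w, h⟩ := exists_isLine_of_le (K := coprimeField 𝕜 p a) (𝕜 := 𝕜) (fun c hc => by
      obtain ⟨y, hy, hy0⟩ := exists_zero_coprimeField hq c
      exact exists_isLine_of_smooth p hc (hasLowFactors_coprimeField 𝕜 p ha)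
        quadraticallyClosedIn_coprimeField (fun _ => exists_sq_eq_coprimeField) hy hy0)
    hn (mapc κ c) hs
  obtain ⟨m, hm, u, hu⟩ := exists_toCoprimeField_comp_eq hq (Sum.elim v w)
  refine ⟨m, hm, u ∘ Sum.inl, u ∘ Sum.inr,
    IsLine.of_comp (toCoprimeField hq hm).injective (?_ : IsLine (mapc κ c) _ _)⟩
  rw [← Function.comp_assoc, ← Function.comp_assoc, hu]
  exact h

/-- A cubic of dimension at least 3 over a finite field contains a line over the cubic extension. -/
theorem exists_isLine_three {n : ℕ} (hn : 5 ≤ n) (c : Fin n → Fin n → Fin n → 𝔽) :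
    ∃ v w, IsLine (mapc (algebraMap 𝔽 (frobeniusFixed 𝔽 𝕜 3)) c) v w := by
  obtain ⟨v, w, h⟩ := exists_isLine_frobeniusFixed_three 𝕜
    (pullback c fun i : Fin 5 => Pi.single (Fin.castLE hn i) 1)
  rw [mapc_pullback] at h
  refine ⟨_, _, h.of_pullback fun x hx => funext fun i => ?_⟩
  have := congrFun hx (Fin.castLE hn i)
  simpa [linComb, Pi.single_apply] using this

end FiniteField

end CubicLines

/-- **Lemma 1 (Fano, Altman–Kleiman + Lang–Weil).**
Let `𝔽` be a finite field, `n ≥ 4`, and `f` a homogeneous polynomial of degree 3 in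
`n+1` variables over `𝔽` defining a smooth cubic hypersurface `X ⊂ Pⁿ_𝔽`.
Then the gcd of the degrees `[L:𝔽]` of the finite extensions `L/𝔽` over which `X`
contains an `L`-line equals `1`; equivalently, every natural number dividing all such
degrees equals `1`. -/
theorem gcd_degrees_of_line_fields_eq_one
    (𝔽 : Type) [Field 𝔽] [Fintype 𝔽] (n : ℕ) (hn : 4 ≤ n)
    (f : MvPolynomial (Fin (n + 1)) 𝔽) (hf : f.IsHomogeneous 3)
    (hsmooth : ¬ ∃ x : Fin (n + 1) → AlgebraicClosure 𝔽, x ≠ 0 ∧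
      MvPolynomial.aeval x f = 0 ∧
      ∀ i, MvPolynomial.aeval x (MvPolynomial.pderiv i f) = 0)
    (d : ℕ)
    (hd : ∀ (L : Type) [Field L] [Algebra 𝔽 L] [FiniteDimensional 𝔽 L],
      (∃ v w : Fin (n + 1) → L, LinearIndependent L ![v, w] ∧
        ∀ s t : L, MvPolynomial.aeval (fun i => s * v i + t * w i) f = 0) →
      d ∣ Module.finrank 𝔽 L) :
    d = 1 := by
  obtain ⟨c, rfl⟩ := CubicLines.exists_eq_F hf
  have key (m : ℕ) (hm : m ≠ 0) (h : ∃ v w, CubicLines.IsLine (CubicLines.mapc (algebraMap 𝔽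
      (CubicLines.frobeniusFixed 𝔽 (AlgebraicClosure 𝔽) m)) c) v w) : d ∣ m := by
    have := CubicLines.finite_frobeniusFixed (𝔽 := 𝔽) (𝕜 := AlgebraicClosure 𝔽) hm
    obtain ⟨v, w, h⟩ := h
    rw [← CubicLines.finrank_frobeniusFixed (𝔽 := 𝔽) (𝕜 := AlgebraicClosure 𝔽) hm]
    exact hd _ ⟨v, w, h.aeval_eq_zero⟩
  have h3 := key 3 (by norm_num) (CubicLines.exists_isLine_three (by omega) c)
  obtain ⟨m, hm, h⟩ := CubicLines.exists_isLine_of_not_three_dvd (by omega)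
    (CubicLines.smooth_of_aeval hsmooth)
  rcases (Nat.dvd_prime Nat.prime_three).mp h3 with rfl | rfl
  · rfl
  · exact absurd (key m (by rintro rfl; exact hm (by simp)) h) hm
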